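/- Assume (T1) α|μ| > |1−αδ|, (T2) μ² > 4(1−αδ), (T3) μ > 0, and fix x < x_c := arctanh(T_c). Then there exists t₀ > 0 and a unique smooth function t ↦ q(x,t) on (−t₀, t₀) with q(x,0) = 𝔷(x), Im q(x,t) > 0, and M₀(q(x,t), conj q(x,t); x, t) = 0 = M₁(q(x,t), conj q(x,t); x, t) for all |t| < t₀. Moreover, for t > 0 this solution extends smoothly for as long as Im q(x,t) remains positive: if the maximal interval of smooth continuation in t > 0 has a finite right endpoint t*, then Im q(x,t) → 0 as t ↑ t*. -/

import Mathlib

open Complex Real Filter Set MeasureTheory ComplexConjugate Topology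

noncomputable section

/-- The inverse hyperbolic tangent. -/
def arctanh (x : ℝ) : ℝ := Real.log ((1 + x) / (1 - x)) / 2

/-- The hyperbolic secant. -/
def sech (x : ℝ) : ℝ := 1 / Real.cosh x

/-- The point `z_P = (1-αδ+αμ)/4`. -/
def zP (α δ μ : ℝ) : ℝ := (1 - α*δ + α*μ)/4

/-- The point `z_∞ = (1-αδ-αμ)/4`. -/
def zInf (α δ μ : ℝ) : ℝ := (1 - α*δ - α*μ)/4

/-- The discriminant `α⁴ + α²μ²/4 − α²(1−αδ)`. -/
def discrm (α δ μ : ℝ) : ℝ := α^4 + α^2*μ^2/4 - α^2*(1 - α*δ)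

/-- The point `z⁺`. -/
def zplus (α δ μ : ℝ) : ℝ := (1/2)*((1 - α*δ)/2 - α^2 + Real.sqrt (discrm α δ μ))

/-- The point `z⁻ = z_L`. -/
def zminus (α δ μ : ℝ) : ℝ := (1/2)*((1 - α*δ)/2 - α^2 - Real.sqrt (discrm α δ μ))

/-- `Ω(z) = (2/(iα))(z − (1−αδ)/4)`. -/
def Omg (α δ : ℝ) (z : ℂ) : ℂ := (2 / (Complex.I * α)) * (z - (1 - α * δ) / 4)

/-- `R(z) = e^{iπ/4}(−i(16z−μ²))^{1/2}` (principal branch). -/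
def Rf (μ : ℝ) (z : ℂ) : ℂ :=
  Complex.exp (Complex.I * (π : ℂ) / 4) * (-Complex.I * (16 * z - (μ:ℂ)^2)) ^ ((1:ℂ)/2)

/-- The reflection coefficient `s(z)` (Gamma-function formula). -/
def sRef (α δ μ ε : ℝ) (z : ℂ) : ℂ :=
  -(((2:ℂ) ^ (-(Complex.I * (μ:ℂ)) / (ε:ℂ)) * Complex.I * (ε:ℂ)) /
      (2 * Complex.exp (Complex.I * (π : ℂ) / 4) * (-Complex.I * z) ^ ((1:ℂ)/2))) *
    (Complex.Gamma (1/2 - Complex.I * (μ:ℂ) / (2*ε) - Omg α δ z / ε) /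
      Complex.Gamma (1/2 + Complex.I * (μ:ℂ) / (2*ε) + Omg α δ z / ε)) *
    ((Complex.Gamma (1/2 + Omg α δ z / ε - Rf μ z / (2*ε)) *
      Complex.Gamma (1/2 + Omg α δ z / ε + Rf μ z / (2*ε))) /
      (Complex.Gamma (-(Complex.I * (μ:ℂ)) / (2*ε) - Rf μ z / (2*ε)) *
        Complex.Gamma (-(Complex.I * (μ:ℂ)) / (2*ε) + Rf μ z / (2*ε))))

/-- The phase function `Φ(z)` obtained from Stirling asymptotics (principal branches). -/
def Phi (α δ μ : ℝ) (z : ℂ) : ℂ :=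
  -(μ:ℂ) * Complex.log 2
  + (4/(α:ℂ)) * (z - (zP α δ μ : ℂ)) * Complex.log ((2/(α:ℂ)) * ((zP α δ μ : ℂ) - z))
  + (((μ:ℂ) - Complex.I * Rf μ z)/2) * Complex.log ((-Complex.I * (μ:ℂ) - Rf μ z)/2)
  + (((μ:ℂ) + Complex.I * Rf μ z)/2) * Complex.log ((-Complex.I * (μ:ℂ) + Rf μ z)/2)
  - Complex.I * (Omg α δ z - Rf μ z / 2) * Complex.log (Omg α δ z - Rf μ z / 2)
  - Complex.I * (Omg α δ z + Rf μ z / 2) * Complex.log (Omg α δ z + Rf μ z / 2)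

/-- `A = (1−αδ)/(4α²)`. -/
def Acoef (α δ : ℝ) : ℝ := (1 - α*δ)/(4*α^2)

/-- `B = μ/(4α)`. -/
def Bcoef (α μ : ℝ) : ℝ := μ/(4*α)

/-- `T_c = 2B − √(4B²−4A+1)`. -/
def Tcrit (α δ μ : ℝ) : ℝ :=
  2*Bcoef α μ - Real.sqrt (4*(Bcoef α μ)^2 - 4*Acoef α δ + 1)

/-- The initial Madelung density `ρ₀ = sech² x`. -/
def rho0 (x : ℝ) : ℝ := (sech x)^2

/-- The initial Madelung velocity `u₀ = δ + μ tanh x`. -/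
def u0 (δ μ : ℝ) (x : ℝ) : ℝ := δ + μ*Real.tanh x

/-- The WKB characteristic quadratic `χ(x;z) = (4z−1+αu₀(x))² + 16α²z·ρ₀(x)` (in `z ∈ ℂ`). -/
def chiC (α δ μ : ℝ) (x : ℝ) (z : ℂ) : ℂ :=
  (4*z - 1 + ((α * u0 δ μ x : ℝ) : ℂ))^2 + ((16*α^2*rho0 x : ℝ) : ℂ) * z

/-- The point at parameter `u` on the oriented segment `𝓑` from `q` to `z_P`. -/
def segB (α δ μ : ℝ) (q : ℂ) (u : ℝ) : ℂ := q + (u:ℂ) * ((zP α δ μ : ℂ) - q)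

/-- Characterization of the branch `S(z)` of `√((z−q)(z−conj q))` with branch cut
`𝓑 ∪ 𝓑*`, normalized by `S(z) = z + O(1)` at infinity (equivalently `S > 0` on
`(z_P, ∞)`), together with its boundary value `S₊` taken from the left of `𝓑`. -/
def SSpec (α δ μ : ℝ) (q : ℂ) (S Splus : ℂ → ℂ) : Prop :=
  DifferentiableOn ℂ S
    ((segB α δ μ q '' Set.Icc 0 1 ∪ segB α δ μ (conj q) '' Set.Icc 0 1)ᶜ) ∧
  (∀ z ∈ (segB α δ μ q '' Set.Icc 0 1 ∪ segB α δ μ (conj q) '' Set.Icc 0 1)ᶜ,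
    S z ^ 2 = (z - q) * (z - conj q)) ∧
  (∀ x : ℝ, zP α δ μ < x → S (x:ℂ) = (Real.sqrt ((x - q.re)^2 + q.im^2) : ℂ)) ∧
  (∀ u : ℝ, 0 < u → u < 1 →
    Filter.Tendsto
      (fun d : ℝ => S (segB α δ μ q u + (d:ℂ) * Complex.I * ((zP α δ μ : ℂ) - q)))
      (𝓝[>] 0) (𝓝 (Splus (segB α δ μ q u))))

/-- The moment `I_p(q, conj q) = Im ∫_𝓑 Φ′(s) s^p / S₊(s) ds`. -/
def Ip (α δ μ : ℝ) (q : ℂ) (Splus : ℂ → ℂ) (p : ℕ) : ℝ :=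
  (∫ u in (0:ℝ)..1,
      deriv (Phi α δ μ) (segB α δ μ q u) * (segB α δ μ q u)^p / Splus (segB α δ μ q u)
        * ((zP α δ μ : ℂ) - q)).im

/-- `M₀(q, conj q; x, t) = (2π/α²)(2(q+conj q)t + αx − t) + I₀`. -/
def M0 (α δ μ : ℝ) (q : ℂ) (Splus : ℂ → ℂ) (x t : ℝ) : ℝ :=
  (2*π/α^2) * (2*(2*q.re)*t + α*x - t) + Ip α δ μ q Splus 0

/-- `M₁(q, conj q; x, t) = (π/α²)((3q² + 2|q|² + 3(conj q)²)t + (q+conj q)(αx−t)) + I₁`. -/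
def M1 (α δ μ : ℝ) (q : ℂ) (Splus : ℂ → ℂ) (x t : ℝ) : ℝ :=
  (π/α^2) * ((6*(q^2).re + 2*‖q‖^2)*t + (2*q.re)*(α*x - t))
    + Ip α δ μ q Splus 1

/-- `M₀` built from an abstract moment function `I₀`. -/
def M0abs (α : ℝ) (I0 : ℂ → ℝ) (q : ℂ) (x t : ℝ) : ℝ :=
  (2*π/α^2) * (2*(2*q.re)*t + α*x - t) + I0 q

/-- `M₁` built from an abstract moment function `I₁`. -/
def M1abs (α : ℝ) (I1 : ℂ → ℝ) (q : ℂ) (x t : ℝ) : ℝ :=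
  (π/α^2) * ((6*(q^2).re + 2*‖q‖^2)*t + (2*q.re)*(α*x - t)) + I1 q

/-- The squared distance quartic on the elliptic curve attached to the initial data. -/
def quart (α μ r T k : ℝ) : ℝ :=
  ((r^2 + 4*α*r - k^2)/4 + α*μ*T)^2 + α^2*(μ^2 - k^2)*(1 - T^2)

/-- Leading coefficient of the auxiliary cubic. -/
def cubLead (α μ r T : ℝ) : ℝ := (r + μ)/4 + α*(1 - T)/2

/-- The quadratic polynomial cutting the quartic curve. -/
def conic (α μ r T k : ℝ) : ℝ :=
  k^2/4 - 2*cubLead α μ r T*k + (μ*r/2 + α*μ + r^2/4 + α*r)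

/-- Coefficients of the pencil of quadratics `A ρ² + B ρ + C`. -/
def pencA (α μ r T h : ℝ) : ℝ := cubLead α μ r T + h/2

def pencB (α μ r T h : ℝ) : ℝ :=
  -cubLead α μ r T*(r + 4*α + μ) - 4*h*cubLead α μ r T - h^2

def pencC (α μ r T h : ℝ) : ℝ :=
  cubLead α μ r T*(r + 4*α)*μ + 2*h*(μ*r/2 + α*μ + r^2/4 + α*r) + h^2*r

def pencD (α μ r T h : ℝ) : ℝ :=
  pencB α μ r T h^2 - 4*pencA α μ r T h*pencC α μ r T h

/-- The smaller root of the pencil. -/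
def pencLo (α μ r T h : ℝ) : ℝ :=
  (-pencB α μ r T h - √(pencD α μ r T h))/(2*pencA α μ r T h)

/-- The larger root of the pencil. -/
def pencHi (α μ r T h : ℝ) : ℝ :=
  (-pencB α μ r T h + √(pencD α μ r T h))/(2*pencA α μ r T h)

lemma quart_sub_conic_sq (α μ r T k : ℝ) :
    quart α μ r T k - conic α μ r T k^2
      = cubLead α μ r T*(k - r)*(k - (r + 4*α))*(k - μ) := by
  unfold quart conic cubLead; ring

lemma pencil_mul (α μ r T h k : ℝ) :
    (k - r)*(pencA α μ r T h*k^2 + pencB α μ r T h*k + pencC α μ r T h)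
      = quart α μ r T k - (conic α μ r T k - h*(k - r))^2 := by
  have := quart_sub_conic_sq α μ r T k
  unfold pencA pencB pencC conic at *
  linear_combination -this

lemma quart_at_left (α μ r T : ℝ) : quart α μ r T r = (α*(μ + r*T))^2 := by
  unfold quart; ring

lemma quart_at_right (α μ r T : ℝ) : quart α μ r T (r + 4*α) = (α*(μ - (r + 4*α)*T))^2 := by
  unfold quart; ring

lemma conic_at_left (α μ r T : ℝ) : conic α μ r T r = α*(μ + r*T) := by
  unfold conic cubLead; ring

lemma conic_at_right (α μ r T : ℝ) : conic α μ r T (r + 4*α) = -(α*(μ - (r + 4*α)*T)) := by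
  unfold conic cubLead; ring

lemma conic_at_mid (α μ r T : ℝ) :
    conic α μ r T μ = -((μ^2 - (r^2 + 4*α*r))/4 - α*μ*T) := by
  unfold conic cubLead; ring

/-- Admissible parameters for the pencil. -/
structure PencilData (α μ r T : ℝ) : Prop where
  hα : 0 < α
  hr : 0 < r
  hrμ : r < μ
  hμR : μ < r + 4*α
  hT1 : -1 < T
  hT2 : T < 1
  hX : ∀ k, 0 < quart α μ r T k
  hmid : 0 < (μ^2 - (r^2 + 4*α*r))/4 - α*μ*T
  hright : 0 < μ - (r + 4*α)*T

namespace PencilData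

variable {α μ r T : ℝ}

lemma cubLead_pos (H : PencilData α μ r T) : 0 < cubLead α μ r T := by
  unfold cubLead
  have := mul_pos H.hα (sub_pos.2 H.hT2)
  have := H.hr; have := H.hrμ
  linarith

lemma pencA_pos (H : PencilData α μ r T) {h : ℝ} (hh : 0 ≤ h) : 0 < pencA α μ r T h := by
  have := H.cubLead_pos
  unfold pencA; linarith

lemma conic_left_pos (H : PencilData α μ r T) : 0 < conic α μ r T r := by
  rw [conic_at_left]
  refine mul_pos H.hα ?_
  have := mul_lt_mul_of_pos_left H.hT1 H.hr
  have := H.hrμ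
  linarith

lemma conic_right_neg (H : PencilData α μ r T) : conic α μ r T (r + 4*α) < 0 := by
  rw [conic_at_right]
  have := mul_pos H.hα H.hright
  linarith

lemma conic_mid_neg (H : PencilData α μ r T) : conic α μ r T μ < 0 := by
  rw [conic_at_mid]
  have := H.hmid
  linarith

lemma pencil_left_pos (H : PencilData α μ r T) {h : ℝ} (hh : 0 ≤ h) :
    0 < pencA α μ r T h*r^2 + pencB α μ r T h*r + pencC α μ r T h := by
  have e : pencA α μ r T h*r^2 + pencB α μ r T h*r + pencC α μ r T h
      = cubLead α μ r T*(4*α)*(μ - r) + 2*h*conic α μ r T r := by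
    unfold pencA pencB pencC conic; ring
  rw [e]
  have h1 := mul_pos (mul_pos H.cubLead_pos (by linarith [H.hα] : 0 < 4*α)) (sub_pos.2 H.hrμ)
  have h2 := mul_nonneg hh H.conic_left_pos.le
  nlinarith

lemma pencil_mid_nonpos (H : PencilData α μ r T) {h : ℝ} (hh : 0 ≤ h) :
    pencA α μ r T h*μ^2 + pencB α μ r T h*μ + pencC α μ r T h ≤ 0 := by
  have e : pencA α μ r T h*μ^2 + pencB α μ r T h*μ + pencC α μ r T h
      = h*(2*conic α μ r T μ - h*(μ - r)) := by
    unfold pencA pencB pencC conic; ring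
  rw [e]
  have := mul_nonneg hh (sub_pos.2 H.hrμ).le
  exact mul_nonpos_of_nonneg_of_nonpos hh (by linarith [H.conic_mid_neg])

lemma pencil_right_nonpos (H : PencilData α μ r T) {h : ℝ} (hh : 0 ≤ h) :
    pencA α μ r T h*(r + 4*α)^2 + pencB α μ r T h*(r + 4*α) + pencC α μ r T h ≤ 0 := by
  have e : pencA α μ r T h*(r + 4*α)^2 + pencB α μ r T h*(r + 4*α) + pencC α μ r T h
      = h*(2*conic α μ r T (r + 4*α) - h*(4*α)) := by
    unfold pencA pencB pencC conic; ring
  rw [e]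
  have := mul_nonneg hh (by linarith [H.hα] : 0 ≤ 4*α)
  exact mul_nonpos_of_nonneg_of_nonpos hh (by linarith [H.conic_right_neg])

end PencilData

/-- A quadratic with nonpositive values at two distinct points has positive discriminant. -/
lemma discr_pos_of_nonpos {A B C u v : ℝ} (hA : 0 < A) (huv : u < v)
    (hu : A*u^2 + B*u + C ≤ 0) (hv : A*v^2 + B*v + C ≤ 0) : 0 < B^2 - 4*A*C := by
  by_contra! hc
  have h1 : (2*A*u + B)^2 ≤ 0 := by nlinarith
  have h2 : (2*A*v + B)^2 ≤ 0 := by nlinarith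
  have h3 : 2*A*u + B = 0 := by nlinarith
  have h4 : 2*A*v + B = 0 := by nlinarith
  nlinarith

lemma quadratic_roots_bounds {A B C u v : ℝ} (hA : 0 < A) (huv : u < v)
    (hu : A*u^2 + B*u + C ≤ 0) (hv : A*v^2 + B*v + C ≤ 0) :
    (-B - √(B^2 - 4*A*C))/(2*A) ≤ u ∧ v ≤ (-B + √(B^2 - 4*A*C))/(2*A) := by
  have hd := discr_pos_of_nonpos hA huv hu hv
  have hs := Real.sq_sqrt hd.le
  have hs0 := Real.sqrt_nonneg (B^2 - 4*A*C)
  have h1 : |2*A*u + B| ≤ √(B^2 - 4*A*C) := Real.abs_le_sqrt (by nlinarith)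
  have h2 : |2*A*v + B| ≤ √(B^2 - 4*A*C) := Real.abs_le_sqrt (by nlinarith)
  rw [abs_le] at h1 h2
  rw [div_le_iff₀ (by positivity), le_div_iff₀ (by positivity)]
  constructor <;> linarith

namespace PencilData

variable {α μ r T : ℝ}

lemma pencD_pos (H : PencilData α μ r T) {h : ℝ} (hh : 0 ≤ h) : 0 < pencD α μ r T h :=
  discr_pos_of_nonpos (H.pencA_pos hh) H.hμR (H.pencil_mid_nonpos hh) (H.pencil_right_nonpos hh)

lemma pencLo_le (H : PencilData α μ r T) {h : ℝ} (hh : 0 ≤ h) : pencLo α μ r T h ≤ μ :=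
  (quadratic_roots_bounds (H.pencA_pos hh) H.hμR (H.pencil_mid_nonpos hh)
    (H.pencil_right_nonpos hh)).1

lemma le_pencHi (H : PencilData α μ r T) {h : ℝ} (hh : 0 ≤ h) : r + 4*α ≤ pencHi α μ r T h :=
  (quadratic_roots_bounds (H.pencA_pos hh) H.hμR (H.pencil_mid_nonpos hh)
    (H.pencil_right_nonpos hh)).2

lemma pencLo_root {h : ℝ} (hA : 0 < pencA α μ r T h) (hD : 0 ≤ pencD α μ r T h) :
    pencA α μ r T h*(pencLo α μ r T h)^2 + pencB α μ r T h*pencLo α μ r T h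
      + pencC α μ r T h = 0 := by
  have hs := Real.sq_sqrt hD
  have e : 2*pencA α μ r T h*pencLo α μ r T h + pencB α μ r T h = -√(pencD α μ r T h) := by
    unfold pencLo; field_simp; ring
  have : 4*pencA α μ r T h*(pencA α μ r T h*(pencLo α μ r T h)^2
      + pencB α μ r T h*pencLo α μ r T h + pencC α μ r T h) = 0 := by
    have e2 := congrArg (· ^ 2) e
    simp only [neg_sq] at e2
    rw [hs] at e2
    unfold pencD at e2
    linear_combination e2
  rcases mul_eq_zero.1 this with h1 | h1
  · linarith
  · exact h1

lemma pencHi_root {h : ℝ} (hA : 0 < pencA α μ r T h) (hD : 0 ≤ pencD α μ r T h) :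
    pencA α μ r T h*(pencHi α μ r T h)^2 + pencB α μ r T h*pencHi α μ r T h
      + pencC α μ r T h = 0 := by
  have hs := Real.sq_sqrt hD
  have e : 2*pencA α μ r T h*pencHi α μ r T h + pencB α μ r T h = √(pencD α μ r T h) := by
    unfold pencHi; field_simp; ring
  have : 4*pencA α μ r T h*(pencA α μ r T h*(pencHi α μ r T h)^2
      + pencB α μ r T h*pencHi α μ r T h + pencC α μ r T h) = 0 := by
    have e2 := congrArg (· ^ 2) e
    rw [hs] at e2
    unfold pencD at e2
    linear_combination e2
  rcases mul_eq_zero.1 this with h1 | h1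
  · linarith
  · exact h1

lemma lt_pencLo (H : PencilData α μ r T) {h : ℝ} (hh : 0 ≤ h) : r < pencLo α μ r T h := by
  have hA := H.pencA_pos hh
  have hD := H.pencD_pos hh
  have hP := H.pencil_left_pos hh
  have hs := Real.sq_sqrt hD.le
  have h3 := H.le_pencHi hh
  have h4 := H.hμR
  have h5 := H.hrμ
  have hf : pencA α μ r T h*r^2 + pencB α μ r T h*r + pencC α μ r T h
      = pencA α μ r T h*((r - pencLo α μ r T h)*(r - pencHi α μ r T h)) := by
    unfold pencLo pencHi
    field_simp
    unfold pencD at hs ⊢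
    linear_combination hs
  rw [hf] at hP
  have := (mul_pos_iff_of_pos_left hA).1 hP
  by_contra! hc
  nlinarith [mul_nonneg (sub_nonneg.2 hc) (by linarith : 0 ≤ pencHi α μ r T h - r)]

/-- On either root of the pencil the square root of the quartic is explicit. -/
lemma sqrt_quart_eq (H : PencilData α μ r T) {h k : ℝ} (hh : 0 ≤ h)
    (hroot : pencA α μ r T h*k^2 + pencB α μ r T h*k + pencC α μ r T h = 0)
    (hrk : r < k) (hk : 0 ≤ (k - (r + 4*α))*(k - μ)) :
    √(quart α μ r T k) = h*(k - r) - conic α μ r T k := by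
  have h1 := pencil_mul α μ r T h k
  rw [hroot, mul_zero] at h1
  have hsq : quart α μ r T k = (h*(k - r) - conic α μ r T k)^2 := by linear_combination -h1
  rw [hsq, Real.sqrt_sq]
  have h2 := quart_sub_conic_sq α μ r T k
  have h3 : 0 ≤ h*((k - r)*h - 2*conic α μ r T k) := by
    have e : (k - r)*(h*((k - r)*h - 2*conic α μ r T k))
        = (k - r)*(cubLead α μ r T*((k - (r + 4*α))*(k - μ))) := by
      linear_combination hsq.symm.trans (eq_add_of_sub_eq h2)
    have e' := mul_left_cancel₀ (sub_pos.2 hrk).ne' e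
    rw [e']
    exact mul_nonneg H.cubLead_pos.le hk
  by_contra! hc
  rcases hh.eq_or_lt with h0 | h0
  · subst h0
    simp only [zero_mul, zero_sub] at hc hsq
    have hroot0 : cubLead α μ r T*((k - (r + 4*α))*(k - μ)) = 0 := by
      unfold pencA pencB pencC at hroot
      linear_combination hroot
    rcases mul_eq_zero.1 ((mul_eq_zero.1 hroot0).resolve_left H.cubLead_pos.ne') with h5 | h5
    · have : k = r + 4*α := by linarith
      subst this
      linarith [H.conic_right_neg]
    · have : k = μ := by linarith
      subst this
      linarith [H.conic_mid_neg]
  · have h4 : 0 ≤ (k - r)*h - 2*conic α μ r T k := by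
      by_contra! hc'
      nlinarith
    have h5 : 0 < h*(k - r) := mul_pos h0 (sub_pos.2 hrk)
    linarith

lemma sqrt_quart_lo (H : PencilData α μ r T) {h : ℝ} (hh : 0 ≤ h) :
    √(quart α μ r T (pencLo α μ r T h))
      = h*(pencLo α μ r T h - r) - conic α μ r T (pencLo α μ r T h) := by
  refine H.sqrt_quart_eq hh (pencLo_root (H.pencA_pos hh) (H.pencD_pos hh).le) (H.lt_pencLo hh) ?_
  have h1 := H.pencLo_le hh
  have h2 := H.hμR
  exact mul_nonneg_of_nonpos_of_nonpos (by linarith) (by linarith)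

lemma sqrt_quart_hi (H : PencilData α μ r T) {h : ℝ} (hh : 0 ≤ h) :
    √(quart α μ r T (pencHi α μ r T h))
      = h*(pencHi α μ r T h - r) - conic α μ r T (pencHi α μ r T h) := by
  have h1 := H.le_pencHi hh
  have h2 := H.hμR
  have h3 := H.hα
  refine H.sqrt_quart_eq hh (pencHi_root (H.pencA_pos hh) (H.pencD_pos hh).le) (by linarith) ?_
  exact mul_nonneg (by linarith) (by linarith)

lemma hasDerivAt_pencA (α μ r T h : ℝ) : HasDerivAt (pencA α μ r T) (1/2) h := by
  unfold pencA
  simpa using ((hasDerivAt_id h).div_const 2).const_add (cubLead α μ r T)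

lemma hasDerivAt_pencB (α μ r T h : ℝ) :
    HasDerivAt (pencB α μ r T) (-4*cubLead α μ r T - 2*h) h := by
  have := (((hasDerivAt_id' h).const_mul 4).mul_const (cubLead α μ r T)).const_sub
    (-cubLead α μ r T*(r + 4*α + μ)) |>.sub (hasDerivAt_pow 2 h)
  refine HasDerivAt.congr_deriv (f := pencB α μ r T) this ?_
  simp

lemma hasDerivAt_pencC (α μ r T h : ℝ) :
    HasDerivAt (pencC α μ r T) (2*(μ*r/2 + α*μ + r^2/4 + α*r) + 2*h*r) h := by
  have := (((hasDerivAt_id' h).const_mul 2).mul_const (μ*r/2 + α*μ + r^2/4 + α*r)).const_add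
    (cubLead α μ r T*(r + 4*α)*μ) |>.add ((hasDerivAt_pow 2 h).mul_const r)
  refine HasDerivAt.congr_deriv (f := pencC α μ r T) this ?_
  simp

lemma differentiableAt_pencD (α μ r T h : ℝ) : DifferentiableAt ℝ (pencD α μ r T) h := by
  unfold pencD
  have h1 := (hasDerivAt_pencA α μ r T h).differentiableAt
  have h2 := (hasDerivAt_pencB α μ r T h).differentiableAt
  have h3 := (hasDerivAt_pencC α μ r T h).differentiableAt
  exact (h2.pow 2).sub ((h1.const_mul 4).mul h3)

/-- Derivative of a root of the pencil, by implicit differentiation. -/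
lemma hasDerivAt_root {ρ : ℝ → ℝ} {h : ℝ} (hρ : DifferentiableAt ℝ ρ h)
    (hroot : ∀ᶠ s in 𝓝 h,
      pencA α μ r T s*(ρ s)^2 + pencB α μ r T s*ρ s + pencC α μ r T s = 0)
    (hne : 2*pencA α μ r T h*ρ h + pencB α μ r T h ≠ 0) :
    HasDerivAt ρ (2*(h*(ρ h - r) - conic α μ r T (ρ h))
      /(2*pencA α μ r T h*ρ h + pencB α μ r T h)) h := by
  have hd := hρ.hasDerivAt
  have h1 := ((hasDerivAt_pencA α μ r T h).mul (hd.pow 2)).add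
    ((hasDerivAt_pencB α μ r T h).mul hd) |>.add (hasDerivAt_pencC α μ r T h)
  have h2 : HasDerivAt (fun s => pencA α μ r T s*(ρ s)^2 + pencB α μ r T s*ρ s
      + pencC α μ r T s) 0 h := by
    refine (hasDerivAt_const h (0:ℝ)).congr_of_eventuallyEq ?_
    filter_upwards [hroot] with s hs using hs
  have h3 := h1.unique h2
  refine hd.congr_deriv ?_
  rw [eq_div_iff hne]
  simp only [Nat.cast_ofNat, Nat.add_one_sub_one, pow_one, Pi.pow_apply] at h3
  unfold conic
  linear_combination h3

lemma hasDerivAt_pencLo (H : PencilData α μ r T) {h : ℝ} (hh : 0 ≤ h) :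
    HasDerivAt (pencLo α μ r T)
      (-(2*√(quart α μ r T (pencLo α μ r T h))/√(pencD α μ r T h))) h := by
  have hA := H.pencA_pos hh
  have hD := H.pencD_pos hh
  have e : 2*pencA α μ r T h*pencLo α μ r T h + pencB α μ r T h = -√(pencD α μ r T h) := by
    unfold pencLo; field_simp; ring
  have hne : 2*pencA α μ r T h*pencLo α μ r T h + pencB α μ r T h ≠ 0 := by
    rw [e]; exact neg_ne_zero.2 (Real.sqrt_ne_zero'.2 hD)
  have cA := (hasDerivAt_pencA α μ r T h).continuousAt
  have cD := (differentiableAt_pencD α μ r T h)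
  have hdiff : DifferentiableAt ℝ (pencLo α μ r T) h := by
    unfold pencLo
    refine DifferentiableAt.div ?_ ?_ (by positivity)
    · exact (hasDerivAt_pencB α μ r T h).differentiableAt.neg.sub (cD.sqrt hD.ne')
    · exact (hasDerivAt_pencA α μ r T h).differentiableAt.const_mul 2
  have := hasDerivAt_root hdiff (by
    filter_upwards [cA.eventually_const_lt hA, cD.continuousAt.eventually_const_lt hD]
      with s hs1 hs2
    exact pencLo_root hs1 hs2.le) hne
  refine this.congr_deriv ?_
  rw [e, H.sqrt_quart_lo hh, div_neg]

lemma hasDerivAt_pencHi (H : PencilData α μ r T) {h : ℝ} (hh : 0 ≤ h) :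
    HasDerivAt (pencHi α μ r T)
      (2*√(quart α μ r T (pencHi α μ r T h))/√(pencD α μ r T h)) h := by
  have hA := H.pencA_pos hh
  have hD := H.pencD_pos hh
  have e : 2*pencA α μ r T h*pencHi α μ r T h + pencB α μ r T h = √(pencD α μ r T h) := by
    unfold pencHi; field_simp; ring
  have hne : 2*pencA α μ r T h*pencHi α μ r T h + pencB α μ r T h ≠ 0 := by
    rw [e]; exact Real.sqrt_ne_zero'.2 hD
  have cA := (hasDerivAt_pencA α μ r T h).continuousAt
  have cD := (differentiableAt_pencD α μ r T h)
  have hdiff : DifferentiableAt ℝ (pencHi α μ r T) h := by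
    unfold pencHi
    refine DifferentiableAt.div ?_ ?_ (by positivity)
    · exact (hasDerivAt_pencB α μ r T h).differentiableAt.neg.add (cD.sqrt hD.ne')
    · exact (hasDerivAt_pencA α μ r T h).differentiableAt.const_mul 2
  have := hasDerivAt_root hdiff (by
    filter_upwards [cA.eventually_const_lt hA, cD.continuousAt.eventually_const_lt hD]
      with s hs1 hs2
    exact pencHi_root hs1 hs2.le) hne
  refine this.congr_deriv ?_
  rw [e, H.sqrt_quart_hi hh]

lemma pencLo_add_pencHi {h : ℝ} (hA : 0 < pencA α μ r T h) :
    pencLo α μ r T h + pencHi α μ r T h = -pencB α μ r T h/pencA α μ r T h := by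
  unfold pencLo pencHi; field_simp; ring

lemma pencHi_sub_pencLo {h : ℝ} (hA : 0 < pencA α μ r T h) :
    pencHi α μ r T h - pencLo α μ r T h = √(pencD α μ r T h)/pencA α μ r T h := by
  unfold pencLo pencHi; field_simp; ring

lemma pencLo_zero (H : PencilData α μ r T) : pencLo α μ r T 0 = μ := by
  have hD : pencD α μ r T 0 = (cubLead α μ r T*(r + 4*α - μ))^2 := by
    unfold pencD pencA pencB pencC; ring
  have hk := H.cubLead_pos
  unfold pencLo
  rw [hD, Real.sqrt_sq (mul_nonneg hk.le (by linarith [H.hμR]))]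
  unfold pencA pencB
  field_simp
  ring

lemma pencHi_zero (H : PencilData α μ r T) : pencHi α μ r T 0 = r + 4*α := by
  have hD : pencD α μ r T 0 = (cubLead α μ r T*(r + 4*α - μ))^2 := by
    unfold pencD pencA pencB pencC; ring
  have hk := H.cubLead_pos
  unfold pencHi
  rw [hD, Real.sqrt_sq (mul_nonneg hk.le (by linarith [H.hμR]))]
  unfold pencA pencB
  field_simp
  ring

lemma tendsto_pencLo (H : PencilData α μ r T) :
    Tendsto (pencLo α μ r T) atTop (𝓝 r) := by
  have hc : ContinuousOn (fun k => √(quart α μ r T k) + conic α μ r T k) (Icc r μ) := by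
    unfold quart conic; fun_prop
  obtain ⟨M, hM⟩ := (isCompact_Icc.image_of_continuousOn hc).bddAbove
  have hb : ∀ᶠ h : ℝ in atTop, pencLo α μ r T h ≤ r + M/h := by
    filter_upwards [eventually_gt_atTop 0] with h hh
    have h1 := H.sqrt_quart_lo hh.le
    have h2 : √(quart α μ r T (pencLo α μ r T h)) + conic α μ r T (pencLo α μ r T h) ≤ M :=
      hM ⟨_, ⟨(H.lt_pencLo hh.le).le, H.pencLo_le hh.le⟩, rfl⟩
    have h3 : pencLo α μ r T h - r ≤ M/h := by
      rw [le_div_iff₀ hh]; linarith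
    linarith
  have ht : Tendsto (fun h : ℝ => r + M/h) atTop (𝓝 r) := by
    simpa using (tendsto_const_nhds (x := r)).add (tendsto_const_nhds.div_atTop tendsto_id)
  refine tendsto_of_tendsto_of_tendsto_of_le_of_le' tendsto_const_nhds ht ?_ hb
  filter_upwards [eventually_ge_atTop 0] with h hh using (H.lt_pencLo hh).le

lemma tendsto_pencHi (H : PencilData α μ r T) :
    Tendsto (pencHi α μ r T) atTop atTop := by
  have ht : Tendsto (fun h : ℝ => h*(2/3) - μ) atTop atTop :=
    tendsto_atTop_add_const_right _ _ (tendsto_id.atTop_mul_const (by norm_num))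
  refine tendsto_atTop_mono' _ ?_ ht
  filter_upwards [eventually_ge_atTop (cubLead α μ r T)] with h hh
  have hk := H.cubLead_pos
  have h0 : 0 ≤ h := by linarith
  have hA := H.pencA_pos h0
  have h1 := pencLo_add_pencHi hA
  have h2 := H.pencLo_le h0
  have h3 : h*(2/3) ≤ -pencB α μ r T h/pencA α μ r T h := by
    rw [le_div_iff₀ hA]
    unfold pencA pencB
    have := mul_pos hk (by linarith [H.hr, H.hα, H.hrμ] : 0 < r + 4*α + μ)
    nlinarith
  linarith

/-- The Abel-type identity in differential form integrated over the pencil. -/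
lemma integral_sub_integral (H : PencilData α μ r T) {f E : ℝ → ℝ} {L : ℝ} (hf : Continuous f)
    (hfi : IntegrableOn f (Ioi (r + 4*α)))
    (hE : ∀ h, 0 ≤ h → HasDerivAt E
      (2*f (pencLo α μ r T h)*√(quart α μ r T (pencLo α μ r T h))/√(pencD α μ r T h)
        - 2*f (pencHi α μ r T h)*√(quart α μ r T (pencHi α μ r T h))/√(pencD α μ r T h)) h)
    (hE0 : E 0 = 0) (hEL : Tendsto E atTop (𝓝 L)) :
    (∫ k in r..μ, f k) - ∫ k in Ioi (r + 4*α), f k = L := by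
  set G : ℝ → ℝ := fun h =>
    (∫ k in (pencLo α μ r T h)..μ, f k) - (∫ k in (r + 4*α)..(pencHi α μ r T h), f k) - E h
    with hG
  have hder : ∀ h, 0 ≤ h → HasDerivAt G 0 h := by
    intro h hh
    have h1 := (intervalIntegral.integral_hasDerivAt_left (hf.intervalIntegrable _ μ)
      (hf.stronglyMeasurableAtFilter _ _) hf.continuousAt).scomp h (H.hasDerivAt_pencLo hh)
    have h2 := (intervalIntegral.integral_hasDerivAt_right (hf.intervalIntegrable (r + 4*α) _)
      (hf.stronglyMeasurableAtFilter _ _) hf.continuousAt).scomp h (H.hasDerivAt_pencHi hh)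
    have h3 := (h1.sub h2).sub (hE h hh)
    refine HasDerivAt.congr_deriv (f := G) h3 ?_
    simp only [smul_eq_mul]
    ring
  have hconst : ∀ h, 0 ≤ h → G h = G 0 := by
    intro h hh
    exact constant_of_has_deriv_right_zero
      (fun s hs => (hder s hs.1).continuousAt.continuousWithinAt)
      (fun s hs => (hder s hs.1).hasDerivWithinAt) h ⟨hh, le_rfl⟩
  have hG0 : G 0 = 0 := by
    simp [hG, H.pencLo_zero, H.pencHi_zero, hE0]
  have hcont : Continuous fun u => ∫ k in u..μ, f k := by
    have : Continuous fun u => ∫ k in μ..u, f k :=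
      intervalIntegral.continuous_primitive (fun a b => hf.intervalIntegrable a b) μ
    exact this.neg.congr fun u => (intervalIntegral.integral_symm μ u).symm
  have hlim : Tendsto G atTop (𝓝 ((∫ k in r..μ, f k) - (∫ k in Ioi (r + 4*α), f k) - L)) :=
    (((hcont.tendsto r).comp H.tendsto_pencLo).sub
      (intervalIntegral_tendsto_integral_Ioi _ hfi H.tendsto_pencHi)).sub hEL
  have hlim0 : Tendsto G atTop (𝓝 0) := by
    refine tendsto_const_nhds.congr' ?_
    filter_upwards [eventually_ge_atTop 0] with h hh
    rw [hconst h hh, hG0]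
  have := tendsto_nhds_unique hlim hlim0
  linarith

lemma continuous_quart (α μ r T : ℝ) : Continuous (quart α μ r T) := by
  unfold quart; fun_prop

lemma integral_inv_sqrt_eq (H : PencilData α μ r T)
    (hi : IntegrableOn (fun k => 1/√(quart α μ r T k)) (Ioi (r + 4*α))) :
    (∫ k in r..μ, 1/√(quart α μ r T k)) = ∫ k in Ioi (r + 4*α), 1/√(quart α μ r T k) := by
  have hpos : ∀ k, √(quart α μ r T k) ≠ 0 := fun k => Real.sqrt_ne_zero'.2 (H.hX k)
  have hc : Continuous fun k => 1/√(quart α μ r T k) :=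
    continuous_const.div (continuous_quart α μ r T).sqrt hpos
  have := H.integral_sub_integral (E := fun _ => 0) hc hi (fun h hh => by
    refine (hasDerivAt_const h (0:ℝ)).congr_deriv ?_
    have h1 := hpos (pencLo α μ r T h)
    have h2 := hpos (pencHi α μ r T h)
    field_simp
    ring) rfl tendsto_const_nhds
  linarith

lemma integral_stream_eq (H : PencilData α μ r T) (c : ℝ)
    (hi : IntegrableOn (fun k => 1 + (c - k^2/4)/√(quart α μ r T k)) (Ioi (r + 4*α))) :
    (∫ k in r..μ, (1 + (c - k^2/4)/√(quart α μ r T k)))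
      - (∫ k in Ioi (r + 4*α), (1 + (c - k^2/4)/√(quart α μ r T k))) = 4*α*(1 + T) := by
  have hpos : ∀ k, √(quart α μ r T k) ≠ 0 := fun k => Real.sqrt_ne_zero'.2 (H.hX k)
  have hc : Continuous fun k => 1 + (c - k^2/4)/√(quart α μ r T k) :=
    continuous_const.add
      (Continuous.div (by fun_prop) (continuous_quart α μ r T).sqrt hpos)
  have hk := H.cubLead_pos
  set κ := cubLead α μ r T with hκ
  set N := κ*(r + 4*α + μ) - 4*κ^2 with hN
  refine H.integral_sub_integral (E := fun h => N*(2/κ - 2/pencA α μ r T h)) hc hi ?_ ?_ ?_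
  · intro h hh
    have hA := H.pencA_pos hh
    have hD := Real.sqrt_pos.2 (H.pencD_pos hh)
    have hd := (((hasDerivAt_pencA α μ r T h).inv hA.ne').const_mul 2 |>.const_sub
      (2/κ)).const_mul N
    have hlo := H.hasDerivAt_pencLo hh
    have hhi := H.hasDerivAt_pencHi hh
    have hsum := hlo.add hhi
    have hev : (fun s => pencLo α μ r T s + pencHi α μ r T s)
        =ᶠ[𝓝 h] fun s => -pencB α μ r T s/pencA α μ r T s := by
      filter_upwards [(hasDerivAt_pencA α μ r T h).continuousAt.eventually_const_lt hA] with s hs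
      exact pencLo_add_pencHi hs
    have hsum2 := ((hasDerivAt_pencB α μ r T h).neg.div (hasDerivAt_pencA α μ r T h)
      hA.ne').congr_of_eventuallyEq hev
    have hs := hsum.unique hsum2
    have hprod : (pencHi α μ r T h)^2 - (pencLo α μ r T h)^2
        = √(pencD α μ r T h)/pencA α μ r T h*(-pencB α μ r T h/pencA α μ r T h) := by
      rw [← pencHi_sub_pencLo hA, ← pencLo_add_pencHi hA]; ring
    have h1 := hpos (pencLo α μ r T h)
    have h2 := hpos (pencHi α μ r T h)
    refine HasDerivAt.congr_deriv (f := fun h => N*(2/κ - 2/pencA α μ r T h)) hd ?_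
    symm
    have e1 : 2*(1 + (c - (pencLo α μ r T h)^2/4)/√(quart α μ r T (pencLo α μ r T h)))
          *√(quart α μ r T (pencLo α μ r T h))/√(pencD α μ r T h)
        - 2*(1 + (c - (pencHi α μ r T h)^2/4)/√(quart α μ r T (pencHi α μ r T h)))
          *√(quart α μ r T (pencHi α μ r T h))/√(pencD α μ r T h)
        = -(-(2*√(quart α μ r T (pencLo α μ r T h))/√(pencD α μ r T h))
            + 2*√(quart α μ r T (pencHi α μ r T h))/√(pencD α μ r T h))
          + ((pencHi α μ r T h)^2 - (pencLo α μ r T h)^2)/2/√(pencD α μ r T h) := by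
      field_simp
      ring
    rw [e1, hs, hprod]
    simp only [Pi.neg_apply]
    field_simp
    rw [hN]
    unfold pencA pencB
    rw [← hκ]
    ring
  · simp [pencA, ← hκ]
  · have hlim : Tendsto (fun h => pencA α μ r T h) atTop atTop := by
      unfold pencA
      exact tendsto_atTop_add_const_left _ _ (tendsto_id.atTop_div_const (by norm_num))
    have h2 : Tendsto (fun h => N*(2/κ - 2/pencA α μ r T h)) atTop (𝓝 (N*(2/κ - 0))) :=
      (tendsto_const_nhds.sub (tendsto_const_nhds.div_atTop hlim)).const_mul N
    convert h2 using 2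
    rw [hN]
    field_simp
    rw [hκ]
    unfold cubLead
    ring

end PencilData

/-- The change of variable `k ↦ (μ² − k²)/16` inverse to `R`. -/
def spt (μ k : ℝ) : ℝ := (μ^2 - k^2)/16

/-- Distance from the real point `σ` to `p.1 + i p.2`. -/
def sdist (σ : ℝ) (p : ℝ × ℝ) : ℝ := √((σ - p.1)^2 + p.2^2)

lemma sdist_sq (σ : ℝ) (p : ℝ × ℝ) : sdist σ p^2 = (σ - p.1)^2 + p.2^2 :=
  Real.sq_sqrt (by positivity)

lemma sdist_nonneg (σ : ℝ) (p : ℝ × ℝ) : 0 ≤ sdist σ p := Real.sqrt_nonneg _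

lemma sdist_pos (σ : ℝ) {p : ℝ × ℝ} (hp : 0 < p.2) : 0 < sdist σ p :=
  Real.sqrt_pos.2 (by positivity)

lemma le_sdist (σ : ℝ) (p : ℝ × ℝ) : p.2 ≤ sdist σ p :=
  Real.le_sqrt_of_sq_le (by nlinarith [sq_nonneg (σ - p.1)])

lemma abs_sub_le_sdist (σ : ℝ) (p : ℝ × ℝ) : |σ - p.1| ≤ sdist σ p :=
  Real.abs_le_sqrt (by nlinarith [sq_nonneg p.2])

lemma abs_sub_lt_sdist (σ : ℝ) {p : ℝ × ℝ} (hp : 0 < p.2) : |σ - p.1| < sdist σ p := by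
  refine abs_lt_of_sq_lt_sq ?_ (sdist_nonneg σ p)
  rw [sdist_sq]; nlinarith [pow_pos hp 2]

lemma sdist_le (σ : ℝ) {p : ℝ × ℝ} (hp : 0 < p.2) : sdist σ p ≤ |σ - p.1| + p.2 := by
  refine Real.sqrt_le_iff.2 ⟨by positivity, ?_⟩
  have := mul_nonneg (abs_nonneg (σ - p.1)) hp.le
  nlinarith [sq_abs (σ - p.1)]

lemma hasFDerivAt_sdist (σ : ℝ) {p : ℝ × ℝ} (hp : 0 < p.2) :
    HasFDerivAt (sdist σ) ((-(σ - p.1)/sdist σ p) • ContinuousLinearMap.fst ℝ ℝ ℝ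
      + (p.2/sdist σ p) • ContinuousLinearMap.snd ℝ ℝ ℝ) p := by
  have h1 : HasFDerivAt (fun p : ℝ × ℝ => (σ - p.1)^2 + p.2^2) _ p :=
    (((hasFDerivAt_fst (𝕜 := ℝ) (p := p)).const_sub σ).pow 2).add
      ((hasFDerivAt_snd (𝕜 := ℝ) (p := p)).pow 2)
  have h2 := h1.sqrt (by positivity)
  refine HasFDerivAt.congr_fderiv (f := sdist σ) h2 ?_
  have := (sdist_pos σ hp).ne'
  change √((σ - p.1)^2 + p.2^2) ≠ 0 at this
  ext <;> simp <;> unfold sdist <;> field_simp <;> ring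

lemma contDiffOn_sdist (σ : ℝ) (m : WithTop ℕ∞) : ContDiffOn ℝ m (sdist σ) {p | 0 < p.2} := by
  unfold sdist
  refine ContDiffOn.sqrt (by fun_prop) ?_
  intro p hp
  have : 0 < p.2 := hp
  positivity

lemma continuous_sdist_spt (μ : ℝ) (p : ℝ × ℝ) : Continuous fun k => sdist (spt μ k) p := by
  unfold sdist spt; fun_prop

/-- Quadratic growth of the distance along the parametrization, locally uniformly. -/
lemma one_add_sq_le (μ M : ℝ) {β : ℝ} (hβ : 0 < β) :
    ∃ C, 0 < C ∧ ∀ (p : ℝ × ℝ) (k : ℝ), |p.1| ≤ M → β ≤ p.2 →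
      1 + k^2 ≤ C*sdist (spt μ k) p ∧ |spt μ k| ≤ C*sdist (spt μ k) p := by
  refine ⟨(1 + μ^2 + 16*|M|)/β + 16, by positivity, fun p k hM hb => ?_⟩
  have h1 := abs_sub_le_sdist (spt μ k) p
  have h2 := le_sdist (spt μ k) p
  have h3 : (1 + μ^2 + 16*|M|) ≤ (1 + μ^2 + 16*|M|)/β*sdist (spt μ k) p := by
    rw [div_mul_eq_mul_div, le_div_iff₀ hβ]
    exact mul_le_mul_of_nonneg_left (hb.trans h2) (by positivity)
  have h4 := le_abs_self M
  have h5 := abs_le.1 hM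
  have h6 := abs_le.1 h1
  have h7 : k^2 = μ^2 - 16*spt μ k := by unfold spt; ring
  have h8 := sq_nonneg μ
  have h9 := sdist_nonneg (spt μ k) p
  constructor
  · rw [add_mul]; linarith
  · rw [add_mul, abs_le]
    constructor <;> nlinarith

lemma kernel_bound (μ M : ℝ) {β : ℝ} (hβ : 0 < β) {n j : ℕ} (hj : j < n) :
    ∃ C, 0 ≤ C ∧ ∀ (p : ℝ × ℝ) (k : ℝ), |p.1| ≤ M → β ≤ p.2 →
      |spt μ k|^j/sdist (spt μ k) p^n ≤ C*(1 + k^2)⁻¹ := by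
  obtain ⟨C, hC, h⟩ := one_add_sq_le μ M hβ
  refine ⟨C^j*(1/β)^(n - 1 - j)*C, by positivity, fun p k hM hb => ?_⟩
  obtain ⟨h1, h2⟩ := h p k hM hb
  have hD : 0 < sdist (spt μ k) p := sdist_pos _ (hβ.trans_le hb)
  have hbD := hb.trans (le_sdist (spt μ k) p)
  set D := sdist (spt μ k) p with hDdef
  have e : n = j + (n - 1 - j) + 1 := by omega
  have h3 : |spt μ k|^j ≤ C^j*D^j := by
    rw [← mul_pow]; exact pow_le_pow_left₀ (abs_nonneg _) h2 j
  have h4 : 1 ≤ (1/β)^(n - 1 - j)*D^(n - 1 - j) := by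
    rw [← mul_pow]
    refine one_le_pow₀ ?_
    rw [one_div, ← div_eq_inv_mul, le_div_iff₀ hβ]; linarith
  rw [← div_eq_mul_inv, div_le_div_iff₀ (by positivity) (by positivity)]
  calc |spt μ k|^j*(1 + k^2) ≤ (C^j*D^j)*(C*D) :=
        mul_le_mul h3 h1 (by positivity) (by positivity)
    _ = C^j*C*(D^j*D)*1 := by ring
    _ ≤ C^j*C*(D^j*D)*((1/β)^(n - 1 - j)*D^(n - 1 - j)) :=
        mul_le_mul_of_nonneg_left h4 (by positivity)
    _ = C^j*(1/β)^(n - 1 - j)*C*D^(j + (n - 1 - j) + 1) := by ring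
    _ = _ := by rw [← e]

/-- Moments of inverse powers of the distance over the set `K`. -/
def Fmom (μ : ℝ) (K : Set ℝ) (n j : ℕ) (p : ℝ × ℝ) : ℝ :=
  ∫ k in K, spt μ k^j/sdist (spt μ k) p^n

/-- The regularized first moment over the set `K`. -/
def Gmom (μ : ℝ) (K : Set ℝ) (p : ℝ × ℝ) : ℝ :=
  ∫ k in K, (1 + (spt μ k - p.1)/sdist (spt μ k) p)

lemma continuous_kernel (μ : ℝ) (n j : ℕ) {p : ℝ × ℝ} (hp : 0 < p.2) :
    Continuous fun k => spt μ k^j/sdist (spt μ k) p^n := by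
  refine Continuous.div ?_ ((continuous_sdist_spt μ p).pow n) fun k => ?_
  · unfold spt; fun_prop
  · exact pow_ne_zero _ (sdist_pos _ hp).ne'

lemma integrable_kernel (μ : ℝ) {n j : ℕ} (hj : j < n) {p : ℝ × ℝ} (hp : 0 < p.2) :
    Integrable fun k => spt μ k^j/sdist (spt μ k) p^n := by
  obtain ⟨C, -, h⟩ := kernel_bound μ |p.1| hp hj
  refine (integrable_inv_one_add_sq.const_mul C).mono'
    (continuous_kernel μ n j hp).aestronglyMeasurable (ae_of_all _ fun k => ?_)
  rw [norm_div, norm_pow, norm_pow, Real.norm_eq_abs, Real.norm_of_nonneg (sdist_nonneg _ _)]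
  exact h p k le_rfl le_rfl

lemma continuous_stream (μ : ℝ) {p : ℝ × ℝ} (hp : 0 < p.2) :
    Continuous fun k => 1 + (spt μ k - p.1)/sdist (spt μ k) p := by
  refine continuous_const.add (Continuous.div ?_ (continuous_sdist_spt μ p) fun k => ?_)
  · unfold spt; fun_prop
  · exact (sdist_pos _ hp).ne'

lemma stream_nonneg (σ : ℝ) {p : ℝ × ℝ} (hp : 0 < p.2) : 0 ≤ 1 + (σ - p.1)/sdist σ p := by
  have hD := sdist_pos σ hp
  have h1 := abs_le.1 (abs_sub_le_sdist σ p)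
  have : -1 ≤ (σ - p.1)/sdist σ p := by rw [le_div_iff₀ hD]; linarith
  linarith

lemma integrable_stream (μ : ℝ) {p : ℝ × ℝ} (hp : 0 < p.2) :
    Integrable fun k => 1 + (spt μ k - p.1)/sdist (spt μ k) p := by
  obtain ⟨C, hC, h⟩ := one_add_sq_le μ |p.1| hp
  set c := p.2 + 2*(μ^2/16 + |p.1|) with hc
  have hc0 : 0 < c := by positivity
  refine (integrable_inv_one_add_sq.const_mul (c*C)).mono'
    (continuous_stream μ hp).aestronglyMeasurable (ae_of_all _ fun k => ?_)
  rw [Real.norm_of_nonneg (stream_nonneg _ hp)]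
  have hD := sdist_pos (spt μ k) hp
  have h1 := (h p k le_rfl le_rfl).1
  have h2 := sdist_le (spt μ k) hp
  have h3 : sdist (spt μ k) p + (spt μ k - p.1) ≤ c := by
    rcases abs_cases (spt μ k - p.1) with ⟨h4, h5⟩ | ⟨h4, h5⟩
    · have : spt μ k ≤ μ^2/16 := by unfold spt; nlinarith [sq_nonneg k]
      have := neg_abs_le p.1
      rw [hc]; linarith
    · have := sq_nonneg μ
      have := abs_nonneg p.1
      rw [hc]; linarith
  rw [← div_eq_mul_inv, one_add_div hD.ne', div_le_div_iff₀ hD (by positivity)]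
  calc _ ≤ c*(C*sdist (spt μ k) p) := mul_le_mul h3 h1 (by positivity) hc0.le
    _ = _ := by ring

lemma hasFDerivAt_kernel (μ k : ℝ) (n j : ℕ) {p : ℝ × ℝ} (hp : 0 < p.2) :
    HasFDerivAt (fun p => spt μ k^j/sdist (spt μ k) p^n)
      ((n*(spt μ k - p.1)*spt μ k^j/sdist (spt μ k) p^(n + 2)) • ContinuousLinearMap.fst ℝ ℝ ℝ
      + (-(n*p.2*spt μ k^j/sdist (spt μ k) p^(n + 2))) • ContinuousLinearMap.snd ℝ ℝ ℝ) p := by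
  have hD := sdist_pos (spt μ k) hp
  have h1 := hasFDerivAt_sdist (spt μ k) hp
  have h2 : HasDerivAt (fun y : ℝ => spt μ k^j/y^n)
      (-(n*spt μ k^j/sdist (spt μ k) p^(n + 1))) (sdist (spt μ k) p) := by
    have h3 := ((hasDerivAt_pow n (sdist (spt μ k) p)).inv
      (pow_ne_zero _ hD.ne')).const_mul (spt μ k^j)
    simp only [div_eq_mul_inv] at h3 ⊢
    refine HasDerivAt.congr_deriv h3 ?_
    rcases n with _ | n
    · simp
    · simp only [Nat.add_sub_cancel]
      field_simp
      ring
  refine (h2.comp_hasFDerivAt p h1).congr_fderiv ?_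
  ext <;> simp <;> field_simp <;> ring

lemma hasFDerivAt_stream (μ k : ℝ) {p : ℝ × ℝ} (hp : 0 < p.2) :
    HasFDerivAt (fun p : ℝ × ℝ => 1 + (spt μ k - p.1)/sdist (spt μ k) p)
      ((-(p.2^2/sdist (spt μ k) p^3)) • ContinuousLinearMap.fst ℝ ℝ ℝ
      + (-((spt μ k - p.1)*p.2/sdist (spt μ k) p^3)) • ContinuousLinearMap.snd ℝ ℝ ℝ) p := by
  have hD := sdist_pos (spt μ k) hp
  have h1 := hasFDerivAt_sdist (spt μ k) hp
  have h2 := ((hasFDerivAt_fst (p := p)).const_sub (spt μ k)).fun_mul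
    ((hasDerivAt_inv hD.ne').comp_hasFDerivAt p h1) |>.const_add 1
  have hs := sdist_sq (spt μ k) p
  refine HasFDerivAt.congr_fderiv (f := fun p : ℝ × ℝ =>
    1 + (spt μ k - p.1)/sdist (spt μ k) p) h2 ?_
  ext
  · simp
    field_simp
    linear_combination -hs
  · simp
    field_simp

lemma norm_smul_fst_add_smul_snd_le (c d : ℝ) :
    ‖c • ContinuousLinearMap.fst ℝ ℝ ℝ + d • ContinuousLinearMap.snd ℝ ℝ ℝ‖ ≤ |c| + |d| := by
  refine (norm_add_le _ _).trans ?_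
  rw [norm_smul, norm_smul, Real.norm_eq_abs, Real.norm_eq_abs]
  have h1 := ContinuousLinearMap.norm_fst_le ℝ ℝ ℝ
  have h2 := ContinuousLinearMap.norm_snd_le ℝ ℝ ℝ
  have h3 := mul_le_mul_of_nonneg_left h1 (abs_nonneg c)
  have h4 := mul_le_mul_of_nonneg_left h2 (abs_nonneg d)
  linarith

/-- Differentiation under the integral for a family with partial derivatives dominated by
`C (1 + k²)⁻¹`. -/
lemma hasFDerivAt_setIntegral {f c d : ℝ → ℝ × ℝ → ℝ} {K : Set ℝ} {p₀ : ℝ × ℝ} {C : ℝ}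
    {s : Set (ℝ × ℝ)} (hs : s ∈ 𝓝 p₀) (hp₀ : p₀ ∈ s)
    (hf : ∀ p ∈ s, Continuous fun k => f k p) (hfi : Integrable fun k => f k p₀)
    (hc : Continuous fun k => c k p₀) (hd : Continuous fun k => d k p₀)
    (hder : ∀ p ∈ s, ∀ k, HasFDerivAt (f k) (c k p • ContinuousLinearMap.fst ℝ ℝ ℝ
      + d k p • ContinuousLinearMap.snd ℝ ℝ ℝ) p)
    (hbound : ∀ p ∈ s, ∀ k, |c k p| + |d k p| ≤ C*(1 + k^2)⁻¹) :
    HasFDerivAt (fun p => ∫ k in K, f k p)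
      ((∫ k in K, c k p₀) • ContinuousLinearMap.fst ℝ ℝ ℝ
      + (∫ k in K, d k p₀) • ContinuousLinearMap.snd ℝ ℝ ℝ) p₀ := by
  have hInt : Integrable fun k : ℝ => C*(1 + k^2)⁻¹ := integrable_inv_one_add_sq.const_mul C
  have h1 := hasFDerivAt_integral_of_dominated_of_fderiv_le (μ := volume.restrict K)
    (F := fun p k => f k p) (F' := fun p k => c k p • ContinuousLinearMap.fst ℝ ℝ ℝ
      + d k p • ContinuousLinearMap.snd ℝ ℝ ℝ) (x₀ := p₀) (bound := fun k => C*(1 + k^2)⁻¹)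
    hs (by
      filter_upwards [hs] with p hp using (hf p hp).aestronglyMeasurable)
    hfi.integrableOn
    ((hc.smul continuous_const).add (hd.smul continuous_const)).aestronglyMeasurable
    (ae_of_all _ fun k p hp => (norm_smul_fst_add_smul_snd_le _ _).trans (hbound p hp k))
    hInt.integrableOn (ae_of_all _ fun k p hp => hder p hp k)
  have hci : Integrable fun k => c k p₀ := hInt.mono' hc.aestronglyMeasurable
    (ae_of_all _ fun k => by
      have := hbound p₀ hp₀ k
      have := abs_nonneg (d k p₀)
      rw [Real.norm_eq_abs]; linarith)
  have hdi : Integrable fun k => d k p₀ := hInt.mono' hd.aestronglyMeasurable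
    (ae_of_all _ fun k => by
      have := hbound p₀ hp₀ k
      have := abs_nonneg (c k p₀)
      rw [Real.norm_eq_abs]; linarith)
  rw [integral_add (hci.integrableOn.smul_const _) (hdi.integrableOn.smul_const _),
    integral_smul_const, integral_smul_const] at h1
  exact h1

/-- A neighbourhood in the upper half-plane with uniform bounds. -/
lemma nhds_strip {p₀ : ℝ × ℝ} (hp₀ : 0 < p₀.2) :
    {p : ℝ × ℝ | |p.1| < |p₀.1| + 1 ∧ p₀.2/2 < p.2} ∈ 𝓝 p₀ := by
  refine (IsOpen.and ?_ ?_).mem_nhds ⟨by linarith, by linarith⟩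
  · exact isOpen_lt (by fun_prop) continuous_const
  · exact isOpen_lt continuous_const continuous_snd

lemma hasFDerivAt_Fmom (μ : ℝ) (K : Set ℝ) {n j : ℕ} (hj : j < n) {p : ℝ × ℝ} (hp : 0 < p.2) :
    HasFDerivAt (Fmom μ K n j)
      ((n*(Fmom μ K (n + 2) (j + 1) p - p.1*Fmom μ K (n + 2) j p)) •
        ContinuousLinearMap.fst ℝ ℝ ℝ
      + (-(n*p.2*Fmom μ K (n + 2) j p)) • ContinuousLinearMap.snd ℝ ℝ ℝ) p := by
  obtain ⟨C, hC, hk⟩ := kernel_bound μ (|p.1| + 1) (half_pos hp) (show j < n + 1 by omega)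
  have hb : ∀ q ∈ {q : ℝ × ℝ | |q.1| < |p.1| + 1 ∧ p.2/2 < q.2}, ∀ k,
      |n*(spt μ k - q.1)*spt μ k^j/sdist (spt μ k) q^(n + 2)|
        + |-(n*q.2*spt μ k^j/sdist (spt μ k) q^(n + 2))| ≤ (2*n*C)*(1 + k^2)⁻¹ := by
    rintro q ⟨h1, h2⟩ k
    have h3 := hk q k h1.le h2.le
    have hq : 0 < q.2 := by linarith
    have hD := sdist_pos (spt μ k) hq
    have h4 := abs_sub_le_sdist (spt μ k) q
    have h5 := le_sdist (spt μ k) q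
    rw [abs_neg, abs_div, abs_div, abs_mul, abs_mul, abs_mul, abs_mul, abs_of_pos hq,
      abs_of_pos (pow_pos hD (n + 2)), abs_pow, Nat.abs_cast]
    have h6 : ∀ y, y ≤ sdist (spt μ k) q → n*y*|spt μ k|^j/sdist (spt μ k) q^(n + 2)
        ≤ n*C*(1 + k^2)⁻¹ := by
      intro y hy
      calc n*y*|spt μ k|^j/sdist (spt μ k) q^(n + 2)
          ≤ n*sdist (spt μ k) q*|spt μ k|^j/sdist (spt μ k) q^(n + 2) := by gcongr
        _ = n*(|spt μ k|^j/sdist (spt μ k) q^(n + 1)) := by field_simp; ring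
        _ ≤ n*(C*(1 + k^2)⁻¹) := by gcongr
        _ = _ := by ring
    have := h6 _ h4
    have := h6 _ h5
    linarith
  have h := hasFDerivAt_setIntegral (K := K) (f := fun k p => spt μ k^j/sdist (spt μ k) p^n)
    (c := fun k p => n*(spt μ k - p.1)*spt μ k^j/sdist (spt μ k) p^(n + 2))
    (d := fun k p => -(n*p.2*spt μ k^j/sdist (spt μ k) p^(n + 2)))
    (nhds_strip hp) (mem_of_mem_nhds (nhds_strip hp))
    (fun q hq => continuous_kernel μ n j (by linarith [hq.2]))
    (integrable_kernel μ hj hp)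
    (by
      refine ((((continuous_kernel μ (n + 2) (j + 1) hp).sub
        ((continuous_kernel μ (n + 2) j hp).const_mul p.1))).const_mul (n:ℝ)).congr fun k => ?_
      simp only [Pi.sub_apply]
      ring)
    (by
      refine ((continuous_kernel μ (n + 2) j hp).const_mul (-(n*p.2))).congr fun k => ?_
      ring)
    (fun q hq k => hasFDerivAt_kernel μ k n j (by linarith [hq.2])) hb
  refine HasFDerivAt.congr_fderiv (f := Fmom μ K n j) h ?_
  have i1 := (integrable_kernel μ (show j + 1 < n + 2 by omega) hp).integrableOn (s := K)
  have i2 := (integrable_kernel μ (show j < n + 2 by omega) hp).integrableOn (s := K)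
  congr 2
  · unfold Fmom
    rw [← integral_const_mul p.1, ← integral_sub i1 (i2.const_mul _), ← integral_const_mul]
    congr 1 with k
    ring
  · unfold Fmom
    rw [← integral_const_mul, ← integral_neg]
    congr 1 with k
    ring

lemma hasFDerivAt_Gmom (μ : ℝ) (K : Set ℝ) {p : ℝ × ℝ} (hp : 0 < p.2) :
    HasFDerivAt (Gmom μ K)
      ((-(p.2^2*Fmom μ K 3 0 p)) • ContinuousLinearMap.fst ℝ ℝ ℝ
      + (-(p.2*(Fmom μ K 3 1 p - p.1*Fmom μ K 3 0 p))) • ContinuousLinearMap.snd ℝ ℝ ℝ) p := by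
  set s := {q : ℝ × ℝ | (|q.1| < |p.1| + 1 ∧ p.2/2 < q.2) ∧ q.2 < p.2 + 1} with hs
  have hsn : s ∈ 𝓝 p := inter_mem (nhds_strip hp)
    ((isOpen_lt continuous_snd continuous_const).mem_nhds (by change p.2 < p.2 + 1; linarith))
  obtain ⟨C, hC, hk⟩ := kernel_bound μ (|p.1| + 1) (half_pos hp) (show 0 < 2 by omega)
  have hb : ∀ q ∈ s, ∀ k,
      |-(q.2^2/sdist (spt μ k) q^3)| + |-((spt μ k - q.1)*q.2/sdist (spt μ k) q^3)|
        ≤ (2*(p.2 + 1)*C)*(1 + k^2)⁻¹ := by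
    rintro q ⟨⟨h1, h2⟩, h2'⟩ k
    have h3 := hk q k h1.le h2.le
    rw [pow_zero] at h3
    have hq : 0 < q.2 := by linarith
    have hD := sdist_pos (spt μ k) hq
    have h4 := abs_sub_le_sdist (spt μ k) q
    have h5 := le_sdist (spt μ k) q
    rw [abs_neg, abs_neg, abs_div, abs_div, abs_mul, abs_of_pos hq, abs_of_pos (pow_pos hq 2),
      abs_of_pos (pow_pos hD 3)]
    have h6 : ∀ y, y ≤ sdist (spt μ k) q → y*q.2/sdist (spt μ k) q^3
        ≤ (p.2 + 1)*C*(1 + k^2)⁻¹ := by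
      intro y hy
      calc y*q.2/sdist (spt μ k) q^3
          ≤ sdist (spt μ k) q*q.2/sdist (spt μ k) q^3 := by gcongr
        _ = q.2*(1/sdist (spt μ k) q^2) := by field_simp
        _ ≤ (p.2 + 1)*(C*(1 + k^2)⁻¹) := by gcongr
        _ = _ := by ring
    have := h6 _ h4
    have := h6 _ h5
    rw [pow_two q.2]
    linarith
  have h := hasFDerivAt_setIntegral (K := K)
    (f := fun k (p : ℝ × ℝ) => 1 + (spt μ k - p.1)/sdist (spt μ k) p)
    (c := fun k (p : ℝ × ℝ) => -(p.2^2/sdist (spt μ k) p^3))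
    (d := fun k (p : ℝ × ℝ) => -((spt μ k - p.1)*p.2/sdist (spt μ k) p^3))
    hsn (mem_of_mem_nhds hsn)
    (fun q hq => continuous_stream μ (by linarith [hq.1.2]))
    (integrable_stream μ hp)
    (by
      refine ((continuous_kernel μ 3 0 hp).const_mul (-(p.2^2))).congr fun k => ?_
      ring)
    (by
      refine ((((continuous_kernel μ 3 1 hp).sub
        ((continuous_kernel μ 3 0 hp).const_mul p.1))).const_mul (-p.2)).congr fun k => ?_
      simp only [Pi.sub_apply]
      ring)
    (fun q hq k => hasFDerivAt_stream μ k (by linarith [hq.1.2])) hb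
  refine HasFDerivAt.congr_fderiv (f := Gmom μ K) h ?_
  have i1 := (integrable_kernel μ (show 1 < 3 by omega) hp).integrableOn (s := K)
  have i2 := (integrable_kernel μ (show 0 < 3 by omega) hp).integrableOn (s := K)
  congr 2
  · unfold Fmom
    rw [← integral_const_mul, ← integral_neg]
    congr 1 with k
    ring
  · unfold Fmom
    rw [← integral_const_mul p.1, ← integral_sub i1 (i2.const_mul _), ← integral_const_mul,
      ← integral_neg]
    congr 1 with k
    ring

lemma isOpen_upper : IsOpen {p : ℝ × ℝ | 0 < p.2} := isOpen_lt continuous_const continuous_snd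

lemma contDiffOn_succ_of_partials {f c d : ℝ × ℝ → ℝ} {m : ℕ}
    (hf : ∀ p : ℝ × ℝ, 0 < p.2 → HasFDerivAt f (c p • ContinuousLinearMap.fst ℝ ℝ ℝ
      + d p • ContinuousLinearMap.snd ℝ ℝ ℝ) p)
    (hc : ContDiffOn ℝ m c {p | 0 < p.2}) (hd : ContDiffOn ℝ m d {p | 0 < p.2}) :
    ContDiffOn ℝ ((m + 1 : ℕ) : WithTop ℕ∞) f {p | 0 < p.2} := by
  push_cast
  rw [contDiffOn_succ_iff_fderiv_of_isOpen isOpen_upper]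
  refine ⟨fun p hp => (hf p hp).differentiableAt.differentiableWithinAt, by simp, ?_⟩
  have h := (hc.smul (contDiffOn_const (c := ContinuousLinearMap.fst ℝ ℝ ℝ))).add
    (hd.smul (contDiffOn_const (c := ContinuousLinearMap.snd ℝ ℝ ℝ)))
  exact h.congr fun p hp => (hf p hp).fderiv

lemma contDiffOn_Fmom_nat (μ : ℝ) (K : Set ℝ) (m : ℕ) :
    ∀ {n j : ℕ}, j < n → ContDiffOn ℝ m (Fmom μ K n j) {p | 0 < p.2} := by
  induction m with
  | zero =>
    intro n j hj
    simp only [Nat.cast_zero, contDiffOn_zero]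
    exact fun p hp => (hasFDerivAt_Fmom μ K hj hp).continuousAt.continuousWithinAt
  | succ m ih =>
    intro n j hj
    refine contDiffOn_succ_of_partials (fun p hp => hasFDerivAt_Fmom μ K hj hp) ?_ ?_
    · have h1 := ih (show j + 1 < n + 2 by omega)
      have h2 := ih (show j < n + 2 by omega)
      exact contDiffOn_const.mul (h1.sub (contDiffOn_fst.mul h2))
    · have h2 := ih (show j < n + 2 by omega)
      exact ((contDiffOn_const.mul contDiffOn_snd).mul h2).neg

lemma contDiffOn_Fmom (μ : ℝ) (K : Set ℝ) {n j : ℕ} (hj : j < n) :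
    ContDiffOn ℝ (⊤ : ℕ∞) (Fmom μ K n j) {p | 0 < p.2} :=
  contDiffOn_infty.2 fun m => contDiffOn_Fmom_nat μ K m hj

lemma contDiffOn_Gmom (μ : ℝ) (K : Set ℝ) :
    ContDiffOn ℝ (⊤ : ℕ∞) (Gmom μ K) {p | 0 < p.2} := by
  refine contDiffOn_infty.2 fun m => ?_
  have h1 := contDiffOn_Fmom_nat μ K m (show 1 < 3 by omega)
  have h2 := contDiffOn_Fmom_nat μ K m (show 0 < 3 by omega)
  have h3 : ContDiffOn ℝ ((m + 1 : ℕ) : WithTop ℕ∞) (Gmom μ K) {p | 0 < p.2} :=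
    contDiffOn_succ_of_partials (fun p hp => hasFDerivAt_Gmom μ K hp)
      ((contDiffOn_snd.pow 2).mul h2).neg
      (contDiffOn_snd.mul (h1.sub (contDiffOn_fst.mul h2))).neg
  exact h3.of_le (by exact_mod_cast Nat.le_succ m)

lemma arsinh_div_eq_log (σ : ℝ) {p : ℝ × ℝ} (hp : 0 < p.2) :
    Real.arsinh ((σ - p.1)/p.2) = Real.log ((σ - p.1 + sdist σ p)/p.2) := by
  have e : √(1 + ((σ - p.1)/p.2)^2) = sdist σ p/p.2 := by
    rw [sdist, ← Real.sqrt_sq hp.le, ← Real.sqrt_div (by positivity), Real.sqrt_sq hp.le]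
    congr 1
    field_simp
    ring
  rw [Real.arsinh, e, add_div]

lemma hasFDerivAt_arsinh_div (σ : ℝ) {p : ℝ × ℝ} (hp : 0 < p.2) :
    HasFDerivAt (fun p : ℝ × ℝ => Real.arsinh ((σ - p.1)/p.2))
      ((-(1/sdist σ p)) • ContinuousLinearMap.fst ℝ ℝ ℝ
      + (-((σ - p.1)/(p.2*sdist σ p))) • ContinuousLinearMap.snd ℝ ℝ ℝ) p := by
  have h1 := ((hasFDerivAt_fst (𝕜 := ℝ) (p := p)).const_sub σ).fun_mul
    ((hasDerivAt_inv hp.ne').comp_hasFDerivAt p (hasFDerivAt_snd (𝕜 := ℝ) (p := p)))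
  have h2 := h1.arsinh
  have hD := sdist_pos σ hp
  have e : √(1 + ((σ - p.1)*p.2⁻¹)^2) = sdist σ p/p.2 := by
    rw [sdist, ← Real.sqrt_sq hp.le, ← Real.sqrt_div (by positivity), Real.sqrt_sq hp.le]
    congr 1
    field_simp
    ring
  refine HasFDerivAt.congr_fderiv (f := fun p : ℝ × ℝ => Real.arsinh ((σ - p.1)/p.2)) h2 ?_
  simp only [Function.comp_apply, e]
  ext <;> simp <;> field_simp

lemma contDiffOn_arsinh_div (σ : ℝ) (m : WithTop ℕ∞) :
    ContDiffOn ℝ m (fun p : ℝ × ℝ => Real.arsinh ((σ - p.1)/p.2)) {p | 0 < p.2} :=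
  Real.contDiff_arsinh.comp_contDiffOn
    ((contDiffOn_const.sub contDiffOn_fst).div contDiffOn_snd fun _ hp => (ne_of_gt hp))

/-- The real point `z_P` in terms of the parameter `r`. -/
def zpt (α μ r : ℝ) : ℝ := spt μ r + α*(μ - r)/4

/-- Closed form of the zeroth moment. -/
def I0fun (α μ r : ℝ) (p : ℝ × ℝ) : ℝ :=
  -(π/α)*(Real.arsinh ((spt μ r - p.1)/p.2) + Real.arsinh ((spt μ (r + 4*α) - p.1)/p.2))
    + π/4*(Fmom μ (Ioi (r + 4*α)) 1 0 p - Fmom μ (Ioc r μ) 1 0 p)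

/-- Closed form of the combination `I₁ − (Re q) I₀`. -/
def N0fun (α μ r : ℝ) (p : ℝ × ℝ) : ℝ :=
  π/α*(2*zpt α μ r - spt μ r - spt μ (r + 4*α) - sdist (spt μ r) p - sdist (spt μ (r + 4*α)) p)
    + π/4*(Gmom μ (Ioi (r + 4*α)) p - Gmom μ (Ioc r μ) p)

/-- Partial derivative of `I0fun` in the first variable. -/
def I0a (α μ r : ℝ) (p : ℝ × ℝ) : ℝ :=
  π/α*(1/sdist (spt μ r) p + 1/sdist (spt μ (r + 4*α)) p)
    + π/4*((Fmom μ (Ioi (r + 4*α)) 3 1 p - p.1*Fmom μ (Ioi (r + 4*α)) 3 0 p)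
      - (Fmom μ (Ioc r μ) 3 1 p - p.1*Fmom μ (Ioc r μ) 3 0 p))

/-- Partial derivative of `N0fun` in the first variable. -/
def N0a (α μ r : ℝ) (p : ℝ × ℝ) : ℝ :=
  π/α*((spt μ r - p.1)/sdist (spt μ r) p
      + (spt μ (r + 4*α) - p.1)/sdist (spt μ (r + 4*α)) p)
    - π/4*p.2^2*(Fmom μ (Ioi (r + 4*α)) 3 0 p - Fmom μ (Ioc r μ) 3 0 p)

lemma hasFDerivAt_I0fun (α μ r : ℝ) {p : ℝ × ℝ} (hp : 0 < p.2) :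
    HasFDerivAt (I0fun α μ r) (I0a α μ r p • ContinuousLinearMap.fst ℝ ℝ ℝ
      + (N0a α μ r p/p.2) • ContinuousLinearMap.snd ℝ ℝ ℝ) p := by
  have h := (((hasFDerivAt_arsinh_div (spt μ r) hp).add
    (hasFDerivAt_arsinh_div (spt μ (r + 4*α)) hp)).const_mul (-(π/α))).add
    (((hasFDerivAt_Fmom μ (Ioi (r + 4*α)) one_pos hp).sub
      (hasFDerivAt_Fmom μ (Ioc r μ) one_pos hp)).const_mul (π/4))
  refine HasFDerivAt.congr_fderiv (f := I0fun α μ r) h ?_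
  have h1 := sdist_pos (spt μ r) hp
  have h2 := sdist_pos (spt μ (r + 4*α)) hp
  unfold I0a N0a
  ext
  · simp
    ring
  · simp
    field_simp
    ring

lemma hasFDerivAt_N0fun (α μ r : ℝ) {p : ℝ × ℝ} (hp : 0 < p.2) :
    HasFDerivAt (N0fun α μ r) (N0a α μ r p • ContinuousLinearMap.fst ℝ ℝ ℝ
      + (-(p.2*I0a α μ r p)) • ContinuousLinearMap.snd ℝ ℝ ℝ) p := by
  have h := ((((hasFDerivAt_sdist (spt μ r) hp).const_sub
    (2*zpt α μ r - spt μ r - spt μ (r + 4*α))).sub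
    (hasFDerivAt_sdist (spt μ (r + 4*α)) hp)).const_mul (π/α)).add
    (((hasFDerivAt_Gmom μ (Ioi (r + 4*α)) hp).sub
      (hasFDerivAt_Gmom μ (Ioc r μ) hp)).const_mul (π/4))
  refine HasFDerivAt.congr_fderiv (f := N0fun α μ r) h ?_
  unfold I0a N0a
  ext
  · simp
    ring
  · simp
    ring

lemma contDiffOn_I0fun (α μ r : ℝ) : ContDiffOn ℝ (⊤ : ℕ∞) (I0fun α μ r) {p | 0 < p.2} :=
  (contDiffOn_const.mul ((contDiffOn_arsinh_div _ _).add (contDiffOn_arsinh_div _ _))).add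
    (contDiffOn_const.mul ((contDiffOn_Fmom _ _ one_pos).sub (contDiffOn_Fmom _ _ one_pos)))

lemma contDiffOn_N0fun (α μ r : ℝ) : ContDiffOn ℝ (⊤ : ℕ∞) (N0fun α μ r) {p | 0 < p.2} :=
  (contDiffOn_const.mul ((contDiffOn_const.sub (contDiffOn_sdist _ _)).sub
    (contDiffOn_sdist _ _))).add
    (contDiffOn_const.mul ((contDiffOn_Gmom _ _).sub (contDiffOn_Gmom _ _)))

lemma hasDerivAt_sdist_spt (μ k : ℝ) {p : ℝ × ℝ} (hp : 0 < p.2) :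
    HasDerivAt (fun k => sdist (spt μ k) p)
      (-(k/8)*((spt μ k - p.1)/sdist (spt μ k) p)) k := by
  have h0 : HasDerivAt (spt μ) (-(k/8)) k := by
    have := ((hasDerivAt_pow 2 k).const_sub (μ^2)).div_const 16
    refine HasDerivAt.congr_deriv (f := spt μ) this ?_
    simp; ring
  have h1 := ((h0.sub_const p.1).fun_pow 2).add_const (p.2^2)
  have h2 := h1.sqrt (by positivity)
  refine HasDerivAt.congr_deriv (f := fun k => sdist (spt μ k) p) h2 ?_
  have hD := sdist_pos (spt μ k) hp
  change _ = -(k/8)*((spt μ k - p.1)/√((spt μ k - p.1)^2 + p.2^2))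
  have hD' : 0 < √((spt μ k - p.1)^2 + p.2^2) := hD
  simp
  field_simp

lemma hasDerivAt_spt (μ k : ℝ) : HasDerivAt (spt μ) (-(k/8)) k := by
  have := ((hasDerivAt_pow 2 k).const_sub (μ^2)).div_const 16
  refine HasDerivAt.congr_deriv (f := spt μ) this ?_
  simp; ring

/-- A half-line integral is bounded by the variation of a dominating primitive. -/
lemma integral_Ioi_le_of_hasDerivAt {f V V' : ℝ → ℝ} {R M : ℝ} (hfc : Continuous f)
    (hf : IntegrableOn f (Ioi R)) (hV : ∀ k, R ≤ k → HasDerivAt V (V' k) k)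
    (hle : ∀ k, R ≤ k → f k ≤ V' k) (hM : ∀ k, R ≤ k → V k - V R ≤ M) :
    ∫ k in Ioi R, f k ≤ M := by
  refine le_of_tendsto (intervalIntegral_tendsto_integral_Ioi R hf tendsto_id) ?_
  filter_upwards [eventually_ge_atTop R] with n hn
  refine (intervalIntegral.integral_le_sub_of_hasDeriv_right_of_le hn
    (fun k hk => (hV k hk.1).continuousAt.continuousWithinAt)
    (fun k hk => (hV k hk.1.le).hasDerivWithinAt) hfc.continuousOn.integrableOn_Icc
    (fun k hk => hle k hk.1.le)).trans (hM n hn)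

lemma Gmom_Ioi_le {α μ r : ℝ} (hα : 0 < α) (hr : 0 < r) {p : ℝ × ℝ} (hp : 0 < p.2) :
    Gmom μ (Ioi (r + 4*α)) p
      ≤ 2/α*(sdist (spt μ (r + 4*α)) p + (spt μ (r + 4*α) - p.1)) := by
  refine integral_Ioi_le_of_hasDerivAt (continuous_stream μ hp)
    (integrable_stream μ hp).integrableOn
    (V := fun k => -(2/α)*(sdist (spt μ k) p + (spt μ k - p.1)))
    (V' := fun k => k/(4*α)*(1 + (spt μ k - p.1)/sdist (spt μ k) p)) ?_ ?_ ?_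
  · intro k hk
    refine (((hasDerivAt_sdist_spt μ k hp).fun_add
      ((hasDerivAt_spt μ k).sub_const p.1)).const_mul (-(2/α))).congr_deriv ?_
    have hD := sdist_pos (spt μ k) hp
    field_simp
    ring
  · intro k hk
    refine le_mul_of_one_le_left (stream_nonneg _ hp) ?_
    rw [le_div_iff₀ (by positivity)]
    linarith
  · intro k hk
    have h1 := abs_le.1 (abs_sub_le_sdist (spt μ k) p)
    have : 0 ≤ 2/α*(sdist (spt μ k) p + (spt μ k - p.1)) :=
      mul_nonneg (by positivity) (by linarith)
    linarith

lemma Gmom_nonneg (μ : ℝ) (K : Set ℝ) {p : ℝ × ℝ} (hp : 0 < p.2) : 0 ≤ Gmom μ K p :=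
  integral_nonneg fun _ => stream_nonneg _ hp

lemma N0fun_le {α μ r : ℝ} (hα : 0 < α) (hr : 0 < r) {p : ℝ × ℝ} (hp : 0 < p.2) :
    N0fun α μ r p ≤ π/α*(2*zpt α μ r - spt μ r - spt μ (r + 4*α) - sdist (spt μ r) p
      - sdist (spt μ (r + 4*α)) p/2 + (spt μ (r + 4*α) - p.1)/2) := by
  have h1 := Gmom_Ioi_le (μ := μ) hα hr hp
  have h2 := Gmom_nonneg μ (Ioc r μ) hp
  have h3 : π/4*(Gmom μ (Ioi (r + 4*α)) p - Gmom μ (Ioc r μ) p)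
      ≤ π/4*(2/α*(sdist (spt μ (r + 4*α)) p + (spt μ (r + 4*α) - p.1))) :=
    mul_le_mul_of_nonneg_left (by linarith) (by positivity)
  unfold N0fun
  refine (add_le_add_right h3 _).trans (le_of_eq ?_)
  field_simp
  ring

/-- The stream-type moment is negative above `z_P`. -/
lemma N0fun_neg_of_eq {α μ r : ℝ} (hα : 0 < α) (hr : 0 < r) {p : ℝ × ℝ}
    (hp : 0 < p.2) (hpz : p.1 = zpt α μ r) : N0fun α μ r p < 0 := by
  refine (N0fun_le hα hr hp).trans_lt ?_
  have h1 := (abs_lt.1 (abs_sub_lt_sdist (spt μ r) hp)).1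
  have h2 := (abs_lt.1 (abs_sub_lt_sdist (spt μ (r + 4*α)) hp)).1
  refine mul_neg_of_pos_of_neg (by positivity) ?_
  rw [hpz] at h1 h2 ⊢
  linarith

lemma sdist_le_of_N0fun_nonneg {α μ r : ℝ} (hα : 0 < α) (hr : 0 < r) {p : ℝ × ℝ}
    (hp : 0 < p.2) (hN : 0 ≤ N0fun α μ r p) :
    sdist (spt μ r) p ≤ 2*zpt α μ r - spt μ r - spt μ (r + 4*α) := by
  have h := hN.trans (N0fun_le hα hr hp)
  have h1 := (abs_lt.1 (abs_sub_lt_sdist (spt μ (r + 4*α)) hp)).2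
  have h2 := nonneg_of_mul_nonneg_right h (by positivity)
  linarith

/-- The gradient of the zeroth moment points strictly in the direction `(b, z₊ − a)`. -/
lemma gradient_pos {α μ r : ℝ} (hα : 0 < α) (hr : 0 < r) {p : ℝ × ℝ}
    (hp : 0 < p.2) : 0 < p.2^2*I0a α μ r p + (spt μ r - p.1)*N0a α μ r p := by
  have hD := sdist_pos (spt μ r) hp
  have hE := sdist_pos (spt μ (r + 4*α)) hp
  have hDsq := sdist_sq (spt μ r) p
  have hEsq := sdist_sq (spt μ (r + 4*α)) p
  have hlt := (abs_lt.1 (abs_sub_lt_sdist (spt μ r) hp)).2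
  have i1 := integrable_kernel μ (show 1 < 3 by omega) hp
  have i2 := integrable_kernel μ (show 0 < 3 by omega) hp
  have hcomb : ∀ K : Set ℝ, ∫ k in K, (spt μ r - spt μ k)/sdist (spt μ k) p^3
      = spt μ r*Fmom μ K 3 0 p - Fmom μ K 3 1 p := by
    intro K
    unfold Fmom
    rw [← integral_const_mul, ← integral_sub (i2.integrableOn.const_mul _) i1.integrableOn]
    congr 1 with k
    ring
  have hmono : ∀ k, r ≤ k → 0 ≤ spt μ r - spt μ k := by
    intro k hk
    unfold spt
    nlinarith
  have hP : 0 ≤ spt μ r*Fmom μ (Ioc r μ) 3 0 p - Fmom μ (Ioc r μ) 3 1 p := by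
    rw [← hcomb]
    exact setIntegral_nonneg measurableSet_Ioc fun k hk =>
      div_nonneg (hmono k hk.1.le) (pow_nonneg (sdist_nonneg _ _) 3)
  have hQ : spt μ r*Fmom μ (Ioi (r + 4*α)) 3 0 p - Fmom μ (Ioi (r + 4*α)) 3 1 p
      ≤ 2/α*((spt μ r - p.1)/p.2^2 + (p.2^2 + (spt μ r - p.1)*(spt μ (r + 4*α) - p.1))
        /(p.2^2*sdist (spt μ (r + 4*α)) p)) := by
    rw [← hcomb]
    refine integral_Ioi_le_of_hasDerivAt ?_ ?_
      (V := fun k => -(2/α)*((p.2^2 + (spt μ r - p.1)*(spt μ k - p.1))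
        /(p.2^2*sdist (spt μ k) p)))
      (V' := fun k => k/(4*α)*((spt μ r - spt μ k)/sdist (spt μ k) p^3)) ?_ ?_ ?_
    · refine (((continuous_kernel μ 3 0 hp).const_mul (spt μ r)).sub
        (continuous_kernel μ 3 1 hp)).congr fun k => ?_
      simp only [Pi.sub_apply]
      ring
    · refine IntegrableOn.congr_fun ((i2.const_mul (spt μ r)).sub i1).integrableOn
        (fun k _ => ?_) measurableSet_Ioi
      simp only [Pi.sub_apply]
      ring
    · intro k hk
      have hK := sdist_pos (spt μ k) hp
      have hKsq := sdist_sq (spt μ k) p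
      refine ((((((hasDerivAt_spt μ k).sub_const p.1).const_mul (spt μ r - p.1)).const_add
        (p.2^2)).fun_div ((hasDerivAt_sdist_spt μ k hp).const_mul (p.2^2))
        (by positivity)).const_mul (-(2/α))).congr_deriv ?_
      field_simp
      rw [hKsq]
      ring
    · intro k hk
      refine le_mul_of_one_le_left (div_nonneg (hmono k (by linarith))
        (pow_nonneg (sdist_nonneg _ _) 3)) ?_
      rw [le_div_iff₀ (by positivity)]
      linarith
    · intro k hk
      have hK := sdist_pos (spt μ k) hp
      have hKsq := sdist_sq (spt μ k) p
      have h1 := (abs_lt.1 (abs_sub_lt_sdist (spt μ k) hp)).1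
      have h2 := hmono k (by linarith)
      have h3 : 0 ≤ (sdist (spt μ k) p + (spt μ k - p.1))
          *(sdist (spt μ k) p + (spt μ r - spt μ k)) :=
        mul_nonneg (by linarith) (by linarith)
      have h4 : -((spt μ r - p.1)/p.2^2) ≤ (p.2^2 + (spt μ r - p.1)*(spt μ k - p.1))
          /(p.2^2*sdist (spt μ k) p) := by
        rw [← neg_div, div_le_div_iff₀ (by positivity) (by positivity)]
        have : 0 ≤ p.2^2*(p.2^2 + (spt μ r - p.1)*(spt μ k - p.1)
            + (spt μ r - p.1)*sdist (spt μ k) p) := by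
          refine mul_nonneg (by positivity) ?_
          nlinarith
        linarith
      have h5 := mul_le_mul_of_nonneg_left h4 (by positivity : 0 ≤ 2/α)
      linarith
  have hcs : -(sdist (spt μ r) p) ≤ (p.2^2 + (spt μ r - p.1)*(spt μ (r + 4*α) - p.1))
      /sdist (spt μ (r + 4*α)) p := by
    rw [le_div_iff₀ hE]
    have : |p.2^2 + (spt μ r - p.1)*(spt μ (r + 4*α) - p.1)|
        ≤ sdist (spt μ r) p*sdist (spt μ (r + 4*α)) p := by
      refine abs_le_of_sq_le_sq ?_ (by positivity)
      rw [mul_pow, hDsq, hEsq]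
      nlinarith [sq_nonneg (p.2*(spt μ (r + 4*α) - p.1) - p.2*(spt μ r - p.1))]
    have := (abs_le.1 this).1
    linarith
  set ξ := spt μ r - p.1 with hξ
  set η := spt μ (r + 4*α) - p.1 with hη
  set D := sdist (spt μ r) p with hDdef
  set E := sdist (spt μ (r + 4*α)) p with hEdef
  set Q := spt μ r*Fmom μ (Ioi (r + 4*α)) 3 0 p - Fmom μ (Ioi (r + 4*α)) 3 1 p with hQdef
  set P := spt μ r*Fmom μ (Ioc r μ) 3 0 p - Fmom μ (Ioc r μ) 3 1 p with hPdef
  have e : p.2^2*I0a α μ r p + ξ*N0a α μ r p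
      = π/α*(D + (p.2^2 + ξ*η)/E) + π/4*p.2^2*(P - Q) := by
    have e1 : D = (p.2^2 + ξ^2)/D := by
      rw [eq_div_iff hD.ne']; linarith
    nth_rewrite 1 [e1]
    unfold I0a N0a
    rw [hQdef, hPdef, ← hDdef, ← hEdef, ← hξ, ← hη]
    have : spt μ r = ξ + p.1 := by rw [hξ]; ring
    rw [this]
    ring
  have hQ' : π/4*p.2^2*Q ≤ π/4*p.2^2*(2/α*(ξ/p.2^2 + (p.2^2 + ξ*η)/(p.2^2*E))) :=
    mul_le_mul_of_nonneg_left hQ (by positivity)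
  have e2 : π/4*p.2^2*(2/α*(ξ/p.2^2 + (p.2^2 + ξ*η)/(p.2^2*E)))
      = π/α*(ξ/2 + (p.2^2 + ξ*η)/E/2) := by
    field_simp
    ring
  have hP' : 0 ≤ π/4*p.2^2*P := mul_nonneg (by positivity) hP
  have h6 : 0 < π/α*(D - ξ/2 + (p.2^2 + ξ*η)/E/2) :=
    mul_pos (by positivity) (by linarith)
  rw [e]
  rw [e2] at hQ'
  linarith

/-- Chord bound for the convex quadratic governing the sign of the initial discriminant. -/
lemma quadratic_nonpos_of_le {α μ R T : ℝ} (hμ : 0 < μ) (hμR : μ < R) (hr : 0 ≤ μ + R - 4*α)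
    (hT : μ ≤ R*T) (hT2 : T < 1) :
    α^2*T^2 - α*μ*T + ((μ^2 - R^2 + 4*α*R)/4 - α^2) ≤ 0 := by
  have hR : 0 < R := hμ.trans hμR
  have hconv : (R - μ)*R^2*(α^2*T^2 - α*μ*T + ((μ^2 - R^2 + 4*α*R)/4 - α^2))
      = -(R*(1 - T)*((R - 2*α)^2/4*((R - μ)*(R + μ))))
        - R^2*(R*T - μ)*((R - μ)*(μ + R - 4*α)/4)
        - α^2*R*(R*T - μ)*(1 - T)*(R - μ) := by
    ring
  have q1 : 0 ≤ R - μ := by linarith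
  have q2 : 0 ≤ 1 - T := by linarith
  have q3 : 0 ≤ R*T - μ := by linarith
  have q4 : 0 ≤ R + μ := by linarith
  have p2 : 0 ≤ R*(1 - T)*((R - 2*α)^2/4*((R - μ)*(R + μ))) := by positivity
  have p3 : 0 ≤ R^2*(R*T - μ)*((R - μ)*(μ + R - 4*α)/4) := by positivity
  have p4 : 0 ≤ α^2*R*(R*T - μ)*(1 - T)*(R - μ) := by positivity
  have hpos : 0 < (R - μ)*R^2 := mul_pos (by linarith) (by positivity)
  by_contra! h
  have := mul_pos hpos h
  linarith

/-- The initial data give admissible parameters for the pencil. -/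
lemma pencilData_of_quart {α μ r T : ℝ} (hα : 0 < α) (hr : 0 < r) (hrμ : r < μ)
    (hμR : μ < r + 4*α) (hT1 : -1 < T) (hT2 : T < 1) {p : ℝ × ℝ} (hp : 0 < p.2)
    (hq : ∀ k, quart α μ r T k = 16*sdist (spt μ k) p^2) : PencilData α μ r T := by
  have hq' : ∀ k, quart α μ r T k = 16*((spt μ k - p.1)^2 + p.2^2) := fun k => by
    rw [hq, sdist_sq]
  set w := ((μ^2 - (r^2 + 4*α*r))/4 - α*μ*T)/4 with hw
  have h0 := hq' μ
  have h1 := hq' 0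
  unfold quart spt at h0 h1
  have hμ : 0 < μ := hr.trans hrμ
  have ha : p.1 = w - α^2*(1 - T^2)/2 := by
    have : μ^2*(p.1 - (w - α^2*(1 - T^2)/2)) = 0 := by
      rw [hw]
      linear_combination (1/2)*h1 - (1/2)*h0
    have := (mul_eq_zero.1 this).resolve_left (by positivity)
    linarith
  have hab : p.1^2 + p.2^2 = w^2 := by
    rw [hw]; linear_combination -(1/16)*h0
  have hρ : 0 < 1 - T^2 := by nlinarith
  have hb : p.2^2 = α^2*(1 - T^2)*(w - α^2*(1 - T^2)/4) := by
    have : p.2^2 = w^2 - p.1^2 := by linarith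
    rw [this, ha]; ring
  have hαρ : 0 < α^2*(1 - T^2) := by positivity
  have hw0 : 0 < w - α^2*(1 - T^2)/4 := by
    have h3 : 0 < α^2*(1 - T^2)*(w - α^2*(1 - T^2)/4) := by rw [← hb]; positivity
    exact (mul_pos_iff_of_pos_left hαρ).1 h3
  refine ⟨hα, hr, hrμ, hμR, hT1, hT2, fun k => ?_, by linarith, ?_⟩
  · rw [hq]
    have := sdist_pos (spt μ k) hp
    positivity
  · by_contra! hc
    have hf : α^2*T^2 - α*μ*T + ((μ^2 - (r + 4*α)^2 + 4*α*(r + 4*α))/4 - α^2)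
        = 4*(w - α^2*(1 - T^2)/4) := by
      rw [hw]; ring
    have := quadratic_nonpos_of_le (α := α) (R := r + 4*α) (T := T) hμ hμR (by linarith)
      (by linarith) hT2
    linarith

section InitialValue

variable {α μ r T : ℝ} {p : ℝ × ℝ}

lemma sqrt_quart_eq_sdist (hq : ∀ k, quart α μ r T k = 16*sdist (spt μ k) p^2) (k : ℝ) :
    √(quart α μ r T k) = 4*sdist (spt μ k) p := by
  rw [hq, show 16*sdist (spt μ k) p^2 = (4*sdist (spt μ k) p)^2 by ring,
    Real.sqrt_sq (mul_nonneg (by norm_num) (sdist_nonneg _ _))]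

lemma sdist_left_of_quart (H : PencilData α μ r T)
    (hq : ∀ k, quart α μ r T k = 16*sdist (spt μ k) p^2) :
    sdist (spt μ r) p = α*(μ + r*T)/4 := by
  have h := sqrt_quart_eq_sdist hq r
  have h2 := H.conic_left_pos
  rw [conic_at_left] at h2
  rw [quart_at_left, Real.sqrt_sq h2.le] at h
  linarith

lemma sdist_right_of_quart (H : PencilData α μ r T)
    (hq : ∀ k, quart α μ r T k = 16*sdist (spt μ k) p^2) :
    sdist (spt μ (r + 4*α)) p = α*(μ - (r + 4*α)*T)/4 := by
  have h := sqrt_quart_eq_sdist hq (r + 4*α)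
  have h2 := mul_pos H.hα H.hright
  rw [quart_at_right, Real.sqrt_sq h2.le] at h
  linarith

lemma N0fun_of_quart (H : PencilData α μ r T) (hp : 0 < p.2)
    (hq : ∀ k, quart α μ r T k = 16*sdist (spt μ k) p^2) : N0fun α μ r p = 0 := by
  have hfun : ∀ k, 1 + (spt μ k - p.1)/sdist (spt μ k) p
      = 1 + ((μ^2/4 - 4*p.1) - k^2/4)/√(quart α μ r T k) := by
    intro k
    have := sdist_pos (spt μ k) hp
    rw [sqrt_quart_eq_sdist hq]
    unfold spt at this ⊢
    field_simp
    ring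
  have hi := (integrable_stream μ hp).integrableOn (s := Ioi (r + 4*α))
  simp only [hfun] at hi
  have h := H.integral_stream_eq _ hi
  rw [intervalIntegral.integral_of_le H.hrμ.le] at h
  unfold N0fun Gmom
  simp only [hfun]
  rw [sdist_left_of_quart H hq, sdist_right_of_quart H hq, ← neg_sub (∫ k in Ioc r μ, _), h]
  have := H.hα
  unfold zpt spt
  field_simp
  ring

lemma I0fun_of_quart {x : ℝ} (H : PencilData α μ r (Real.tanh x)) (hp : 0 < p.2)
    (hq : ∀ k, quart α μ r (Real.tanh x) k = 16*sdist (spt μ k) p^2) :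
    I0fun α μ r p = -(2*π*x/α) := by
  have hfun : ∀ k, spt μ k^0/sdist (spt μ k) p^1 = 4*(1/√(quart α μ r (Real.tanh x) k)) := by
    intro k
    have := sdist_pos (spt μ k) hp
    rw [sqrt_quart_eq_sdist hq]
    field_simp
  have hfun' : ∀ k, 1/√(quart α μ r (Real.tanh x) k) = (1/4)*(spt μ k^0/sdist (spt μ k) p^1) := by
    intro k; rw [hfun]; ring
  have hi : IntegrableOn (fun k => 1/√(quart α μ r (Real.tanh x) k)) (Ioi (r + 4*α)) := by
    simp only [hfun']
    exact ((integrable_kernel μ one_pos hp).const_mul (1/4)).integrableOn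
  have h := H.integral_inv_sqrt_eq hi
  rw [intervalIntegral.integral_of_le H.hrμ.le] at h
  have hF : Fmom μ (Ioi (r + 4*α)) 1 0 p - Fmom μ (Ioc r μ) 1 0 p = 0 := by
    unfold Fmom
    simp only [hfun]
    rw [integral_const_mul, integral_const_mul, h, sub_self]
  have hD := sdist_left_of_quart H hq
  have hE := sdist_right_of_quart H hq
  have hEp := sdist_pos (spt μ (r + 4*α)) hp
  have hEsq := sdist_sq (spt μ (r + 4*α)) p
  have l1 := (abs_lt.1 (abs_sub_lt_sdist (spt μ r) hp)).1
  have l2 := abs_lt.1 (abs_sub_lt_sdist (spt μ (r + 4*α)) hp)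
  have h0 := hq μ
  have h1 := hq 0
  rw [sdist_sq] at h0 h1
  unfold quart spt at h0 h1
  have hμ : 0 < μ := H.hr.trans H.hrμ
  set T := Real.tanh x with hT
  have ha : p.1 = ((μ^2 - (r^2 + 4*α*r))/4 - α*μ*T)/4 - α^2*(1 - T^2)/2 := by
    have : μ^2*(p.1 - (((μ^2 - (r^2 + 4*α*r))/4 - α*μ*T)/4 - α^2*(1 - T^2)/2)) = 0 := by
      linear_combination (1/2)*h1 - (1/2)*h0
    have := (mul_eq_zero.1 this).resolve_left (by positivity)
    linarith
  have hprod : Real.log ((spt μ r - p.1 + sdist (spt μ r) p)/p.2)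
      + Real.log ((spt μ (r + 4*α) - p.1 + sdist (spt μ (r + 4*α)) p)/p.2) = 2*x := by
    have e1 : spt μ r - p.1 + sdist (spt μ r) p = α/4*(1 + T)*(r + μ + 2*α*(1 - T)) := by
      rw [hD, ha]; unfold spt; ring
    have e2 : sdist (spt μ (r + 4*α)) p - (spt μ (r + 4*α) - p.1)
        = α/4*(1 - T)*(r + μ + 2*α*(1 - T)) := by
      rw [hE, ha]; unfold spt; ring
    have hT1 := H.hT1
    have hT2 := H.hT2
    have hc : 0 < r + μ + 2*α*(1 - T) := by
      have := mul_pos H.hα (sub_pos.2 hT2)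
      have := H.hr
      linarith
    have e3 : (spt μ (r + 4*α) - p.1 + sdist (spt μ (r + 4*α)) p)/p.2
        = p.2/(α/4*(1 - T)*(r + μ + 2*α*(1 - T))) := by
      rw [← e2, div_eq_div_iff hp.ne' (by linarith)]
      linear_combination hEsq
    have hα := H.hα
    rw [e1, e3, ← Real.log_mul (by
      have : 0 < 1 + T := by linarith
      positivity) (by
      have : 0 < 1 - T := by linarith
      positivity)]
    have e4 : α/4*(1 + T)*(r + μ + 2*α*(1 - T))/p.2*(p.2/(α/4*(1 - T)*(r + μ + 2*α*(1 - T))))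
        = Real.exp (2*x) := by
      have h6 : (1 + T) = Real.exp (2*x)*(1 - T) := by
        have hcosh := Real.cosh_pos x
        rw [hT, Real.tanh_eq_sinh_div_cosh]
        field_simp
        rw [add_comm, Real.sinh_add_cosh, Real.cosh_sub_sinh, ← Real.exp_add]
        congr 1; ring
      have h7 : 1 - T ≠ 0 := by linarith
      rw [h6]
      generalize r + μ + 2*α*(1 - T) = c at hc
      generalize 1 - T = d at h7
      field_simp
    rw [e4, Real.log_exp]
  unfold I0fun
  rw [hF, arsinh_div_eq_log _ hp, arsinh_div_eq_log _ hp, hprod]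
  ring

end InitialValue

lemma cpow_half_sq (w : ℂ) : (w ^ ((1:ℂ)/2))^2 = w := by
  have := Complex.cpow_nat_inv_pow w (n := 2) two_ne_zero
  rwa [Nat.cast_ofNat, ← one_div] at this

lemma cpow_half_re_pos {w : ℂ} (hw : w ∈ Complex.slitPlane) : 0 < (w ^ ((1:ℂ)/2)).re := by
  have h0 := Complex.slitPlane_ne_zero hw
  have h1 := Complex.neg_pi_lt_arg w
  have h2 := (Complex.mem_slitPlane_iff_arg.1 hw).1
  have h3 := lt_of_le_of_ne (Complex.arg_le_pi w) h2
  rw [Complex.cpow_def_of_ne_zero h0, Complex.exp_re]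
  have : (Complex.log w * (1/2)).im = w.arg/2 := by
    rw [show (1/2 : ℂ) = ((1/2 : ℝ) : ℂ) by push_cast; rfl, Complex.im_mul_ofReal, Complex.log_im]
    ring
  rw [this]
  exact mul_pos (Real.exp_pos _) (Real.cos_pos_of_mem_Ioo ⟨by linarith, by linarith⟩)

lemma sq_im (z : ℂ) : (z^2).im = 2*z.re*z.im := by rw [pow_two, Complex.mul_im]; ring

lemma sq_re (z : ℂ) : (z^2).re = z.re^2 - z.im^2 := by rw [pow_two, Complex.mul_re]; ring

lemma cpow_half_im_pos {w : ℂ} (hw : 0 < w.im) : 0 < (w ^ ((1:ℂ)/2)).im := by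
  have h1 := cpow_half_re_pos (Complex.mem_slitPlane_iff.2 (Or.inr hw.ne'))
  have h2 := sq_im (w ^ ((1:ℂ)/2))
  rw [cpow_half_sq] at h2
  rw [h2] at hw
  exact (mul_pos_iff_of_pos_left (by positivity)).1 hw

lemma hasDerivAt_cpow_half {w : ℂ} (hw : w ∈ Complex.slitPlane) :
    HasDerivAt (fun w : ℂ => w ^ ((1:ℂ)/2)) (1/(2*w ^ ((1:ℂ)/2))) w := by
  refine ((hasDerivAt_id w).cpow_const (c := (1:ℂ)/2) hw).congr_deriv ?_
  have h0 := Complex.slitPlane_ne_zero hw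
  have h1 := cpow_half_sq w
  have h2 : w ^ ((1:ℂ)/2) ≠ 0 := fun h => by
    rw [h] at h1; exact h0 (by rw [← h1]; ring)
  simp only [id]
  rw [Complex.cpow_sub _ _ h0, Complex.cpow_one]
  field_simp
  rw [h1]

lemma exp_quarter : Complex.exp (Complex.I * (π : ℂ) / 4) = ((√2/2 : ℝ) : ℂ) * (1 + Complex.I) := by
  rw [show Complex.I * (π : ℂ) / 4 = ((π/4 : ℝ) : ℂ) * Complex.I by push_cast; ring]
  apply Complex.ext
  · rw [Complex.exp_ofReal_mul_I_re, Real.cos_pi_div_four, Complex.re_ofReal_mul]; simp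
  · rw [Complex.exp_ofReal_mul_I_im, Real.sin_pi_div_four, Complex.im_ofReal_mul]; simp

lemma re_rotated (μ : ℝ) (z : ℂ) : (-Complex.I * (16 * z - (μ:ℂ)^2)).re = 16*z.im := by
  rw [show (μ:ℂ)^2 = ((μ^2 : ℝ) : ℂ) by push_cast; ring, Complex.mul_re, Complex.neg_re,
    Complex.neg_im, Complex.I_re, Complex.I_im, Complex.sub_im, Complex.ofReal_im, Complex.mul_im]
  norm_num

/-- The square root `Rf` lies in the open first quadrant over the upper half plane. -/
lemma Rf_mem_quadrant (μ : ℝ) {z : ℂ} (hz : 0 < z.im) : 0 < (Rf μ z).re ∧ 0 < (Rf μ z).im := by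
  have hw := re_rotated μ z
  unfold Rf
  set w : ℂ := -Complex.I * (16 * z - (μ:ℂ)^2)
  have hwre : 0 < w.re := by rw [hw]; positivity
  have h1 := cpow_half_re_pos (Complex.mem_slitPlane_iff.2 (Or.inl hwre))
  have h2 := sq_re (w ^ ((1:ℂ)/2))
  rw [cpow_half_sq] at h2
  have h3 := abs_lt_of_sq_lt_sq (show (w ^ ((1:ℂ)/2)).im^2 < (w ^ ((1:ℂ)/2)).re^2 by linarith) h1.le
  have h4 := abs_lt.1 h3
  have h5 : (0:ℝ) < √2/2 := by positivity
  rw [exp_quarter, mul_assoc, Complex.re_ofReal_mul, Complex.im_ofReal_mul]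
  constructor <;> refine mul_pos h5 ?_
  · simp; linarith
  · simp; linarith

lemma Rf_sq (μ : ℝ) (z : ℂ) : Rf μ z^2 = 16*z - (μ:ℂ)^2 := by
  unfold Rf
  rw [mul_pow, cpow_half_sq, exp_quarter, mul_pow, ← Complex.ofReal_pow, div_pow,
    Real.sq_sqrt (by norm_num)]
  push_cast
  linear_combination (16*z - (μ:ℂ)^2)*(-(1/2)*Complex.I - 1)*Complex.I_sq

lemma hasDerivAt_Rf (μ : ℝ) {z : ℂ} (hz : 0 < z.im) : HasDerivAt (Rf μ) (8/Rf μ z) z := by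
  have hw := re_rotated μ z
  have hwre : 0 < (-Complex.I * (16 * z - (μ:ℂ)^2)).re := by rw [hw]; positivity
  have h1 := hasDerivAt_cpow_half (Complex.mem_slitPlane_iff.2 (Or.inl hwre))
  have h2 : HasDerivAt (fun z : ℂ => -Complex.I * (16 * z - (μ:ℂ)^2)) (-Complex.I*16) z := by
    refine ((((hasDerivAt_id z).const_mul 16).sub_const _).const_mul (-Complex.I)).congr_deriv ?_
    ring
  have h3 := (h1.comp z h2).const_mul (Complex.exp (Complex.I * (π : ℂ) / 4))
  refine HasDerivAt.congr_deriv (f := Rf μ) h3 ?_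
  have hs : (-Complex.I * (16 * z - (μ:ℂ)^2)) ^ ((1:ℂ)/2) ≠ 0 := fun h => by
    have := cpow_half_re_pos (Complex.mem_slitPlane_iff.2 (Or.inl hwre))
    rw [h] at this; simp at this
  have he : Complex.exp (Complex.I * (π : ℂ) / 4)^2 = Complex.I := by
    rw [← Complex.exp_nat_mul]
    refine Eq.trans ?_ Complex.exp_pi_div_two_mul_I
    congr 1; push_cast; ring
  have he0 := Complex.exp_ne_zero (Complex.I * (π : ℂ) / 4)
  unfold Rf
  generalize (-Complex.I * (16 * z - (μ:ℂ)^2)) ^ ((1:ℂ)/2) = s at hs ⊢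
  generalize Complex.exp (Complex.I * (π : ℂ) / 4) = e at he he0 ⊢
  field_simp
  rw [he]
  linear_combination (-16)*Complex.I_sq

lemma arg_mem_of_im_pos {w : ℂ} (h : 0 < w.im) : 0 < w.arg ∧ w.arg < π := by
  refine ⟨lt_of_le_of_ne (Complex.arg_nonneg_iff.2 h.le) fun h0 => ?_,
    Complex.arg_lt_pi_iff.2 (Or.inr h.ne')⟩
  exact h.ne' (Complex.arg_eq_zero_iff.1 h0.symm).2

lemma arg_mem_of_fourth {w : ℂ} (h : 0 < w.re) (h' : w.im < 0) : -(π/2) < w.arg ∧ w.arg < 0 :=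
  ⟨Complex.neg_pi_div_two_lt_arg_iff.2 (Or.inl h), Complex.arg_neg_iff.2 h'⟩

lemma ne_zero_of_im_ne_zero {w : ℂ} (h : w.im ≠ 0) : w ≠ 0 := fun h0 => h (by rw [h0]; rfl)

lemma log_mul_upper_fourth {x y : ℂ} (hx : 0 < x.im) (hy : 0 < y.re) (hy' : y.im < 0) :
    Complex.log (x*y) = Complex.log x + Complex.log y := by
  have h1 := arg_mem_of_im_pos hx
  have h2 := arg_mem_of_fourth hy hy'
  exact Complex.log_mul (ne_zero_of_im_ne_zero hx.ne') (ne_zero_of_im_ne_zero hy'.ne)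
    ⟨by linarith [Real.pi_pos], by linarith [Real.pi_pos]⟩

lemma log_neg_I_mul {w : ℂ} (h0 : w ≠ 0) (hw : -(π/2) < w.arg) :
    Complex.log (-Complex.I*w) = Complex.log w - (π/2)*Complex.I := by
  rw [Complex.log_mul (by simp) h0, Complex.log_neg_I]
  · ring
  · rw [Complex.arg_neg_I]
    exact ⟨by linarith, by linarith [Complex.arg_le_pi w, Real.pi_pos]⟩

/-- The four logarithm arguments occurring in `Phi`. -/
def logArg1 (μ : ℝ) (z : ℂ) : ℂ := (-Complex.I * (μ:ℂ) - Rf μ z)/2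
def logArg2 (μ : ℝ) (z : ℂ) : ℂ := (-Complex.I * (μ:ℂ) + Rf μ z)/2
def logArg3 (α δ μ : ℝ) (z : ℂ) : ℂ := Omg α δ z - Rf μ z / 2
def logArg4 (α δ μ : ℝ) (z : ℂ) : ℂ := Omg α δ z + Rf μ z / 2

lemma Phi_eq (α δ μ : ℝ) (z : ℂ) : Phi α δ μ z = -(μ:ℂ) * Complex.log 2
    + (4/(α:ℂ)) * ((z - (zP α δ μ : ℂ)) * Complex.log ((2/(α:ℂ)) * ((zP α δ μ : ℂ) - z)))
    + Complex.I*(logArg1 μ z*Complex.log (logArg1 μ z) + logArg2 μ z*Complex.log (logArg2 μ z)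
      - logArg3 α δ μ z*Complex.log (logArg3 α δ μ z)
      - logArg4 α δ μ z*Complex.log (logArg4 α δ μ z)) := by
  unfold Phi
  rw [show (-Complex.I * (μ:ℂ) - Rf μ z)/2 = logArg1 μ z from rfl,
    show (-Complex.I * (μ:ℂ) + Rf μ z)/2 = logArg2 μ z from rfl,
    show Omg α δ z - Rf μ z / 2 = logArg3 α δ μ z from rfl,
    show Omg α δ z + Rf μ z / 2 = logArg4 α δ μ z from rfl]
  have h1 : ((μ:ℂ) - Complex.I * Rf μ z)/2 = Complex.I*logArg1 μ z := by
    unfold logArg1; linear_combination (μ/2)*Complex.I_sq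
  have h2 : ((μ:ℂ) + Complex.I * Rf μ z)/2 = Complex.I*logArg2 μ z := by
    unfold logArg2; linear_combination (μ/2)*Complex.I_sq
  rw [h1, h2]
  ring

section LogForm

variable {α δ μ r : ℝ} {z : ℂ}

lemma real_add_I_mul_Rf (k : ℝ) (hk : 0 < k) (hz : 0 < z.im) :
    0 < ((k:ℂ) + Complex.I*Rf μ z).im ∧ 0 < ((k:ℂ) - Complex.I*Rf μ z).re ∧
      ((k:ℂ) - Complex.I*Rf μ z).im < 0 := by
  have h := Rf_mem_quadrant μ hz
  refine ⟨?_, ?_, ?_⟩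
  · simpa using h.1
  · simp; linarith
  · simpa using h.1

lemma logArg1_eq : logArg1 μ z = ((1/2 : ℝ) : ℂ)*(-Complex.I*((μ:ℂ) - Complex.I*Rf μ z)) := by
  unfold logArg1; push_cast; linear_combination (Rf μ z/2)*(-Complex.I_sq)

lemma logArg2_eq : logArg2 μ z = ((1/2 : ℝ) : ℂ)*(-Complex.I*((μ:ℂ) + Complex.I*Rf μ z)) := by
  unfold logArg2; push_cast; linear_combination (Rf μ z/2)*(Complex.I_sq)

lemma two_div_I_mul (hα : 0 < α) : (2:ℂ)/(Complex.I*α) = -(2*Complex.I/α) := by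
  have hα' : (α:ℂ) ≠ 0 := by exact_mod_cast hα.ne'
  have hI := Complex.I_ne_zero
  field_simp
  linear_combination Complex.I_sq

lemma logArg3_eq (hα : 0 < α) (hr : r^2 + 4*α*r = μ^2 - 4*(1 - α*δ)) :
    logArg3 α δ μ z = ((1/(8*α) : ℝ) : ℂ)*(-Complex.I*((((r + 4*α : ℝ) : ℂ) + Complex.I*Rf μ z)
      *((r:ℂ) - Complex.I*Rf μ z))) := by
  have hα' : (α:ℂ) ≠ 0 := by exact_mod_cast hα.ne'
  have hrc : (r:ℂ)^2 + 4*α*r = μ^2 - 4*(1 - α*δ) := by exact_mod_cast hr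
  have key : (((r + 4*α : ℝ) : ℂ) + Complex.I*Rf μ z)*((r:ℂ) - Complex.I*Rf μ z)
      = 16*z - 4*(1 - α*δ) - 4*α*Complex.I*Rf μ z := by
    push_cast
    linear_combination hrc + Rf_sq μ z - Rf μ z^2*Complex.I_sq
  rw [key]
  unfold logArg3 Omg
  rw [two_div_I_mul hα]
  push_cast
  field_simp
  linear_combination (-32*α*Rf μ z)*Complex.I_sq

lemma logArg4_eq (hα : 0 < α) (hr : r^2 + 4*α*r = μ^2 - 4*(1 - α*δ)) :
    logArg4 α δ μ z = ((1/(8*α) : ℝ) : ℂ)*(-Complex.I*(((r:ℂ) + Complex.I*Rf μ z)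
      *(((r + 4*α : ℝ) : ℂ) - Complex.I*Rf μ z))) := by
  have hα' : (α:ℂ) ≠ 0 := by exact_mod_cast hα.ne'
  have hrc : (r:ℂ)^2 + 4*α*r = μ^2 - 4*(1 - α*δ) := by exact_mod_cast hr
  have key : ((r:ℂ) + Complex.I*Rf μ z)*(((r + 4*α : ℝ) : ℂ) - Complex.I*Rf μ z)
      = 16*z - 4*(1 - α*δ) + 4*α*Complex.I*Rf μ z := by
    push_cast
    linear_combination hrc + Rf_sq μ z - Rf μ z^2*Complex.I_sq
  rw [key]
  unfold logArg4 Omg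
  rw [two_div_I_mul hα]
  push_cast
  field_simp
  linear_combination (32*α*Rf μ z)*Complex.I_sq

lemma log_logArg1 (hμ : 0 < μ) (hz : 0 < z.im) : Complex.log (logArg1 μ z)
    = (Real.log (1/2) : ℂ) + (Complex.log ((μ:ℂ) - Complex.I*Rf μ z) - (π/2)*Complex.I) := by
  obtain ⟨h1, h2, h3⟩ := real_add_I_mul_Rf (μ := μ) μ hμ hz
  have h0 := ne_zero_of_im_ne_zero h3.ne
  rw [logArg1_eq, Complex.log_ofReal_mul (by norm_num) (mul_ne_zero (by simp) h0),
    log_neg_I_mul h0 (arg_mem_of_fourth h2 h3).1]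

lemma log_logArg2 (hμ : 0 < μ) (hz : 0 < z.im) : Complex.log (logArg2 μ z)
    = (Real.log (1/2) : ℂ) + (Complex.log ((μ:ℂ) + Complex.I*Rf μ z) - (π/2)*Complex.I) := by
  obtain ⟨h1, h2, h3⟩ := real_add_I_mul_Rf (μ := μ) μ hμ hz
  have h0 := ne_zero_of_im_ne_zero h1.ne'
  rw [logArg2_eq, Complex.log_ofReal_mul (by norm_num) (mul_ne_zero (by simp) h0),
    log_neg_I_mul h0 (by linarith [(arg_mem_of_im_pos h1).1, Real.pi_pos])]

lemma log_scaled_mul {c : ℝ} (hc : 0 < c) {x y : ℂ} (hx : 0 < x.im) (hy : 0 < y.re)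
    (hy' : y.im < 0) : Complex.log ((c:ℂ)*(-Complex.I*(x*y)))
      = (Real.log c : ℂ) + (Complex.log x + Complex.log y - (π/2)*Complex.I) ∧
      (c:ℂ)*(-Complex.I*(x*y)) ∈ Complex.slitPlane := by
  have hx0 := ne_zero_of_im_ne_zero hx.ne'
  have hy0 := ne_zero_of_im_ne_zero hy'.ne
  have h0 : x*y ≠ 0 := mul_ne_zero hx0 hy0
  have h1 := arg_mem_of_im_pos hx
  have h2 := arg_mem_of_fourth hy hy'
  have h3 := log_mul_upper_fourth hx hy hy'
  have h4 : (x*y).arg = x.arg + y.arg := by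
    have := congrArg Complex.im h3
    simpa [Complex.log_im] using this
  have h5 : Complex.log ((c:ℂ)*(-Complex.I*(x*y)))
      = (Real.log c : ℂ) + (Complex.log x + Complex.log y - (π/2)*Complex.I) := by
    rw [Complex.log_ofReal_mul hc (mul_ne_zero (by simp) h0), log_neg_I_mul h0 (by linarith), h3]
  refine ⟨h5, Complex.mem_slitPlane_iff_arg.2 ⟨?_, mul_ne_zero (by exact_mod_cast hc.ne') (mul_ne_zero (by simp) h0)⟩⟩
  have h6 := congrArg Complex.im h5
  rw [Complex.log_im] at h6
  rw [h6]
  simp [Complex.log_im]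
  intro h
  linarith [Real.pi_pos]

lemma log_logArg3 (hα : 0 < α) (hr0 : 0 < r) (hr : r^2 + 4*α*r = μ^2 - 4*(1 - α*δ))
    (hz : 0 < z.im) : Complex.log (logArg3 α δ μ z) = (Real.log (1/(8*α)) : ℂ)
      + (Complex.log (((r + 4*α : ℝ) : ℂ) + Complex.I*Rf μ z)
        + Complex.log ((r:ℂ) - Complex.I*Rf μ z) - (π/2)*Complex.I) ∧
      logArg3 α δ μ z ∈ Complex.slitPlane := by
  obtain ⟨-, h2, h3⟩ := real_add_I_mul_Rf (μ := μ) r hr0 hz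
  obtain ⟨h1, -, -⟩ := real_add_I_mul_Rf (μ := μ) (r + 4*α) (by linarith) hz
  rw [logArg3_eq hα hr]
  exact log_scaled_mul (by positivity) h1 h2 h3

lemma log_logArg4 (hα : 0 < α) (hr0 : 0 < r) (hr : r^2 + 4*α*r = μ^2 - 4*(1 - α*δ))
    (hz : 0 < z.im) : Complex.log (logArg4 α δ μ z) = (Real.log (1/(8*α)) : ℂ)
      + (Complex.log ((r:ℂ) + Complex.I*Rf μ z)
        + Complex.log (((r + 4*α : ℝ) : ℂ) - Complex.I*Rf μ z) - (π/2)*Complex.I) ∧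
      logArg4 α δ μ z ∈ Complex.slitPlane := by
  obtain ⟨-, h2, h3⟩ := real_add_I_mul_Rf (μ := μ) (r + 4*α) (by linarith) hz
  obtain ⟨h1, -, -⟩ := real_add_I_mul_Rf (μ := μ) r hr0 hz
  rw [logArg4_eq hα hr]
  exact log_scaled_mul (by positivity) h1 h2 h3

lemma hasDerivAt_mul_log {f : ℂ → ℂ} {f' : ℂ} (hf : HasDerivAt f f' z)
    (hs : f z ∈ Complex.slitPlane) :
    HasDerivAt (fun z => f z*Complex.log (f z)) (f'*(Complex.log (f z) + 1)) z := by
  refine (hf.fun_mul (hf.clog hs)).congr_deriv ?_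
  have := Complex.slitPlane_ne_zero hs
  field_simp

lemma hasDerivAt_Phi (hα : 0 < α) (hμ : 0 < μ) (hr0 : 0 < r)
    (hr : r^2 + 4*α*r = μ^2 - 4*(1 - α*δ)) (hz : 0 < z.im) :
    HasDerivAt (Phi α δ μ) ((4/(α:ℂ))*Complex.log ((2/(α:ℂ)) * ((zP α δ μ : ℂ) - z))
      - (2/α)*(Complex.log (logArg3 α δ μ z) + Complex.log (logArg4 α δ μ z))
      + (4*Complex.I/Rf μ z)*(Complex.log (logArg2 μ z) - Complex.log (logArg1 μ z)
        + Complex.log (logArg3 α δ μ z) - Complex.log (logArg4 α δ μ z))) z := by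
  have hR := hasDerivAt_Rf μ hz
  have hq := Rf_mem_quadrant μ hz
  have hR0 := ne_zero_of_im_ne_zero hq.2.ne'
  have hα' : (α:ℂ) ≠ 0 := by exact_mod_cast hα.ne'
  have hO : HasDerivAt (Omg α δ) (2 / (Complex.I * α)) z := by
    unfold Omg
    exact (((hasDerivAt_id z).sub_const _).const_mul _).congr_deriv (by ring)
  have d1 : HasDerivAt (logArg1 μ) (-4/Rf μ z) z := by
    refine HasDerivAt.congr_deriv (f := logArg1 μ) ((hR.const_sub (-Complex.I * (μ:ℂ))).div_const 2) (by ring)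
  have d2 : HasDerivAt (logArg2 μ) (4/Rf μ z) z := by
    refine HasDerivAt.congr_deriv (f := logArg2 μ) ((hR.const_add (-Complex.I * (μ:ℂ))).div_const 2) (by ring)
  have d3 : HasDerivAt (logArg3 α δ μ) (2/(Complex.I*α) - 4/Rf μ z) z :=
    HasDerivAt.congr_deriv (f := logArg3 α δ μ) (hO.sub (hR.div_const 2)) (by ring)
  have d4 : HasDerivAt (logArg4 α δ μ) (2/(Complex.I*α) + 4/Rf μ z) z :=
    HasDerivAt.congr_deriv (f := logArg4 α δ μ) (hO.add (hR.div_const 2)) (by ring)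
  have s1 : logArg1 μ z ∈ Complex.slitPlane := Complex.mem_slitPlane_iff.2 (Or.inr (by
    unfold logArg1
    rw [show ((-Complex.I * (μ:ℂ) - Rf μ z)/2) = ((1/2:ℝ):ℂ)*(-Complex.I * (μ:ℂ) - Rf μ z) by push_cast; ring,
      Complex.im_ofReal_mul]
    simp; intro h; linarith [hq.2]))
  have s2 : logArg2 μ z ∈ Complex.slitPlane := Complex.mem_slitPlane_iff.2 (Or.inl (by
    unfold logArg2
    rw [show ((-Complex.I * (μ:ℂ) + Rf μ z)/2) = ((1/2:ℝ):ℂ)*(-Complex.I * (μ:ℂ) + Rf μ z) by push_cast; ring,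
      Complex.re_ofReal_mul]
    simpa using hq.1))
  have s3 := (log_logArg3 hα hr0 hr hz).2
  have s4 := (log_logArg4 hα hr0 hr hz).2
  have s0 : (2/(α:ℂ)) * ((zP α δ μ : ℂ) - z) ∈ Complex.slitPlane :=
    Complex.mem_slitPlane_iff.2 (Or.inr (by
      rw [show (2/(α:ℂ)) = ((2/α:ℝ):ℂ) by push_cast; ring, Complex.im_ofReal_mul]
      have : 0 < 2/α := by positivity
      simp
      exact ⟨hα.ne', hz.ne'⟩))
  have hi : Complex.I*((2:ℂ)/(Complex.I*α)) = 2/α := by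
    have := Complex.I_ne_zero
    field_simp
  have d0 : HasDerivAt (fun z => (z - (zP α δ μ : ℂ)) * Complex.log ((2/(α:ℂ)) * ((zP α δ μ : ℂ) - z)))
      (Complex.log ((2/(α:ℂ)) * ((zP α δ μ : ℂ) - z)) + 1) z := by
    have e1 := ((hasDerivAt_id z).const_sub (zP α δ μ : ℂ)).const_mul (2/(α:ℂ))
    refine (((hasDerivAt_id z).sub_const (zP α δ μ : ℂ)).fun_mul (e1.clog s0)).congr_deriv ?_
    have := Complex.slitPlane_ne_zero s0
    have h2 := right_ne_zero_of_mul this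
    simp only [id]
    field_simp
    ring
  have hall := ((d0.const_mul (4/(α:ℂ))).const_add (-(μ:ℂ) * Complex.log 2)).fun_add
    (((((hasDerivAt_mul_log d1 s1).fun_add (hasDerivAt_mul_log d2 s2)).fun_sub
      (hasDerivAt_mul_log d3 s3)).fun_sub (hasDerivAt_mul_log d4 s4)).const_mul Complex.I)
  rw [show Phi α δ μ = _ from funext (Phi_eq α δ μ)]
  refine hall.congr_deriv ?_
  linear_combination (-(Complex.log (logArg3 α δ μ z) + 1) - (Complex.log (logArg4 α δ μ z) + 1))*hi

end LogForm

section IntegralForm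

variable {α δ μ r : ℝ} {z : ℂ}

lemma zP_eq_zpt (hr : r^2 + 4*α*r = μ^2 - 4*(1 - α*δ)) : zP α δ μ = zpt α μ r := by
  unfold zP zpt spt; linarith

lemma sub_ofReal_ne_zero (hz : 0 < z.im) (σ : ℝ) : z - (σ:ℂ) ≠ 0 :=
  ne_zero_of_im_ne_zero (by simpa using hz.ne')

lemma integral_one_div_sub (hz : 0 < z.im) (c d : ℝ) :
    ∫ σ in c..d, 1/(z - (σ:ℂ)) = Complex.log (z - (c:ℂ)) - Complex.log (z - (d:ℂ)) := by
  have hd : ∀ σ ∈ uIcc c d, HasDerivAt (fun σ : ℝ => -Complex.log (z - (σ:ℂ))) (1/(z - (σ:ℂ))) σ := by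
    intro σ _
    have h1 : HasDerivAt (fun σ : ℝ => z - (σ:ℂ)) (-1) σ :=
      (Complex.ofRealCLM.hasDerivAt (x := σ)).const_sub z
    refine (h1.clog_real (Complex.mem_slitPlane_iff.2 (Or.inr (by simpa using hz.ne')))).neg.congr_deriv ?_
    ring
  have hc : Continuous fun σ : ℝ => 1/(z - (σ:ℂ)) :=
    continuous_const.div (by fun_prop) (sub_ofReal_ne_zero hz)
  rw [intervalIntegral.integral_eq_sub_of_hasDerivAt hd (hc.intervalIntegrable _ _)]
  ring

lemma sub_spt (k : ℝ) : z - ((spt μ k : ℝ) : ℂ) = ((k:ℂ)^2 + Rf μ z^2)/16 := by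
  rw [Rf_sq]; unfold spt; push_cast; ring

/-- The difference of logarithms `log (k + iR) - log (k - iR)`. -/
def logGap (μ : ℝ) (z : ℂ) (k : ℝ) : ℂ :=
  Complex.log ((k:ℂ) + Complex.I*Rf μ z) - Complex.log ((k:ℂ) - Complex.I*Rf μ z)

lemma hasDerivAt_logGap (hz : 0 < z.im) {k : ℝ} (hk : 0 < k) :
    HasDerivAt (logGap μ z) (-(Complex.I*Rf μ z/8)*(1/(z - (spt μ k : ℝ)))) k := by
  obtain ⟨h1, h2, h3⟩ := real_add_I_mul_Rf (μ := μ) k hk hz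
  have e1 : HasDerivAt (fun k : ℝ => (k:ℂ) + Complex.I*Rf μ z) 1 k :=
    (Complex.ofRealCLM.hasDerivAt (x := k)).add_const _
  have e2 : HasDerivAt (fun k : ℝ => (k:ℂ) - Complex.I*Rf μ z) 1 k :=
    (Complex.ofRealCLM.hasDerivAt (x := k)).sub_const _
  have := (e1.clog_real (Complex.mem_slitPlane_iff.2 (Or.inr h1.ne'))).fun_sub
    (e2.clog_real (Complex.mem_slitPlane_iff.2 (Or.inl h2)))
  refine HasDerivAt.congr_deriv (f := logGap μ z) this ?_
  have n1 := ne_zero_of_im_ne_zero h1.ne'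
  have n2 := ne_zero_of_im_ne_zero h3.ne
  have n3 : (k:ℂ)^2 + Rf μ z^2 = ((k:ℂ) + Complex.I*Rf μ z)*((k:ℂ) - Complex.I*Rf μ z) := by
    linear_combination Rf μ z^2*Complex.I_sq
  rw [sub_spt, n3]
  field_simp
  ring

lemma continuous_one_div_sub_spt (hz : 0 < z.im) :
    Continuous fun k : ℝ => 1/(z - ((spt μ k : ℝ) : ℂ)) := by
  unfold spt
  exact continuous_const.div (by fun_prop) fun k => sub_ofReal_ne_zero hz _

lemma integrable_one_div_sub_spt (hz : 0 < z.im) :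
    Integrable fun k : ℝ => 1/(z - ((spt μ k : ℝ) : ℂ)) := by
  have h := (integrable_kernel μ one_pos (p := (z.re, z.im)) hz)
  refine Integrable.mono' h (continuous_one_div_sub_spt hz).aestronglyMeasurable
    (Eventually.of_forall fun k => ?_)
  have : ‖z - ((spt μ k : ℝ) : ℂ)‖ = sdist (spt μ k) (z.re, z.im) := by
    unfold sdist
    rw [Complex.norm_eq_sqrt_sq_add_sq]
    congr 1
    simp
    ring
  rw [norm_div, this]
  simp

lemma integral_logGap (hz : 0 < z.im) {c d : ℝ} (hc : 0 < c) (hcd : c ≤ d) :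
    -(Complex.I*Rf μ z/8)*(∫ k in c..d, 1/(z - ((spt μ k : ℝ) : ℂ))) = logGap μ z d - logGap μ z c := by
  rw [← intervalIntegral.integral_const_mul]
  refine intervalIntegral.integral_eq_sub_of_hasDerivAt (fun k hk => ?_) ?_
  · rw [uIcc_of_le hcd] at hk
    exact hasDerivAt_logGap hz (hc.trans_le hk.1)
  · exact ((continuous_one_div_sub_spt hz).const_mul _ |>.intervalIntegrable _ _)

lemma tendsto_logGap (hz : 0 < z.im) : Tendsto (logGap μ z) atTop (𝓝 0) := by
  have hlim : ∀ w : ℂ, Tendsto (fun k : ℝ => Complex.log (1 + w/(k:ℂ))) atTop (𝓝 0) := by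
    intro w
    have h1 : Tendsto (fun k : ℝ => 1 + w/(k:ℂ)) atTop (𝓝 (1 + 0)) := by
      refine tendsto_const_nhds.add ?_
      have := ((Complex.continuous_ofReal.tendsto 0).comp tendsto_inv_atTop_zero).const_mul w
      simpa [Function.comp_def, div_eq_mul_inv] using this
    have h2 := (continuousAt_clog (x := 1 + 0) (by simp)).tendsto.comp h1
    simpa [Function.comp_def] using h2
  have h := (hlim (Complex.I*Rf μ z)).sub (hlim (-(Complex.I*Rf μ z)))
  rw [sub_zero] at h
  refine h.congr' ?_
  filter_upwards [eventually_gt_atTop 0] with k hk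
  have hk' : (k:ℂ) ≠ 0 := by exact_mod_cast hk.ne'
  obtain ⟨h1, h2, h3⟩ := real_add_I_mul_Rf (μ := μ) k hk hz
  unfold logGap
  have n1 := ne_zero_of_im_ne_zero h1.ne'
  have n2 := ne_zero_of_im_ne_zero h3.ne
  have f1 : (k:ℂ) + Complex.I*Rf μ z = (k:ℂ)*(1 + Complex.I*Rf μ z/k) := by field_simp
  have f2 : (k:ℂ) - Complex.I*Rf μ z = (k:ℂ)*(1 + -(Complex.I*Rf μ z)/k) := by field_simp; ring
  rw [f1] at n1 ⊢
  rw [f2] at n2 ⊢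
  rw [Complex.log_ofReal_mul hk (right_ne_zero_of_mul n1),
    Complex.log_ofReal_mul hk (right_ne_zero_of_mul n2)]
  ring

lemma integral_Ioi_logGap (hz : 0 < z.im) {c : ℝ} (hc : 0 < c) :
    (Complex.I*Rf μ z/8)*(∫ k in Ioi c, 1/(z - ((spt μ k : ℝ) : ℂ))) = logGap μ z c := by
  have h1 := intervalIntegral_tendsto_integral_Ioi c
    (integrable_one_div_sub_spt (μ := μ) hz).integrableOn tendsto_id
  have h2 := (h1.const_mul (Complex.I*Rf μ z/8))
  have h3 : Tendsto (fun d => logGap μ z c - logGap μ z d) atTop (𝓝 (logGap μ z c - 0)) :=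
    tendsto_const_nhds.sub (tendsto_logGap hz)
  rw [sub_zero] at h3
  refine tendsto_nhds_unique h2 (h3.congr' ?_)
  filter_upwards [eventually_ge_atTop c] with d hd
  have := integral_logGap (μ := μ) hz hc hd
  simp only [id]
  linear_combination this

lemma log_add_log_eq (hz : 0 < z.im) {k : ℝ} (hk : 0 < k) :
    Complex.log ((k:ℂ) + Complex.I*Rf μ z) + Complex.log ((k:ℂ) - Complex.I*Rf μ z)
      = Real.log 16 + Complex.log (z - ((spt μ k : ℝ) : ℂ)) := by
  obtain ⟨h1, h2, h3⟩ := real_add_I_mul_Rf (μ := μ) k hk hz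
  rw [← log_mul_upper_fourth h1 h2 h3, ← Complex.log_ofReal_mul (by norm_num) (sub_ofReal_ne_zero hz _),
    sub_spt]
  congr 1
  push_cast
  linear_combination -Rf μ z^2*Complex.I_sq

/-- Integral representation of `Φ'` in the upper half plane. -/
lemma deriv_Phi_eq (hα : 0 < α) (hr0 : 0 < r) (hrμ : r < μ)
    (hr : r^2 + 4*α*r = μ^2 - 4*(1 - α*δ)) (hz : 0 < z.im) :
    deriv (Phi α δ μ) z = -(2*π*Complex.I/α)
      - (2/α)*((∫ σ in spt μ r..zP α δ μ, 1/(z - (σ:ℂ)))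
        + ∫ σ in spt μ (r + 4*α)..zP α δ μ, 1/(z - (σ:ℂ)))
      + (1/2)*(∫ k in Ioc r μ, 1/(z - ((spt μ k : ℝ) : ℂ)))
      - (1/2)*(∫ k in Ioi (r + 4*α), 1/(z - ((spt μ k : ℝ) : ℂ))) := by
  have hμ := hr0.trans hrμ
  have hα' : (α:ℂ) ≠ 0 := by exact_mod_cast hα.ne'
  have hR0 := ne_zero_of_im_ne_zero (Rf_mem_quadrant μ hz).2.ne'
  rw [(hasDerivAt_Phi hα hμ hr0 hr hz).deriv, (log_logArg3 hα hr0 hr hz).1,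
    (log_logArg4 hα hr0 hr hz).1, log_logArg1 hμ hz, log_logArg2 hμ hz,
    integral_one_div_sub hz, integral_one_div_sub hz, ← intervalIntegral.integral_of_le hrμ.le]
  have hR : 0 < r + 4*α := by linarith
  have g1 := integral_logGap (μ := μ) hz hr0 hrμ.le
  have g2 := integral_Ioi_logGap (μ := μ) hz hR
  have l1 := log_add_log_eq (μ := μ) hz hr0
  have l2 := log_add_log_eq (μ := μ) hz hR
  unfold logGap at g1 g2
  have hzP : Complex.log ((2/(α:ℂ)) * ((zP α δ μ : ℂ) - z))
      = (Real.log (2/α) : ℂ) + (Complex.log (z - (zP α δ μ : ℂ)) - π*Complex.I) := by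
    rw [show (2/(α:ℂ)) = ((2/α:ℝ):ℂ) by push_cast; ring, ← neg_sub z, Complex.log_ofReal_mul
      (by positivity) (neg_ne_zero.2 (sub_ofReal_ne_zero hz _))]
    have him : 0 < (z - (zP α δ μ : ℂ)).im := by simpa using hz
    congr 1
    rw [Complex.log, Complex.log, norm_neg, Complex.arg_neg_eq_arg_sub_pi_of_im_pos him]
    push_cast
    ring
  have hlog : Real.log (2/α) = Real.log 16 + Real.log (1/(8*α)) := by
    rw [← Real.log_mul (by norm_num) (by positivity)]; congr 1; field_simp; norm_num
  have hlogc : (Real.log (2/α) : ℂ) = Real.log 16 + Real.log (1/(8*α)) := by exact_mod_cast hlog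
  rw [hzP, hlogc]
  have key : ∀ J₁ J₂ : ℂ, (4*Complex.I/Rf μ z)*(-(Complex.I*Rf μ z/8)*J₁ + (Complex.I*Rf μ z/8)*J₂)
      = (1/2)*J₁ - (1/2)*J₂ := by
    intro J₁ J₂
    field_simp
    linear_combination (-8*J₁ + 8*J₂)*Complex.I_sq
  have hk := key (∫ k in r..μ, 1/(z - ((spt μ k : ℝ) : ℂ)))
    (∫ k in Ioi (r + 4*α), 1/(z - ((spt μ k : ℝ) : ℂ)))
  linear_combination hk - (4*Complex.I/Rf μ z)*(g1 + g2) - (2/(α:ℂ))*(l1 + l2)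

end IntegralForm

/-- Parametrisation of the segment from `q` to the real point `c`. -/
def segPt (c : ℝ) (q : ℂ) (u : ℝ) : ℂ := q + (u:ℂ)*((c:ℂ) - q)

/-- Displacement of the conjugate branch point in the affine coordinate of the segment. -/
def segShift (c : ℝ) (q : ℂ) : ℂ := 2*Complex.I*q.im/((c:ℂ) - q)

/-- Boundary value of the square root on the left of the segment. -/
def segRoot (c : ℝ) (q : ℂ) (u : ℝ) : ℂ :=
  ((c:ℂ) - q)*((√u : ℂ)*((u:ℂ) + segShift c q)^((1:ℂ)/2))

section Segment

variable {c : ℝ} {q : ℂ}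

lemma dir_re_im : ((c:ℂ) - q).re = c - q.re ∧ ((c:ℂ) - q).im = -q.im := by simp

lemma dir_ne_zero (hq : 0 < q.im) : (c:ℂ) - q ≠ 0 :=
  ne_zero_of_im_ne_zero (by rw [dir_re_im.2]; linarith)

lemma sub_conj_eq : q - conj q = 2*Complex.I*q.im := by
  apply Complex.ext <;> simp; ring

lemma normSq_dir_pos (hq : 0 < q.im) : 0 < Complex.normSq ((c:ℂ) - q) :=
  Complex.normSq_pos.2 (dir_ne_zero hq)

lemma segShift_im : (segShift c q).im = 2*q.im*(c - q.re)/Complex.normSq ((c:ℂ) - q) := by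
  unfold segShift
  rw [Complex.div_im]
  simp

lemma segShift_im_pos (hq : 0 < q.im) (hqc : q.re < c) : 0 < (segShift c q).im := by
  rw [segShift_im]
  have := normSq_dir_pos (c := c) hq
  have : 0 < c - q.re := by linarith
  positivity

lemma add_segShift_im_pos (hq : 0 < q.im) (hqc : q.re < c) (u : ℝ) :
    0 < ((u:ℂ) + segShift c q).im := by
  simpa using segShift_im_pos hq hqc

lemma add_segShift_mem (hq : 0 < q.im) (hqc : q.re < c) (u : ℝ) :
    (u:ℂ) + segShift c q ∈ Complex.slitPlane :=
  Complex.mem_slitPlane_iff.2 (Or.inr (add_segShift_im_pos hq hqc u).ne')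

lemma dir_mul_segShift (hq : 0 < q.im) : ((c:ℂ) - q)*segShift c q = 2*Complex.I*q.im := by
  have := dir_ne_zero (c := c) hq
  unfold segShift; field_simp

lemma segRoot_sq (hq : 0 < q.im) {u : ℝ} (hu : 0 ≤ u) :
    segRoot c q u^2 = (segPt c q u - q)*(segPt c q u - conj q) := by
  unfold segRoot segPt
  have h1 : ((√u : ℝ) : ℂ)^2 = (u:ℂ) := by exact_mod_cast Real.sq_sqrt hu
  rw [mul_pow, mul_pow, h1, cpow_half_sq]
  have h2 := dir_mul_segShift (c := c) hq
  have h3 := sub_conj_eq (q := q)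
  linear_combination ((c:ℂ) - q)*u*(h2 - h3)

lemma segRoot_sq' (hq : 0 < q.im) {u : ℝ} (hu : 0 ≤ u) :
    segRoot c q u^2 = (segPt c q u - q.re)^2 + q.im^2 := by
  rw [segRoot_sq hq hu]
  have h1 : q = q.re + q.im*Complex.I := (Complex.re_add_im q).symm
  have h2 : conj q = q.re - q.im*Complex.I := by
    apply Complex.ext <;> simp
  rw [h2]
  generalize segPt c q u = w
  generalize q.re = a at *
  generalize q.im = b at *
  subst h1
  linear_combination (-b^2)*Complex.I_sq

lemma segRoot_ne_zero (hq : 0 < q.im) (hqc : q.re < c) {u : ℝ} (hu : 0 < u) :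
    segRoot c q u ≠ 0 := by
  unfold segRoot
  refine mul_ne_zero (dir_ne_zero hq) (mul_ne_zero ?_ ?_)
  · exact_mod_cast (Real.sqrt_pos.2 hu).ne'
  · exact ne_zero_of_im_ne_zero (cpow_half_im_pos (add_segShift_im_pos hq hqc u)).ne'

lemma continuous_segRoot (hq : 0 < q.im) (hqc : q.re < c) : Continuous (segRoot c q) := by
  unfold segRoot
  refine continuous_const.mul ((by fun_prop : Continuous fun u : ℝ => ((√u : ℝ) : ℂ)).mul ?_)
  refine Continuous.cpow (by fun_prop) continuous_const (add_segShift_mem hq hqc)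

lemma continuous_segPt : Continuous (segPt c q) := by unfold segPt; fun_prop

lemma segPt_im (u : ℝ) : (segPt c q u).im = (1 - u)*q.im := by
  unfold segPt; simp; ring

lemma hasDerivAt_segPt (u : ℝ) : HasDerivAt (segPt c q) ((c:ℂ) - q) u := by
  unfold segPt
  exact (((Complex.ofRealCLM.hasDerivAt (x := u)).mul_const _).const_add _).congr_deriv (by simp)

lemma hasDerivAt_segRoot (hq : 0 < q.im) (hqc : q.re < c) {u : ℝ} (hu : 0 < u) :
    HasDerivAt (segRoot c q) (((c:ℂ) - q)*(segPt c q u - q.re)/segRoot c q u) u := by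
  have h1 : HasDerivAt (fun u : ℝ => ((√u : ℝ) : ℂ)) ((1/(2*√u) : ℝ) : ℂ) u :=
    (Real.hasDerivAt_sqrt hu.ne').ofReal_comp
  have h2 : HasDerivAt (fun u : ℝ => ((u:ℂ) + segShift c q)^((1:ℂ)/2))
      (1/(2*((u:ℂ) + segShift c q)^((1:ℂ)/2))) u :=
    HasDerivAt.comp_ofReal (e := fun w : ℂ => (w + segShift c q)^((1:ℂ)/2))
      (HasDerivAt.comp_add_const (u:ℂ) (segShift c q)
        (hasDerivAt_cpow_half (add_segShift_mem hq hqc u)))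
  have h3 := ((h1.fun_mul h2).const_mul ((c:ℂ) - q))
  refine HasDerivAt.congr_deriv (f := segRoot c q) h3 ?_
  have hs : ((√u : ℝ) : ℂ) ≠ 0 := by exact_mod_cast (Real.sqrt_pos.2 hu).ne'
  have hs2 : ((√u : ℝ) : ℂ)^2 = (u:ℂ) := by exact_mod_cast Real.sq_sqrt hu.le
  have hg : ((u:ℂ) + segShift c q)^((1:ℂ)/2) ≠ 0 :=
    ne_zero_of_im_ne_zero (cpow_half_im_pos (add_segShift_im_pos hq hqc u)).ne'
  have hg2 := cpow_half_sq ((u:ℂ) + segShift c q)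
  have hv := dir_ne_zero (c := c) hq
  have hvs := dir_mul_segShift (c := c) hq
  have h1 : q - q.re = q.im*Complex.I := by
    apply Complex.ext <;> simp
  unfold segRoot segPt
  push_cast
  generalize ((u:ℂ) + segShift c q)^((1:ℂ)/2) = g at *
  generalize ((√u : ℝ) : ℂ) = s at *
  field_simp
  linear_combination ((c:ℂ) - q)*(hg2 + hs2) + hvs - 2*h1

lemma dir_mul_ne_neg (hq : 0 < q.im) {D : ℝ} (hD : 0 < D) {g : ℂ} (hg : 0 < g.im) :
    ((c:ℂ) - q)*g ≠ -(D:ℂ) := by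
  intro h
  have hv := normSq_dir_pos (c := c) hq
  have h4 : (Complex.normSq ((c:ℂ) - q) : ℂ)*g = ((-D : ℝ) : ℂ)*conj ((c:ℂ) - q) := by
    rw [Complex.normSq_eq_conj_mul_self]
    push_cast
    linear_combination (conj ((c:ℂ) - q))*h
  have h5 := congrArg Complex.im h4
  rw [Complex.im_ofReal_mul, Complex.im_ofReal_mul, Complex.conj_im, dir_re_im.2] at h5
  have := mul_pos hv hg
  have := mul_pos hD hq
  linarith

lemma segRoot_one (hq : 0 < q.im) (hqc : q.re < c) :
    segRoot c q 1 = (sdist c (q.re, q.im) : ℂ) := by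
  have h1 := segRoot_sq' (c := c) hq zero_le_one
  have h2 : segPt c q 1 = c := by unfold segPt; simp
  have h3 : (sdist c (q.re, q.im) : ℂ)^2 = ((c:ℂ) - q.re)^2 + q.im^2 := by
    exact_mod_cast sdist_sq c (q.re, q.im)
  rw [h2, ← h3] at h1
  rcases sq_eq_sq_iff_eq_or_eq_neg.1 h1 with h | h
  · exact h
  · exfalso
    have hg := cpow_half_im_pos (add_segShift_im_pos hq hqc 1)
    unfold segRoot at h
    rw [Real.sqrt_one, Complex.ofReal_one, one_mul] at h
    rw [Complex.ofReal_one] at hg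
    exact dir_mul_ne_neg hq (sdist_pos c (p := (q.re, q.im)) hq) hg h

end Segment

/-- Affine coordinate along the segment. -/
def segCoord (c : ℝ) (q z : ℂ) : ℂ := (z - q)/((c:ℂ) - q)

/-- Explicit branch of the square root on the half plane to the left of the segment. -/
def leftRoot (c : ℝ) (q z : ℂ) : ℂ :=
  ((c:ℂ) - q)*(segCoord c q z^((1:ℂ)/2)*(segCoord c q z + segShift c q)^((1:ℂ)/2))

section Boundary

variable {α δ μ c : ℝ} {q : ℂ}

lemma leftRoot_sq (hq : 0 < q.im) (z : ℂ) : leftRoot c q z^2 = (z - q)*(z - conj q) := by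
  unfold leftRoot
  rw [mul_pow, mul_pow, cpow_half_sq, cpow_half_sq]
  have h2 := dir_mul_segShift (c := c) hq
  have h3 := sub_conj_eq (q := q)
  have h4 : ((c:ℂ) - q)*segCoord c q z = z - q := by
    have := dir_ne_zero (c := c) hq
    unfold segCoord; field_simp
  linear_combination (((c:ℂ) - q)*segCoord c q z + ((c:ℂ) - q)*segShift c q + (z - q))*h4 + (z - q)*(h2 - h3)

lemma continuous_segCoord : Continuous (segCoord c q) := by unfold segCoord; fun_prop

lemma leftRoot_continuousOn (hq : 0 < q.im) (hqc : q.re < c) :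
    ContinuousOn (leftRoot c q) {z | 0 < (segCoord c q z).im} := by
  intro z hz
  refine ContinuousAt.continuousWithinAt ?_
  have hz' : 0 < (segCoord c q z).im := hz
  have h1 := segShift_im_pos hq hqc
  unfold leftRoot
  refine continuousAt_const.mul (ContinuousAt.mul ?_ ?_)
  · exact continuous_segCoord.continuousAt.cpow continuousAt_const
      (Complex.mem_slitPlane_iff.2 (Or.inr hz'.ne'))
  · refine (continuous_segCoord.continuousAt.add continuousAt_const).cpow continuousAt_const
      (Complex.mem_slitPlane_iff.2 (Or.inr ?_))
    show (segCoord c q z + segShift c q).im ≠ 0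
    rw [Complex.add_im]
    exact (by linarith : 0 < (segCoord c q z).im + (segShift c q).im).ne'

lemma isPreconnected_left : IsPreconnected {z : ℂ | 0 < (segCoord c q z).im} := by
  refine Convex.isPreconnected ?_
  have : Convex ℝ {w : ℂ | 0 < w.im} := convex_halfSpace_im_gt 0
  intro x hx y hy s t hs ht hst
  have h := this hx hy hs ht hst
  have e : segCoord c q (s • x + t • y) = s • segCoord c q x + t • segCoord c q y := by
    have hst' : (s:ℂ) + t = 1 := by exact_mod_cast hst
    unfold segCoord
    simp only [Complex.real_smul]
    linear_combination (q/((c:ℂ) - q))*hst'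
  show 0 < (segCoord c q (s • x + t • y)).im
  rw [e]; exact h

lemma left_subset (hq : 0 < q.im) (hqc : q.re < zP α δ μ) :
    {z : ℂ | 0 < (segCoord (zP α δ μ) q z).im} ⊆
      (segB α δ μ q '' Set.Icc 0 1 ∪ segB α δ μ (conj q) '' Set.Icc 0 1)ᶜ := by
  have hv := dir_ne_zero (c := zP α δ μ) hq
  rintro z hz (⟨t, ht, rfl⟩ | ⟨t, ht, rfl⟩)
  · have : segCoord (zP α δ μ) q (segB α δ μ q t) = (t:ℂ) := by
      unfold segCoord segB; field_simp; ring
    simp [this] at hz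
  · have : segCoord (zP α δ μ) q (segB α δ μ (conj q) t)
        = 1 - ((1 - t : ℝ) : ℂ)*(1 + segShift (zP α δ μ) q) := by
      have h2 := dir_mul_segShift (c := zP α δ μ) hq
      have h3 := sub_conj_eq (q := q)
      unfold segCoord segB
      rw [div_eq_iff hv]
      push_cast
      linear_combination (1-t)*(h2 - h3)
    have h1 := segShift_im_pos hq hqc
    have h2 : 0 ≤ (1 - t)*(segShift (zP α δ μ) q).im := mul_nonneg (by linarith [ht.2]) h1.le
    simp only [Set.mem_ofPred_eq, this, Complex.sub_im, Complex.im_ofReal_mul, Complex.add_im,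
      Complex.one_im, zero_add] at hz
    linarith

lemma SSpec_eq_leftRoot {S Sp : ℂ → ℂ} (h : SSpec α δ μ q S Sp) (hq : 0 < q.im)
    (hqc : q.re < zP α δ μ) : EqOn S (leftRoot (zP α δ μ) q) {z | 0 < (segCoord (zP α δ μ) q z).im} := by
  obtain ⟨hd, hsq, hpos, -⟩ := h
  have hsub := left_subset hq hqc
  have hv := dir_ne_zero (c := zP α δ μ) hq
  have hco : segCoord (zP α δ μ) q ((zP α δ μ + 1 : ℝ) : ℂ) = 1 + 1/((zP α δ μ : ℂ) - q) := by
    unfold segCoord; field_simp; push_cast; ring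
  have hone : 0 < (1/((zP α δ μ : ℂ) - q)).im := by
    rw [one_div, Complex.inv_im, dir_re_im.2, neg_neg]
    exact div_pos hq (normSq_dir_pos hq)
  have hmem : 0 < (segCoord (zP α δ μ) q ((zP α δ μ + 1 : ℝ) : ℂ)).im := by
    rw [hco]; simpa using hone
  refine isPreconnected_left.eq_of_sq_eq (hd.continuousOn.mono hsub) (leftRoot_continuousOn hq hqc)
    (fun z hz => ?_) (fun {z} hz h0 => ?_) hmem ?_
  · simp only [Pi.pow_apply]
    rw [hsq z (hsub hz), leftRoot_sq hq]
  · have hz' : 0 < (segCoord (zP α δ μ) q z).im := hz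
    have hm2 : 0 < (segCoord (zP α δ μ) q z + segShift (zP α δ μ) q).im := by
      rw [Complex.add_im]; exact add_pos hz' (segShift_im_pos hq hqc)
    exact mul_ne_zero hv (mul_ne_zero (ne_zero_of_im_ne_zero (cpow_half_im_pos hz').ne')
      (ne_zero_of_im_ne_zero (cpow_half_im_pos hm2).ne')) h0
  · have hs := hsq _ (hsub hmem)
    rw [← leftRoot_sq (c := zP α δ μ) hq] at hs
    rcases sq_eq_sq_iff_eq_or_eq_neg.1 hs with h | h
    · exact h
    · exfalso
      rw [hpos _ (by linarith)] at h
      have hD : 0 < √((zP α δ μ + 1 - q.re)^2 + q.im^2) := Real.sqrt_pos.2 (by positivity)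
      have h' : leftRoot (zP α δ μ) q ((zP α δ μ + 1 : ℝ) : ℂ) =
        -(√((zP α δ μ + 1 - q.re)^2 + q.im^2) : ℂ) := by rw [h]; ring
      refine dir_mul_ne_neg hq hD ?_ h'
      have hm2 : 0 < (segCoord (zP α δ μ) q ((zP α δ μ + 1 : ℝ) : ℂ) + segShift (zP α δ μ) q).im := by
        rw [Complex.add_im]; exact add_pos hmem (segShift_im_pos hq hqc)
      rw [Complex.mul_im]
      have a1 := cpow_half_im_pos hmem
      have a2 := cpow_half_im_pos hm2
      have a3 := cpow_half_re_pos (Complex.mem_slitPlane_iff.2 (Or.inr hmem.ne'))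
      have a4 := cpow_half_re_pos (Complex.mem_slitPlane_iff.2 (Or.inr hm2.ne'))
      positivity

lemma boundary_eq_segRoot {S Sp : ℂ → ℂ} (h : SSpec α δ μ q S Sp) (hq : 0 < q.im)
    (hqc : q.re < zP α δ μ) {u : ℝ} (hu : 0 < u) (hu1 : u < 1) :
    Sp (segB α δ μ q u) = segRoot (zP α δ μ) q u := by
  have hE := SSpec_eq_leftRoot h hq hqc
  have hv := dir_ne_zero (c := zP α δ μ) hq
  refine tendsto_nhds_unique (h.2.2.2 u hu hu1) ?_
  have hco : ∀ d : ℝ, segCoord (zP α δ μ) q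
      (segB α δ μ q u + (d:ℂ) * Complex.I * ((zP α δ μ : ℂ) - q)) = (u:ℂ) + (d:ℂ)*Complex.I := by
    intro d; unfold segCoord segB; field_simp; ring
  have hlim : Tendsto (fun d : ℝ => ((zP α δ μ : ℂ) - q)*(((u:ℂ) + (d:ℂ)*Complex.I)^((1:ℂ)/2)
      *(((u:ℂ) + (d:ℂ)*Complex.I) + segShift (zP α δ μ) q)^((1:ℂ)/2))) (𝓝[>] 0)
      (𝓝 (segRoot (zP α δ μ) q u)) := by
    have hcont : ContinuousAt (fun d : ℝ => ((zP α δ μ : ℂ) - q)*(((u:ℂ) + (d:ℂ)*Complex.I)^((1:ℂ)/2)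
      *(((u:ℂ) + (d:ℂ)*Complex.I) + segShift (zP α δ μ) q)^((1:ℂ)/2))) 0 := by
      refine continuousAt_const.mul (ContinuousAt.mul ?_ ?_)
      · refine ContinuousAt.cpow (by fun_prop) continuousAt_const ?_
        exact Complex.mem_slitPlane_iff.2 (Or.inl (by simpa using hu))
      · refine ContinuousAt.cpow (by fun_prop) continuousAt_const ?_
        simpa using add_segShift_mem hq hqc u
    have := hcont.tendsto
    have e : (u:ℂ)^((1:ℂ)/2) = ((√u : ℝ) : ℂ) := by
      rw [Real.sqrt_eq_rpow, Complex.ofReal_cpow hu.le]; push_cast; rfl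
    simp only [Complex.ofReal_zero, zero_mul, add_zero, e] at this
    exact this.mono_left nhdsWithin_le_nhds
  refine hlim.congr' ?_
  filter_upwards [self_mem_nhdsWithin] with d hd
  have hd' : 0 < d := hd
  have hm : 0 < (segCoord (zP α δ μ) q
      (segB α δ μ q u + (d:ℂ) * Complex.I * ((zP α δ μ : ℂ) - q))).im := by
    rw [hco]; simpa using hd'
  rw [hE hm]
  unfold leftRoot
  rw [hco]

end Boundary

/-- The uniformizing coordinate of the spectral curve along the segment. -/
def segZeta (c : ℝ) (q : ℂ) (u : ℝ) : ℂ := segPt c q u - q.re + segRoot c q u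

/-- The differential `dz/S` along the segment. -/
def segDen (c : ℝ) (q : ℂ) (u : ℝ) : ℂ := ((c:ℂ) - q)/segRoot c q u

section Kernels

variable {c : ℝ} {q : ℂ}

lemma segDen_eq (hq : 0 < q.im) (u : ℝ) :
    segDen c q u = ((u^(-(1/2) : ℝ) : ℝ) : ℂ)*(((u:ℂ) + segShift c q)^((1:ℂ)/2))⁻¹ ∨ u < 0 := by
  rcases lt_or_ge u 0 with h | h
  · exact Or.inr h
  left
  have hv := dir_ne_zero (c := c) hq
  unfold segDen segRoot
  rw [Real.rpow_neg h, ← Real.sqrt_eq_rpow, div_eq_mul_inv, mul_inv, mul_inv, ← mul_assoc,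
    mul_inv_cancel₀ hv, one_mul]
  push_cast; rfl

lemma intervalIntegrable_mul_segDen (hq : 0 < q.im) (hqc : q.re < c) {g : ℝ → ℂ}
    (hg : ContinuousOn g (Set.Icc 0 1)) :
    IntervalIntegrable (fun u => g u*segDen c q u) volume 0 1 := by
  have h1 : IntervalIntegrable (fun u : ℝ => ((u^(-(1/2) : ℝ) : ℝ) : ℂ)) volume 0 1 :=
    have h := intervalIntegral.intervalIntegrable_rpow' (a := 0) (b := 1)
      (by norm_num : (-1:ℝ) < -(1/2))
    ⟨h.1.ofReal, h.2.ofReal⟩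
  have h2 : ContinuousOn (fun u : ℝ => (((u:ℂ) + segShift c q)^((1:ℂ)/2))⁻¹*g u)
      (Set.uIcc 0 1) := by
    rw [Set.uIcc_of_le zero_le_one]
    refine ContinuousOn.mul (Continuous.continuousOn ?_) hg
    refine Continuous.inv₀ (Continuous.cpow (by fun_prop) continuous_const (add_segShift_mem hq hqc))
      fun u => ?_
    exact ne_zero_of_im_ne_zero (cpow_half_im_pos (add_segShift_im_pos hq hqc u)).ne'
  refine (h1.mul_continuousOn h2).congr fun u hu => ?_
  rw [Set.uIoc_of_le zero_le_one] at hu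
  rcases segDen_eq (c := c) hq u with h | h
  · simp only [h]; ring
  · exact absurd hu.1 (by linarith)

lemma segZeta_mul (hq : 0 < q.im) {u : ℝ} (hu : 0 ≤ u) :
    segZeta c q u*(segPt c q u - q.re - segRoot c q u) = -(q.im:ℂ)^2 := by
  unfold segZeta
  linear_combination -segRoot_sq' (c := c) hq hu

lemma segZeta_sq (hq : 0 < q.im) {u : ℝ} (hu : 0 ≤ u) :
    segZeta c q u^2 - (q.im:ℂ)^2 = 2*(segPt c q u - q.re)*segZeta c q u := by
  unfold segZeta
  linear_combination segRoot_sq' (c := c) hq hu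

lemma segZeta_ne_zero (hq : 0 < q.im) {u : ℝ} (hu : 0 ≤ u) : segZeta c q u ≠ 0 := by
  intro h
  have h1 := segZeta_mul (c := c) hq hu
  rw [h, zero_mul] at h1
  have : (q.im:ℂ) ≠ 0 := by exact_mod_cast hq.ne'
  exact this (pow_eq_zero_iff (two_ne_zero)|>.1 (neg_eq_zero.1 h1.symm))

lemma segZeta_im_pos (hq : 0 < q.im) {u : ℝ} (hu : 0 ≤ u) (hu1 : u < 1) :
    0 < (segZeta c q u).im := by
  have h0 := segZeta_ne_zero (c := c) hq hu
  have hN : 0 < Complex.normSq (segZeta c q u) := Complex.normSq_pos.2 h0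
  have h1 : segZeta c q u - (q.im:ℂ)^2/segZeta c q u = 2*(segPt c q u - q.re) := by
    field_simp
    linear_combination segZeta_sq (c := c) hq hu
  have h2 := congrArg Complex.im h1
  have h3 : (2*(segPt c q u - (q.re:ℂ))).im = 2*((1 - u)*q.im) := by
    simp [segPt_im]
  have h4 : ((q.im:ℂ)^2/segZeta c q u).im = -(q.im^2*(segZeta c q u).im/Complex.normSq (segZeta c q u)) := by
    rw [← Complex.ofReal_pow, Complex.div_im, Complex.ofReal_im, Complex.ofReal_re]; ring
  rw [Complex.sub_im, h3, h4] at h2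
  have h5 : (segZeta c q u).im*(1 + q.im^2/Complex.normSq (segZeta c q u)) = 2*((1 - u)*q.im) := by
    rw [← h2]; ring
  have h6 : 0 < 2*((1 - u)*q.im) := by have : 0 < 1 - u := by linarith
                                       positivity
  have h7 : 0 < 1 + q.im^2/Complex.normSq (segZeta c q u) := by positivity
  rw [← h5] at h6
  exact (mul_pos_iff_of_pos_right h7).1 h6

lemma segPt_zero : segPt c q 0 = q := by unfold segPt; simp
lemma segPt_one : segPt c q 1 = c := by unfold segPt; simp
lemma segRoot_zero : segRoot c q 0 = 0 := by unfold segRoot; simp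

lemma segZeta_zero : segZeta c q 0 = q.im*Complex.I := by
  unfold segZeta
  rw [segPt_zero, segRoot_zero]
  linear_combination -Complex.re_add_im q

lemma segZeta_one (hq : 0 < q.im) (hqc : q.re < c) :
    segZeta c q 1 = ((c - q.re + sdist c (q.re, q.im) : ℝ) : ℂ) := by
  unfold segZeta
  rw [segPt_one, segRoot_one hq hqc]; push_cast; ring

lemma continuous_segZeta (hq : 0 < q.im) (hqc : q.re < c) : Continuous (segZeta c q) := by
  unfold segZeta
  exact (continuous_segPt.sub continuous_const).add (continuous_segRoot hq hqc)

lemma hasDerivAt_segZeta (hq : 0 < q.im) (hqc : q.re < c) {u : ℝ} (hu : 0 < u) :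
    HasDerivAt (segZeta c q) (segZeta c q u*segDen c q u) u := by
  refine HasDerivAt.congr_deriv (f := segZeta c q)
    (((hasDerivAt_segPt u).sub_const _).add (hasDerivAt_segRoot hq hqc hu)) ?_
  have := segRoot_ne_zero hq hqc hu
  unfold segDen segZeta
  field_simp; ring

lemma integral_segDen (hq : 0 < q.im) (hqc : q.re < c) :
    ∫ u in (0:ℝ)..1, segDen c q u
      = (Real.arsinh ((c - q.re)/q.im) : ℂ) - (π/2 : ℝ)*Complex.I := by
  have hs := sdist_pos c (p := (q.re, q.im)) hq
  have hone : 0 < c - q.re + sdist c (q.re, q.im) := by linarith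
  have hmem : ∀ u ∈ Set.Icc (0:ℝ) 1, segZeta c q u ∈ Complex.slitPlane := by
    intro u hu
    rcases hu.2.eq_or_lt with h | h
    · rw [h, segZeta_one hq hqc]; exact Complex.ofReal_mem_slitPlane.2 hone
    · exact Complex.mem_slitPlane_iff.2 (Or.inr (segZeta_im_pos hq hu.1 h).ne')
  have hF := intervalIntegral.integral_eq_sub_of_hasDerivAt_of_le (a := 0) (b := 1)
    (f := fun u => Complex.log (segZeta c q u)) (f' := segDen c q) zero_le_one
    ((continuous_segZeta hq hqc).continuousOn.clog hmem)
    (fun u hu => ((hasDerivAt_segZeta hq hqc hu.1).clog_real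
      (hmem u ⟨hu.1.le, hu.2.le⟩)).congr_deriv (by
        have := segZeta_ne_zero (c := c) hq hu.1.le
        field_simp))
    (by simpa using intervalIntegrable_mul_segDen hq hqc (g := fun _ => 1) continuousOn_const)
  rw [hF]
  rw [segZeta_one hq hqc, segZeta_zero, Complex.log_ofReal_mul hq (Complex.I_ne_zero),
    Complex.log_I, ← Complex.ofReal_log hone.le]
  have h := arsinh_div_eq_log c (p := (q.re, q.im)) hq
  simp only at h
  rw [h, Real.log_div hone.ne' hq.ne']
  push_cast; ring

lemma integral_sub_mul_segDen (hq : 0 < q.im) (hqc : q.re < c) :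
    ∫ u in (0:ℝ)..1, (segPt c q u - q.re)*segDen c q u = (sdist c (q.re, q.im) : ℂ) := by
  have hF := intervalIntegral.integral_eq_sub_of_hasDerivAt_of_le (a := 0) (b := 1)
    (f := segRoot c q) (f' := fun u => (segPt c q u - q.re)*segDen c q u) zero_le_one
    (continuous_segRoot hq hqc).continuousOn
    (fun u hu => (hasDerivAt_segRoot hq hqc hu.1).congr_deriv (by unfold segDen; ring))
    (intervalIntegrable_mul_segDen hq hqc (continuous_segPt.sub continuous_const).continuousOn)
  rw [hF, segRoot_one hq hqc, segRoot_zero, sub_zero]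

lemma integral_segPt_mul_segDen (hq : 0 < q.im) (hqc : q.re < c) :
    ∫ u in (0:ℝ)..1, segPt c q u*segDen c q u = (sdist c (q.re, q.im) : ℂ)
      + q.re*((Real.arsinh ((c - q.re)/q.im) : ℂ) - (π/2 : ℝ)*Complex.I) := by
  rw [← integral_sub_mul_segDen hq hqc, ← integral_segDen hq hqc,
    ← intervalIntegral.integral_const_mul, ← intervalIntegral.integral_add]
  · refine intervalIntegral.integral_congr fun u _ => ?_
    ring
  · exact intervalIntegrable_mul_segDen hq hqc (continuous_segPt.sub continuous_const).continuousOn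
  · exact intervalIntegrable_mul_segDen hq hqc continuousOn_const

lemma segPt_sub_ne_zero (hq : 0 < q.im) {σ : ℝ} (hσ : σ < c) {u : ℝ} (hu1 : u ≤ 1) :
    segPt c q u - (σ:ℂ) ≠ 0 := by
  rcases hu1.eq_or_lt with h | h
  · rw [h, segPt_one]
    have : (c:ℂ) - σ = ((c - σ : ℝ) : ℂ) := by push_cast; rfl
    rw [this]; exact_mod_cast (sub_pos.2 hσ).ne'
  · refine sub_ofReal_ne_zero ?_ σ
    rw [segPt_im]; exact mul_pos (by linarith) hq

lemma arg_sub_arg_eq {b r s : ℝ} (hb : 0 < b) (hr : 0 < r) (hs : 0 < s) (hrs : r*s = b^2) :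
    Complex.arg (b*Complex.I - r) - Complex.arg (b*Complex.I + s) = π/2 := by
  have h1 : (b*Complex.I - r : ℂ) = ((r/b : ℝ) : ℂ)*(Complex.I*(b*Complex.I + s)) := by
    have hb' : (b:ℂ) ≠ 0 := by exact_mod_cast hb.ne'
    have : (r:ℂ)*s = b^2 := by exact_mod_cast hrs
    push_cast
    field_simp
    linear_combination -Complex.I*this - r*b*Complex.I_sq
  have hne : (b*Complex.I + s : ℂ) ≠ 0 := ne_zero_of_im_ne_zero (by simpa using hb.ne')
  have h2 : |Complex.arg (b*Complex.I + s)| < π/2 := by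
    refine Complex.abs_arg_lt_pi_div_two_iff.2 (Or.inl ?_)
    simpa using hs
  rw [abs_lt] at h2
  rw [h1, Complex.arg_real_mul _ (by positivity), Complex.arg_mul Complex.I_ne_zero hne, Complex.arg_I]
  · ring
  · rw [Complex.arg_I]; exact ⟨by linarith, by linarith⟩

lemma integral_kernel_im (hq : 0 < q.im) (hqc : q.re < c) {σ : ℝ} (hσ : σ < c) :
    (∫ u in (0:ℝ)..1, (1/(segPt c q u - (σ:ℂ)))*segDen c q u).im
      = -(π/2)/sdist σ (q.re, q.im) := by
  have hs := sdist_pos σ (p := (q.re, q.im)) hq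
  have hsc := sdist_pos c (p := (q.re, q.im)) hq
  have hab := abs_lt.1 (abs_sub_lt_sdist σ (p := (q.re, q.im)) hq)
  have hsq := sdist_sq σ (q.re, q.im)
  simp only at hab hsq
  set D := sdist σ (q.re, q.im) with hD
  have hsq' : (D:ℂ)^2 = (σ - q.re)^2 + q.im^2 := by exact_mod_cast hsq
  set ζ₁ : ℝ := σ - q.re + D with h1
  set ζ₂ : ℝ := D - (σ - q.re) with h2
  have hζ₁ : 0 < ζ₁ := by linarith
  have hζ₂ : 0 < ζ₂ := by linarith
  have hprod : ∀ u : ℝ, 0 ≤ u → (segZeta c q u - ζ₁)*(segZeta c q u + ζ₂)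
      = 2*segZeta c q u*(segPt c q u - σ) := by
    intro u hu
    rw [h1, h2]; push_cast
    linear_combination segZeta_sq (c := c) hq hu - hsq'
  have hone : 0 < c - q.re + sdist c (q.re, q.im) := by linarith
  have hz1 := segZeta_one hq hqc
  have hgt : 0 < c - q.re + sdist c (q.re, q.im) - ζ₁ := by
    have h := hprod 1 zero_le_one
    rw [hz1, segPt_one] at h
    have h' : (c - q.re + sdist c (q.re, q.im) - ζ₁)*(c - q.re + sdist c (q.re, q.im) + ζ₂)
      = 2*(c - q.re + sdist c (q.re, q.im))*(c - σ) := by exact_mod_cast h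
    have h3 : 0 < 2*(c - q.re + sdist c (q.re, q.im))*(c - σ) :=
      mul_pos (by linarith) (sub_pos.2 hσ)
    rw [← h'] at h3
    exact (mul_pos_iff_of_pos_right (by linarith)).1 h3
  have hmem1 : ∀ u ∈ Set.Icc (0:ℝ) 1, segZeta c q u - (ζ₁:ℂ) ∈ Complex.slitPlane := by
    intro u hu
    rcases hu.2.eq_or_lt with h | h
    · rw [h, hz1, ← Complex.ofReal_sub]; exact Complex.ofReal_mem_slitPlane.2 hgt
    · refine Complex.mem_slitPlane_iff.2 (Or.inr ?_)
      simpa using (segZeta_im_pos hq hu.1 h).ne'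
  have hmem2 : ∀ u ∈ Set.Icc (0:ℝ) 1, segZeta c q u + (ζ₂:ℂ) ∈ Complex.slitPlane := by
    intro u hu
    rcases hu.2.eq_or_lt with h | h
    · rw [h, hz1, ← Complex.ofReal_add]; exact Complex.ofReal_mem_slitPlane.2 (by linarith)
    · refine Complex.mem_slitPlane_iff.2 (Or.inr ?_)
      simpa using (segZeta_im_pos hq hu.1 h).ne'
  have hDne : (D:ℂ) ≠ 0 := by exact_mod_cast hs.ne'
  have hF := intervalIntegral.integral_eq_sub_of_hasDerivAt_of_le (a := 0) (b := 1)
    (f := fun u => (Complex.log (segZeta c q u - ζ₁) - Complex.log (segZeta c q u + ζ₂))/D)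
    (f' := fun u => (1/(segPt c q u - (σ:ℂ)))*segDen c q u) zero_le_one
    (((((continuous_segZeta hq hqc).sub continuous_const).continuousOn.clog hmem1).sub
      (((continuous_segZeta hq hqc).add continuous_const).continuousOn.clog hmem2)).div_const _)
    (fun u hu => by
      have hu' : u ∈ Set.Icc (0:ℝ) 1 := ⟨hu.1.le, hu.2.le⟩
      have hd := hasDerivAt_segZeta hq hqc hu.1
      refine ((((hd.sub_const (ζ₁:ℂ)).clog_real (hmem1 u hu')).sub
        ((hd.add_const (ζ₂:ℂ)).clog_real (hmem2 u hu'))).div_const (D:ℂ)).congr_deriv ?_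
      have e1 := Complex.slitPlane_ne_zero (hmem1 u hu')
      have e2 := Complex.slitPlane_ne_zero (hmem2 u hu')
      have e3 := segPt_sub_ne_zero hq hσ hu.2.le
      have e4 := hprod u hu.1.le
      have e5 : (ζ₁:ℂ) + ζ₂ = 2*D := by rw [h1, h2]; push_cast; ring
      generalize segZeta c q u = Z at *
      generalize segPt c q u - (σ:ℂ) = Y at *
      generalize segDen c q u = V at *
      rw [div_sub_div _ _ e1 e2, div_div, one_div, eq_comm, inv_mul_eq_div,
        div_eq_div_iff e3 (mul_ne_zero (mul_ne_zero e1 e2) hDne)]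
      linear_combination V*D*e4 - V*Z*Y*e5)
    (intervalIntegrable_mul_segDen hq hqc (ContinuousOn.div continuousOn_const
      (continuous_segPt.sub continuous_const).continuousOn
      fun u hu => segPt_sub_ne_zero hq hσ hu.2))
  rw [hF]
  have hr : ζ₁*ζ₂ = q.im^2 := by rw [h1, h2]; linarith [hsq]
  have harg := arg_sub_arg_eq hq hζ₁ hζ₂ hr
  rw [hz1, segZeta_zero, ← Complex.ofReal_sub, ← Complex.ofReal_add, ← Complex.ofReal_log hgt.le,
    ← Complex.ofReal_log (by linarith)]
  simp only [Complex.sub_im, Complex.div_ofReal_im, Complex.ofReal_im, Complex.log_im]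
  rw [← harg]; ring

lemma integral_segPt_kernel_im (hq : 0 < q.im) (hqc : q.re < c) {σ : ℝ} (hσ : σ < c) :
    (∫ u in (0:ℝ)..1, (1/(segPt c q u - (σ:ℂ)))*(segPt c q u)*segDen c q u).im
      = -(π/2)*(1 + σ/sdist σ (q.re, q.im)) := by
  have hc : ContinuousOn (fun u => 1/(segPt c q u - (σ:ℂ))) (Set.Icc 0 1) :=
    ContinuousOn.div continuousOn_const
      (continuous_segPt.sub continuous_const).continuousOn fun u hu => segPt_sub_ne_zero hq hσ hu.2
  have h : ∫ u in (0:ℝ)..1, (1/(segPt c q u - (σ:ℂ)))*(segPt c q u)*segDen c q u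
      = (∫ u in (0:ℝ)..1, segDen c q u)
        + σ*∫ u in (0:ℝ)..1, (1/(segPt c q u - (σ:ℂ)))*segDen c q u := by
    rw [← intervalIntegral.integral_const_mul, ← intervalIntegral.integral_add]
    · refine intervalIntegral.integral_congr fun u hu => ?_
      rw [Set.uIcc_of_le zero_le_one] at hu
      have := segPt_sub_ne_zero hq hσ hu.2
      field_simp; ring
    · simpa using intervalIntegrable_mul_segDen hq hqc (g := fun _ => 1) continuousOn_const
    · exact (intervalIntegrable_mul_segDen hq hqc hc).const_mul _
  rw [h, Complex.add_im, Complex.im_ofReal_mul, integral_kernel_im hq hqc hσ, integral_segDen hq hqc]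
  simp only [Complex.sub_im, Complex.ofReal_im, Complex.mul_I_im, Complex.ofReal_re]
  ring

end Kernels

section Fubini

variable {c : ℝ} {q : ℂ}

lemma measurable_segDen (hq : 0 < q.im) (hqc : q.re < c) : Measurable (segDen c q) := by
  unfold segDen
  exact measurable_const.div (continuous_segRoot hq hqc).measurable

lemma integrable_beta_mul (hq : 0 < q.im) (hqc : q.re < c) {g : ℝ → ℂ} (hg : Continuous g) :
    Integrable (fun u => (u^(-(1/2) : ℝ)*(1 - u)^(-(1/2) : ℝ))
      *‖g u*(((u:ℂ) + segShift c q)^((1:ℂ)/2))⁻¹‖) (volume.restrict (Set.Ioo 0 1)) := by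
  have h1 := Complex.betaIntegral_convergent (u := (1:ℂ)/2) (v := (1:ℂ)/2)
    (by norm_num) (by norm_num)
  have h2 : Continuous (fun u : ℝ => g u*(((u:ℂ) + segShift c q)^((1:ℂ)/2))⁻¹) := by
    refine hg.mul (Continuous.inv₀
      (Continuous.cpow (by fun_prop) continuous_const (add_segShift_mem hq hqc)) fun u => ?_)
    exact ne_zero_of_im_ne_zero (cpow_half_im_pos (add_segShift_im_pos hq hqc u)).ne'
  have h3 := ((h1.mul_continuousOn h2.continuousOn).1.mono_set Set.Ioo_subset_Ioc_self).norm
  refine h3.congr ?_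
  filter_upwards [ae_restrict_mem measurableSet_Ioo] with u hu
  rw [norm_mul, norm_mul]
  congr 1
  have h4 : (1 - (u:ℂ)) = ((1 - u : ℝ) : ℂ) := by push_cast; rfl
  rw [h4, Complex.norm_cpow_eq_rpow_re_of_pos hu.1,
    Complex.norm_cpow_eq_rpow_re_of_pos (by linarith [hu.2])]
  norm_num

/-- Fubini for Cauchy-type integrals against `g dz/S` along the segment. -/
lemma integral_cauchy_swap (hq : 0 < q.im) (hqc : q.re < c) {K : Set ℝ} (hK : MeasurableSet K)
    {s W : ℝ → ℝ} (hs : Continuous s) (hW : IntegrableOn W K)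
    (hb : ∀ k ∈ K, ∀ u ∈ Set.Ioo (0:ℝ) 1,
      ‖1/(segPt c q u - (s k : ℂ))‖ ≤ (1 - u)^(-(1/2) : ℝ)*W k)
    {g : ℝ → ℂ} (hg : Continuous g) :
    IntervalIntegrable (fun u => (∫ k in K, 1/(segPt c q u - (s k : ℂ)))*g u*segDen c q u)
      volume 0 1 ∧
    (∫ u in (0:ℝ)..1, (∫ k in K, 1/(segPt c q u - (s k : ℂ)))*g u*segDen c q u).im
      = ∫ k in K, (∫ u in (0:ℝ)..1, 1/(segPt c q u - (s k : ℂ))*g u*segDen c q u).im := by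
  set F : ℝ → ℝ → ℂ := fun u k => 1/(segPt c q u - (s k : ℂ))*g u*segDen c q u with hF
  have hmeas : Measurable (Function.uncurry F) := by
    have e1 : Measurable (segPt c q) := continuous_segPt.measurable
    have e2 := measurable_segDen hq hqc
    have e3 := hg.measurable
    have e4 := hs.measurable
    simp only [hF, Function.uncurry_def]
    fun_prop
  have hInt : Integrable (Function.uncurry F)
      ((volume.restrict (Set.Ioo (0:ℝ) 1)).prod (volume.restrict K)) := by
    refine ((integrable_beta_mul hq hqc hg).mul_prod hW).mono' hmeas.aestronglyMeasurable ?_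
    rw [Measure.prod_restrict]
    filter_upwards [ae_restrict_mem (measurableSet_Ioo.prod hK)] with p hp
    obtain ⟨hu, hk⟩ := hp
    have h1 := hb p.2 hk p.1 hu
    simp only [Function.uncurry_def, hF]
    rcases segDen_eq (c := c) hq p.1 with h | h
    · rw [h, norm_mul, norm_mul, norm_mul, norm_mul (g p.1), Complex.norm_real,
        Real.norm_of_nonneg (Real.rpow_nonneg hu.1.le _)]
      have h2 : 0 ≤ ‖g p.1‖*(p.1^(-(1/2) : ℝ)*‖(((p.1:ℂ) + segShift c q)^((1:ℂ)/2))⁻¹‖) := by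
        have := Real.rpow_nonneg hu.1.le (-(1/2))
        positivity
      nlinarith [mul_le_mul_of_nonneg_right h1 h2]
    · exact absurd hu.1 (by linarith)
  have hrest : (volume.restrict (Set.Ioc (0:ℝ) 1)) = volume.restrict (Set.Ioo (0:ℝ) 1) :=
    (Measure.restrict_congr_set Ioo_ae_eq_Ioc).symm
  have hpull : ∀ u, (∫ k in K, 1/(segPt c q u - (s k : ℂ)))*g u*segDen c q u
      = ∫ k in K, F u k := by
    intro u
    rw [hF, ← integral_mul_const, ← integral_mul_const]
  refine ⟨?_, ?_⟩
  · rw [intervalIntegrable_iff_integrableOn_Ioc_of_le zero_le_one, IntegrableOn, hrest]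
    simp only [hpull]
    exact hInt.integral_prod_left
  · simp only [hpull]
    simp only [intervalIntegral.integral_of_le zero_le_one, hrest]
    rw [integral_integral_swap hInt]
    exact (integral_im (𝕜 := ℂ) hInt.integral_prod_right).symm

end Fubini

section Bounds

variable {c : ℝ} {q : ℂ}

lemma le_norm_segPt_sub {σ u : ℝ} :
    (1 - u)*q.im ≤ ‖segPt c q u - (σ:ℂ)‖ := by
  have h := Complex.abs_im_le_norm (segPt c q u - (σ:ℂ))
  rw [Complex.sub_im, segPt_im, Complex.ofReal_im, sub_zero] at h
  exact (le_abs_self _).trans h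

lemma le_norm_segPt_sub' {σ u : ℝ} :
    (c - σ)*q.im ≤ ‖(c:ℂ) - q‖*‖segPt c q u - (σ:ℂ)‖ := by
  have e : (segPt c q u - σ)*conj ((c:ℂ) - q)
      = (c - σ)*conj ((c:ℂ) - q) - ((1 - u)*Complex.normSq ((c:ℂ) - q) : ℝ) := by
    push_cast
    rw [Complex.normSq_eq_conj_mul_self]
    unfold segPt; ring
  have h := Complex.abs_im_le_norm ((segPt c q u - σ)*conj ((c:ℂ) - q))
  rw [norm_mul, Complex.norm_conj, e, Complex.sub_im, Complex.ofReal_im, ← Complex.ofReal_sub,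
    Complex.im_ofReal_mul, Complex.conj_im, dir_re_im.2, neg_neg, sub_zero] at h
  linarith [le_abs_self ((c - σ)*q.im)]

lemma norm_cauchy_le_inv (hq : 0 < q.im) {σ u : ℝ} (hσ : σ < c) (hu : u ∈ Set.Ioo (0:ℝ) 1) :
    ‖1/(segPt c q u - (σ:ℂ))‖ ≤ (1 - u)^(-(1/2) : ℝ)*(‖(c:ℂ) - q‖/q.im*(c - σ)⁻¹) := by
  have h1 := le_norm_segPt_sub' (c := c) (q := q) (σ := σ) (u := u)
  have hy : 0 < c - σ := sub_pos.2 hσ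
  have hn : 0 < ‖segPt c q u - (σ:ℂ)‖ := norm_pos_iff.2 (segPt_sub_ne_zero hq hσ hu.2.le)
  have h2 : 1 ≤ (1 - u)^(-(1/2) : ℝ) :=
    Real.one_le_rpow_of_pos_of_le_one_of_nonpos (by linarith [hu.2]) (by linarith [hu.1]) (by norm_num)
  have h3 : ‖1/(segPt c q u - (σ:ℂ))‖ ≤ ‖(c:ℂ) - q‖/q.im*(c - σ)⁻¹ := by
    rw [norm_div, norm_one, div_mul_eq_mul_div, ← div_eq_mul_inv, div_div, div_le_div_iff₀ hn (by positivity)]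
    linarith
  have h4 : 0 ≤ ‖(c:ℂ) - q‖/q.im*(c - σ)⁻¹ := by positivity
  nlinarith

lemma norm_cauchy_le_sqrt (hq : 0 < q.im) {σ u : ℝ} (hσ : σ < c) (hu : u ∈ Set.Ioo (0:ℝ) 1) :
    ‖1/(segPt c q u - (σ:ℂ))‖
      ≤ (1 - u)^(-(1/2) : ℝ)*(√‖(c:ℂ) - q‖/q.im*(c - σ)^(-(1/2) : ℝ)) := by
  have h1 := le_norm_segPt_sub' (c := c) (q := q) (σ := σ) (u := u)
  have h2 := le_norm_segPt_sub (c := c) (q := q) (σ := σ) (u := u)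
  have hy : 0 < c - σ := sub_pos.2 hσ
  have hu' : 0 < 1 - u := by linarith [hu.2]
  have hn : 0 < ‖segPt c q u - (σ:ℂ)‖ := norm_pos_iff.2 (segPt_sub_ne_zero hq hσ hu.2.le)
  have h3 : √(1 - u)*√(c - σ)*q.im ≤ √‖(c:ℂ) - q‖*‖segPt c q u - (σ:ℂ)‖ := by
    refine abs_le_of_sq_le_sq' ?_ (by positivity) |>.2
    rw [mul_pow, mul_pow, mul_pow, Real.sq_sqrt hu'.le, Real.sq_sqrt hy.le,
      Real.sq_sqrt (norm_nonneg _)]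
    nlinarith [mul_le_mul h1 h2 (by positivity) (by positivity)]
  rw [Real.rpow_neg hu'.le, Real.rpow_neg hy.le, ← Real.sqrt_eq_rpow, ← Real.sqrt_eq_rpow,
    norm_div, norm_one]
  have := Real.sqrt_pos.2 hu'
  have := Real.sqrt_pos.2 hy
  rw [show (√(1 - u))⁻¹*(√‖(c:ℂ) - q‖/q.im*(√(c - σ))⁻¹)
    = √‖(c:ℂ) - q‖/(√(1 - u)*√(c - σ)*q.im) by field_simp,
    div_le_div_iff₀ hn (by positivity)]
  linarith

end Bounds

section SpectralMoments

variable {c : ℝ} {q : ℂ}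

lemma hasDerivAt_arsinh_sdist {p : ℝ × ℝ} (hp : 0 < p.2) (σ : ℝ) :
    HasDerivAt (fun σ => Real.arsinh ((σ - p.1)/p.2)) (1/sdist σ p) σ := by
  refine HasDerivAt.congr_deriv (f := fun σ => Real.arsinh ((σ - p.1)/p.2))
    (((hasDerivAt_id' σ).sub_const p.1).div_const p.2).arsinh ?_
  have h : √(1 + ((σ - p.1)/p.2)^2) = sdist σ p/p.2 := by
    rw [Real.sqrt_eq_iff_mul_self_eq (by positivity) (div_nonneg (sdist_nonneg _ _) hp.le),
      div_mul_div_comm, ← pow_two, sdist_sq]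
    field_simp; ring
  have := sdist_pos σ hp
  rw [h]; simp only [smul_eq_mul]; field_simp

lemma hasDerivAt_sdist_left {p : ℝ × ℝ} (hp : 0 < p.2) (σ : ℝ) :
    HasDerivAt (fun σ => sdist σ p) ((σ - p.1)/sdist σ p) σ := by
  have h0 := sdist_pos σ hp
  have h1 : HasDerivAt (fun σ => (σ - p.1)^2 + p.2^2) (2*(σ - p.1)) σ :=
    ((((hasDerivAt_id' σ).sub_const p.1).fun_pow 2).add_const _).congr_deriv (by simp)
  refine HasDerivAt.congr_deriv (f := fun σ => sdist σ p)
    (h1.sqrt (by positivity)) ?_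
  rw [show √((σ - p.1)^2 + p.2^2) = sdist σ p from rfl]
  field_simp

lemma continuous_sdist_left (p : ℝ × ℝ) : Continuous fun σ => sdist σ p := by
  unfold sdist; fun_prop

lemma integral_inv_sdist {p : ℝ × ℝ} (hp : 0 < p.2) (a b : ℝ) :
    ∫ σ in a..b, 1/sdist σ p = Real.arsinh ((b - p.1)/p.2) - Real.arsinh ((a - p.1)/p.2) :=
  intervalIntegral.integral_eq_sub_of_hasDerivAt (fun σ _ => hasDerivAt_arsinh_sdist hp σ)
    ((continuous_const.div (continuous_sdist_left p)
      fun σ => (sdist_pos σ hp).ne').intervalIntegrable _ _)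

lemma integral_one_add_div_sdist {p : ℝ × ℝ} (hp : 0 < p.2) (a b : ℝ) :
    ∫ σ in a..b, (1 + σ/sdist σ p) = b - a + (sdist b p - sdist a p)
      + p.1*(Real.arsinh ((b - p.1)/p.2) - Real.arsinh ((a - p.1)/p.2)) := by
  have hne : ∀ σ, sdist σ p ≠ 0 := fun σ => (sdist_pos σ hp).ne'
  rw [intervalIntegral.integral_eq_sub_of_hasDerivAt
    (f := fun σ => σ + sdist σ p + p.1*Real.arsinh ((σ - p.1)/p.2))
    (f' := fun σ => 1 + σ/sdist σ p)
    (fun σ _ => (((hasDerivAt_id' σ).fun_add (hasDerivAt_sdist_left hp σ)).fun_add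
      ((hasDerivAt_arsinh_sdist hp σ).const_mul p.1)).congr_deriv (by
        have := hne σ; field_simp; ring))
    ((continuous_const.add (continuous_id.div (continuous_sdist_left p) hne)).intervalIntegrable _ _)]
  ring

lemma integral_cauchy_interval_swap (hq : 0 < q.im) (hqc : q.re < c) {a : ℝ} (hac : a < c)
    {g : ℝ → ℂ} (hg : Continuous g) :
    IntervalIntegrable (fun u => (∫ σ in a..c, 1/(segPt c q u - (σ : ℂ)))*g u*segDen c q u)
      volume 0 1 ∧
    (∫ u in (0:ℝ)..1, (∫ σ in a..c, 1/(segPt c q u - (σ : ℂ)))*g u*segDen c q u).im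
      = ∫ σ in Set.Ioo a c, (∫ u in (0:ℝ)..1, 1/(segPt c q u - (σ : ℂ))*g u*segDen c q u).im := by
  simp only [intervalIntegral.integral_of_le (f := fun σ : ℝ => 1/(segPt c q _ - (σ : ℂ))) hac.le,
    integral_Ioc_eq_integral_Ioo]
  refine integral_cauchy_swap hq hqc measurableSet_Ioo continuous_id
    (W := fun σ => √‖(c:ℂ) - q‖/q.im*(c - σ)^(-(1/2) : ℝ)) ?_
    (fun k hk u hu => norm_cauchy_le_sqrt hq hk.2 hu) hg
  refine Integrable.const_mul ?_ _
  have h : IntervalIntegrable (fun y : ℝ => y^(-(1/2) : ℝ)) volume (c - c) (c - a) :=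
    intervalIntegral.intervalIntegrable_rpow' (by norm_num)
  have h2 := (h.comp_sub_left c).symm
  simp only [sub_sub_cancel] at h2
  exact (intervalIntegrable_iff_integrableOn_Ioo_of_le hac.le).1 h2

lemma integral_cauchy_interval (hq : 0 < q.im) (hqc : q.re < c) {a : ℝ} (hac : a < c) :
    (∫ u in (0:ℝ)..1, (∫ σ in a..c, 1/(segPt c q u - (σ : ℂ)))*1*segDen c q u).im
      = -(π/2)*(Real.arsinh ((c - q.re)/q.im) - Real.arsinh ((a - q.re)/q.im)) := by
  rw [(integral_cauchy_interval_swap hq hqc hac (g := fun _ => 1) continuous_const).2,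
    ← integral_inv_sdist (p := (q.re, q.im)) hq, ← intervalIntegral.integral_const_mul,
    intervalIntegral.integral_of_le hac.le, integral_Ioc_eq_integral_Ioo]
  refine setIntegral_congr_fun measurableSet_Ioo fun σ hσ => ?_
  simp only [mul_one]
  rw [integral_kernel_im hq hqc hσ.2]; ring

lemma integral_cauchy_interval_mul (hq : 0 < q.im) (hqc : q.re < c) {a : ℝ} (hac : a < c) :
    (∫ u in (0:ℝ)..1, (∫ σ in a..c, 1/(segPt c q u - (σ : ℂ)))*segPt c q u*segDen c q u).im
      = -(π/2)*(c - a + (sdist c (q.re, q.im) - sdist a (q.re, q.im))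
      + q.re*(Real.arsinh ((c - q.re)/q.im) - Real.arsinh ((a - q.re)/q.im))) := by
  have h := integral_one_add_div_sdist (p := (q.re, q.im)) hq a c
  simp only at h
  rw [(integral_cauchy_interval_swap hq hqc hac continuous_segPt).2,
    ← h, ← intervalIntegral.integral_const_mul,
    intervalIntegral.integral_of_le hac.le, integral_Ioc_eq_integral_Ioo]
  refine setIntegral_congr_fun measurableSet_Ioo fun σ hσ => ?_
  exact integral_segPt_kernel_im hq hqc hσ.2

variable {μ r : ℝ} {K : Set ℝ}

lemma spt_le_spt (hr : 0 < r) {k : ℝ} (hk : r ≤ k) : spt μ k ≤ spt μ r := by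
  unfold spt; nlinarith

lemma integrableOn_inv_sub_spt (hr : 0 < r) (hrc : spt μ r < c) (hK : MeasurableSet K)
    (hKr : K ⊆ Set.Ici r) : IntegrableOn (fun k => (c - spt μ k)⁻¹) K := by
  set d := c - spt μ r with hd
  have hd0 : 0 < d := sub_pos.2 hrc
  have hspt : Measurable fun k => spt μ k := by unfold spt; fun_prop
  refine ((integrable_inv_one_add_sq.const_mul (16 + (1 + r^2)/d)).integrableOn).mono'
    (hspt.const_sub c).inv.aestronglyMeasurable ?_
  filter_upwards [ae_restrict_mem hK] with k hk
  have hk' : r ≤ k := hKr hk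
  have h1 : c - spt μ k = (k^2 - r^2)/16 + d := by rw [hd]; unfold spt; ring
  have h2 : 0 ≤ k^2 - r^2 := by nlinarith
  rw [Real.norm_of_nonneg (by rw [h1]; positivity), h1, ← div_eq_mul_inv, inv_eq_one_div,
    div_le_div_iff₀ (by positivity) (by positivity)]
  have h3 : (1 + r^2)/d*d = 1 + r^2 := by field_simp
  have h4 : 0 ≤ (1 + r^2)/d := by positivity
  nlinarith [mul_nonneg h4 h2]

lemma integral_cauchy_spt_swap (hq : 0 < q.im) (hqc : q.re < c) (hr : 0 < r) (hrc : spt μ r < c)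
    (hK : MeasurableSet K) (hKr : K ⊆ Set.Ici r) {g : ℝ → ℂ} (hg : Continuous g) :
    IntervalIntegrable (fun u => (∫ k in K, 1/(segPt c q u - ((spt μ k : ℝ) : ℂ)))*g u*segDen c q u)
      volume 0 1 ∧
    (∫ u in (0:ℝ)..1, (∫ k in K, 1/(segPt c q u - ((spt μ k : ℝ) : ℂ)))*g u*segDen c q u).im
      = ∫ k in K, (∫ u in (0:ℝ)..1,
          1/(segPt c q u - ((spt μ k : ℝ) : ℂ))*g u*segDen c q u).im := by
  refine integral_cauchy_swap hq hqc hK (by unfold spt; fun_prop)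
    (W := fun k => ‖(c:ℂ) - q‖/q.im*(c - spt μ k)⁻¹) ?_
    (fun k hk u hu => norm_cauchy_le_inv hq ((spt_le_spt hr (hKr hk)).trans_lt hrc) hu) hg
  exact (integrableOn_inv_sub_spt hr hrc hK hKr).const_mul _

lemma integral_cauchy_spt (hq : 0 < q.im) (hqc : q.re < c) (hr : 0 < r) (hrc : spt μ r < c)
    (hK : MeasurableSet K) (hKr : K ⊆ Set.Ici r) :
    (∫ u in (0:ℝ)..1, (∫ k in K, 1/(segPt c q u - ((spt μ k : ℝ) : ℂ)))*1*segDen c q u).im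
      = -(π/2)*Fmom μ K 1 0 (q.re, q.im) := by
  rw [(integral_cauchy_spt_swap hq hqc hr hrc hK hKr (g := fun _ => 1) continuous_const).2, Fmom,
    ← integral_const_mul]
  refine setIntegral_congr_fun hK fun k hk => ?_
  simp only [mul_one]
  rw [integral_kernel_im hq hqc ((spt_le_spt hr (hKr hk)).trans_lt hrc)]; ring

lemma integral_cauchy_spt_mul (hq : 0 < q.im) (hqc : q.re < c) (hr : 0 < r) (hrc : spt μ r < c)
    (hK : MeasurableSet K) (hKr : K ⊆ Set.Ici r) :
    (∫ u in (0:ℝ)..1, (∫ k in K, 1/(segPt c q u - ((spt μ k : ℝ) : ℂ)))*segPt c q u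
        *segDen c q u).im
      = -(π/2)*(Gmom μ K (q.re, q.im) + q.re*Fmom μ K 1 0 (q.re, q.im)) := by
  rw [(integral_cauchy_spt_swap hq hqc hr hrc hK hKr continuous_segPt).2, Fmom, Gmom,
    ← integral_const_mul, ← integral_add (integrable_stream μ (p := (q.re, q.im)) hq).integrableOn
      ((integrable_kernel μ (n := 1) (j := 0) one_pos (p := (q.re, q.im)) hq).integrableOn.const_mul _),
    ← integral_const_mul]
  refine setIntegral_congr_fun hK fun k hk => ?_
  simp only
  rw [integral_segPt_kernel_im hq hqc ((spt_le_spt hr (hKr hk)).trans_lt hrc)]; ring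

end SpectralMoments

section ClosedForms

variable {α δ μ r : ℝ} {q : ℂ} {S Sp : ℂ → ℂ}

lemma spt_lt_zP (hα : 0 < α) (hrμ : r < μ) (hr : r^2 + 4*α*r = μ^2 - 4*(1 - α*δ)) :
    spt μ r < zP α δ μ := by
  have h : 0 < α*(μ - r)/4 := by have := sub_pos.2 hrμ; positivity
  rw [zP_eq_zpt hr, zpt]
  linarith

lemma Ip_eq_integral (hα : 0 < α) (hr0 : 0 < r) (hrμ : r < μ)
    (hr : r^2 + 4*α*r = μ^2 - 4*(1 - α*δ)) (h : SSpec α δ μ q S Sp) (hq : 0 < q.im)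
    (hqc : q.re < zP α δ μ) (n : ℕ) :
    Ip α δ μ q Sp n
      = (-(2*π/α)*(∫ u in (0:ℝ)..1, segPt (zP α δ μ) q u^n*segDen (zP α δ μ) q u).re
      - (2/α)*((∫ u in (0:ℝ)..1, (∫ σ in spt μ r..zP α δ μ,
            1/(segPt (zP α δ μ) q u - (σ:ℂ)))*segPt (zP α δ μ) q u^n*segDen (zP α δ μ) q u).im
        + (∫ u in (0:ℝ)..1, (∫ σ in spt μ (r + 4*α)..zP α δ μ,
            1/(segPt (zP α δ μ) q u - (σ:ℂ)))*segPt (zP α δ μ) q u^n*segDen (zP α δ μ) q u).im)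
      + (1/2)*(∫ u in (0:ℝ)..1, (∫ k in Ioc r μ,
            1/(segPt (zP α δ μ) q u - ((spt μ k : ℝ) : ℂ)))*segPt (zP α δ μ) q u^n
              *segDen (zP α δ μ) q u).im
      - (1/2)*(∫ u in (0:ℝ)..1, (∫ k in Ioi (r + 4*α),
            1/(segPt (zP α δ μ) q u - ((spt μ k : ℝ) : ℂ)))*segPt (zP α δ μ) q u^n
              *segDen (zP α δ μ) q u).im) := by
  have hrc := spt_lt_zP hα hrμ hr
  have hRc : spt μ (r + 4*α) < zP α δ μ := (spt_le_spt hr0 (by linarith)).trans_lt hrc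
  set c := zP α δ μ with hc
  have hg : Continuous fun u => segPt c q u^n := continuous_segPt.pow n
  have i0 : IntervalIntegrable (fun u => segPt c q u^n*segDen c q u) volume 0 1 :=
    intervalIntegrable_mul_segDen hq hqc hg.continuousOn
  have i1 := (integral_cauchy_interval_swap hq hqc hrc hg).1
  have i2 := (integral_cauchy_interval_swap hq hqc hRc hg).1
  have i3 := (integral_cauchy_spt_swap hq hqc hr0 hrc (K := Ioc r μ) measurableSet_Ioc
    (fun k hk => hk.1.le) hg).1
  have i4 := (integral_cauchy_spt_swap hq hqc hr0 hrc (K := Ioi (r + 4*α)) measurableSet_Ioi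
    (fun k hk => by have : r + 4*α < k := hk
                    show r ≤ k
                    linarith) hg).1
  have key : (∫ u in (0:ℝ)..1, deriv (Phi α δ μ) (segB α δ μ q u) * (segB α δ μ q u)^n
        / Sp (segB α δ μ q u) * ((c : ℂ) - q))
      = (-(2*π/α : ℝ)*Complex.I)*(∫ u in (0:ℝ)..1, segPt c q u^n*segDen c q u)
      + ((-(2/α) : ℝ) : ℂ)*((∫ u in (0:ℝ)..1, (∫ σ in spt μ r..c,
            1/(segPt c q u - (σ:ℂ)))*segPt c q u^n*segDen c q u)
        + ∫ u in (0:ℝ)..1, (∫ σ in spt μ (r + 4*α)..c,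
            1/(segPt c q u - (σ:ℂ)))*segPt c q u^n*segDen c q u)
      + ((1/2 : ℝ) : ℂ)*((∫ u in (0:ℝ)..1, (∫ k in Ioc r μ,
            1/(segPt c q u - ((spt μ k : ℝ) : ℂ)))*segPt c q u^n*segDen c q u)
        - ∫ u in (0:ℝ)..1, (∫ k in Ioi (r + 4*α),
            1/(segPt c q u - ((spt μ k : ℝ) : ℂ)))*segPt c q u^n*segDen c q u) := by
    rw [← intervalIntegral.integral_add i1 i2, ← intervalIntegral.integral_sub i3 i4,
      ← intervalIntegral.integral_const_mul, ← intervalIntegral.integral_const_mul,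
      ← intervalIntegral.integral_const_mul,
      ← intervalIntegral.integral_add (i0.const_mul _) ((i1.add i2).const_mul _),
      ← intervalIntegral.integral_add ((i0.const_mul _).add ((i1.add i2).const_mul _))
        ((i3.sub i4).const_mul _), intervalIntegral.integral_of_le zero_le_one,
      intervalIntegral.integral_of_le zero_le_one, integral_Ioc_eq_integral_Ioo,
      integral_Ioc_eq_integral_Ioo]
    refine setIntegral_congr_fun measurableSet_Ioo fun u hu => ?_
    have hB := boundary_eq_segRoot h hq hqc hu.1 hu.2
    have him : 0 < (segB α δ μ q u).im := by
      have := segPt_im (c := c) (q := q) u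
      rw [show segB α δ μ q u = segPt c q u from rfl, this]
      exact mul_pos (by linarith [hu.2]) hq
    simp only [hB, deriv_Phi_eq hα hr0 hrμ hr him]
    rw [← hc, show segB α δ μ q u = segPt c q u from rfl]
    unfold segDen
    push_cast
    ring
  unfold Ip
  rw [key]
  simp only [Complex.add_im, Complex.sub_im, Complex.im_ofReal_mul]
  rw [← Complex.ofReal_neg, mul_assoc, Complex.im_ofReal_mul, Complex.I_mul_im]
  ring

lemma Ip_zero_eq (hα : 0 < α) (hr0 : 0 < r) (hrμ : r < μ)
    (hr : r^2 + 4*α*r = μ^2 - 4*(1 - α*δ)) (h : SSpec α δ μ q S Sp) (hq : 0 < q.im)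
    (hqc : q.re < zP α δ μ) :
    Ip α δ μ q Sp 0 = I0fun α μ r (q.re, q.im) := by
  have hrc := spt_lt_zP hα hrμ hr
  have hRc : spt μ (r + 4*α) < zP α δ μ := (spt_le_spt hr0 (by linarith)).trans_lt hrc
  rw [Ip_eq_integral hα hr0 hrμ hr h hq hqc]
  simp only [pow_zero]
  rw [integral_cauchy_interval hq hqc hrc, integral_cauchy_interval hq hqc hRc,
    integral_cauchy_spt hq hqc hr0 hrc measurableSet_Ioc (fun k hk => hk.1.le),
    integral_cauchy_spt hq hqc hr0 hrc measurableSet_Ioi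
      (fun k hk => by have : r + 4*α < k := hk
                      show r ≤ k
                      linarith)]
  simp only [one_mul]
  rw [integral_segDen hq hqc]
  unfold I0fun
  simp
  ring

lemma Ip_one_eq (hα : 0 < α) (hr0 : 0 < r) (hrμ : r < μ)
    (hr : r^2 + 4*α*r = μ^2 - 4*(1 - α*δ)) (h : SSpec α δ μ q S Sp) (hq : 0 < q.im)
    (hqc : q.re < zP α δ μ) :
    Ip α δ μ q Sp 1 = q.re*I0fun α μ r (q.re, q.im) + N0fun α μ r (q.re, q.im) := by
  have hrc := spt_lt_zP hα hrμ hr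
  have hRc : spt μ (r + 4*α) < zP α δ μ := (spt_le_spt hr0 (by linarith)).trans_lt hrc
  rw [Ip_eq_integral hα hr0 hrμ hr h hq hqc]
  simp only [pow_one]
  rw [integral_cauchy_interval_mul hq hqc hrc, integral_cauchy_interval_mul hq hqc hRc,
    integral_cauchy_spt_mul hq hqc hr0 hrc measurableSet_Ioc (fun k hk => hk.1.le),
    integral_cauchy_spt_mul hq hqc hr0 hrc measurableSet_Ioi
      (fun k hk => by have : r + 4*α < k := hk
                      show r ≤ k
                      linarith)]
  rw [integral_segPt_mul_segDen hq hqc]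
  unfold I0fun N0fun
  rw [zP_eq_zpt hr]
  simp
  ring

end ClosedForms

section Continuation

/-- A property that is relatively clopen on a preconnected set and holds somewhere holds everywhere. -/
lemma forall_mem_of_clopen {I : Set ℝ} (hI : IsPreconnected I) {P : ℝ → Prop}
    (hopen : ∀ t ∈ I, P t → ∀ᶠ s in 𝓝[I] t, P s)
    (hclosed : ∀ t ∈ I, (∃ᶠ s in 𝓝[I] t, P s) → P t)
    {a : ℝ} (ha : a ∈ I) (hPa : P a) : ∀ t ∈ I, P t := by
  have : PreconnectedSpace I := Subtype.preconnectedSpace hI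
  have hcl : IsClopen {t : I | P t} := by
    constructor
    · rw [isClosed_iff_frequently]
      intro t ht
      refine hclosed t t.2 ?_
      rw [nhdsWithin_eq_map_subtype_coe t.2, frequently_map]
      exact ht
    · rw [isOpen_iff_eventually]
      intro t ht
      have h := hopen t t.2 ht
      rw [nhdsWithin_eq_map_subtype_coe t.2, eventually_map] at h
      exact h
  have h := hcl.eq_univ ⟨⟨a, ha⟩, hPa⟩
  intro t ht
  have h2 : (⟨t, ht⟩ : I) ∈ {t : I | P t} := h ▸ Set.mem_univ _
  exact h2

/-- Zero set of a smooth map near a point with injective partial derivative: a smooth curve. -/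
lemma exists_local_curve {F : ℝ × (ℝ × ℝ) → ℝ × ℝ} {O : Set (ℝ × (ℝ × ℝ))} (hO : IsOpen O)
    (hF : ContDiffOn ℝ (⊤ : ℕ∞) F O) {y : ℝ × (ℝ × ℝ)} (hy : y ∈ O) (hFy : F y = 0)
    (hinj : ∀ w : ℝ × ℝ, fderiv ℝ F y (0, w) = 0 → w = 0) :
    ∃ U : Set (ℝ × (ℝ × ℝ)), IsOpen U ∧ U ⊆ O ∧ y ∈ U ∧ ∃ ε : ℝ, 0 < ε ∧ ∃ g : ℝ → ℝ × ℝ,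
      ContDiffOn ℝ (⊤ : ℕ∞) g (Set.Ioo (y.1 - ε) (y.1 + ε)) ∧ g y.1 = y.2 ∧
      (∀ t ∈ Set.Ioo (y.1 - ε) (y.1 + ε), (t, g t) ∈ U ∧ F (t, g t) = 0) ∧
      ∀ t ∈ Set.Ioo (y.1 - ε) (y.1 + ε), ∀ p, (t, p) ∈ U → F (t, p) = 0 → p = g t := by
  set G : ℝ × (ℝ × ℝ) → ℝ × (ℝ × ℝ) := fun z => (z.1, F z) with hG
  have hGs : ContDiffOn ℝ (⊤ : ℕ∞) G O := contDiffOn_fst.prodMk hF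
  have hGat : ∀ z ∈ O, ContDiffAt ℝ (⊤ : ℕ∞) G z := fun z hz => hGs.contDiffAt (hO.mem_nhds hz)
  have htop : ((⊤ : ℕ∞) : WithTop ℕ∞) ≠ 0 := by simp
  have hGd : ∀ z ∈ O, HasFDerivAt G (fderiv ℝ G z) z := fun z hz =>
    ((hGat z hz).differentiableAt htop).hasFDerivAt
  have hGy : fderiv ℝ G y = (ContinuousLinearMap.fst ℝ ℝ (ℝ × ℝ)).prod (fderiv ℝ F y) := by
    refine HasFDerivAt.fderiv ?_
    exact hasFDerivAt_fst.prodMk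
      (((hF.contDiffAt (hO.mem_nhds hy)).differentiableAt htop).hasFDerivAt)
  have hker : Function.Injective (fderiv ℝ G y).toLinearMap := by
    rw [injective_iff_map_eq_zero]
    rintro ⟨τ, w⟩ hw
    have hw' : fderiv ℝ G y (τ, w) = 0 := hw
    rw [hGy] at hw'
    have h1 : τ = 0 := congrArg Prod.fst hw'
    have h2 : fderiv ℝ F y (τ, w) = 0 := congrArg Prod.snd hw'
    subst h1
    rw [hinj w h2]; rfl
  set L : (ℝ × (ℝ × ℝ)) ≃L[ℝ] (ℝ × (ℝ × ℝ)) :=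
    (LinearEquiv.ofInjectiveEndo _ hker).toContinuousLinearEquiv with hL
  have hLc : (L : (ℝ × (ℝ × ℝ)) →L[ℝ] (ℝ × (ℝ × ℝ))) = fderiv ℝ G y := by
    ext <;> rfl
  have hLd : HasFDerivAt G (L : (ℝ × (ℝ × ℝ)) →L[ℝ] (ℝ × (ℝ × ℝ))) y := hLc ▸ hGd y hy
  set e := (hGat y hy).toOpenPartialHomeomorph G hLd htop with he
  have hecoe : ∀ z, e z = G z := fun z => rfl
  have hR : IsOpen (O ∩ fderiv ℝ G ⁻¹' (Set.range
      ((↑) : ((ℝ × (ℝ × ℝ)) ≃L[ℝ] (ℝ × (ℝ × ℝ))) → (ℝ × (ℝ × ℝ)) →L[ℝ] (ℝ × (ℝ × ℝ))))) :=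
    (hGs.continuousOn_fderiv_of_isOpen hO (by simp)).isOpen_inter_preimage hO
      ContinuousLinearEquiv.isOpen
  set U := e.source ∩ (O ∩ fderiv ℝ G ⁻¹' (Set.range
      ((↑) : ((ℝ × (ℝ × ℝ)) ≃L[ℝ] (ℝ × (ℝ × ℝ))) → (ℝ × (ℝ × ℝ)) →L[ℝ] (ℝ × (ℝ × ℝ))))) with hU
  have hUo : IsOpen U := e.open_source.inter hR
  have hyU : y ∈ U := ⟨(hGat y hy).mem_toOpenPartialHomeomorph_source hLd htop, hy, L, hLc⟩
  have hV : IsOpen (e '' U) :=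
    (e.isOpen_image_iff_of_subset_source Set.inter_subset_left).2 hUo
  have hcont : Continuous fun t : ℝ => ((t, (0 : ℝ × ℝ)) : ℝ × (ℝ × ℝ)) := by fun_prop
  have hmem : y.1 ∈ (fun t : ℝ => ((t, (0 : ℝ × ℝ)) : ℝ × (ℝ × ℝ))) ⁻¹' (e '' U) :=
    ⟨y, hyU, by rw [hecoe, hG]; simp only [hFy]⟩
  obtain ⟨ε, hε, hball⟩ := Metric.isOpen_iff.1 (hV.preimage hcont) _ hmem
  rw [Real.ball_eq_Ioo] at hball
  have hsol : ∀ t ∈ Set.Ioo (y.1 - ε) (y.1 + ε), ∃ p, (t, p) ∈ U ∧ F (t, p) = 0 ∧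
      e.symm (t, 0) = (t, p) := by
    intro t ht
    obtain ⟨⟨t', p⟩, hz, hzt⟩ := hball ht
    rw [hecoe] at hzt
    have h1 : t' = t := congrArg Prod.fst hzt
    have h2 : F (t', p) = 0 := congrArg Prod.snd hzt
    subst h1
    refine ⟨p, hz, h2, ?_⟩
    have h3 := e.left_inv hz.1
    rw [hecoe, hG] at h3
    simp only [h2] at h3
    exact h3
  refine ⟨U, hUo, fun z hz => hz.2.1, hyU, ε, hε, fun t => (e.symm (t, 0)).2, ?_, ?_, ?_, ?_⟩
  · intro t ht
    refine ContDiffAt.contDiffWithinAt ?_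
    obtain ⟨p, hp, hFp, hs⟩ := hsol t ht
    obtain ⟨-, hpO, L', hL'⟩ := hp
    have htar : ((t, 0) : ℝ × (ℝ × ℝ)) ∈ e.target := by
      obtain ⟨z, hz, hzt⟩ := hball ht
      have h := e.map_source hz.1
      rw [hzt] at h
      exact h
    have h1 : ContDiffAt ℝ (⊤ : ℕ∞) e.symm (t, 0) := by
      refine e.contDiffAt_symm (f₀' := L') htar ?_ ?_
      · rw [hs, hL']; exact hGd _ hpO
      · rw [hs]; exact hGat _ hpO
    have h2 : ContDiffAt ℝ (⊤ : ℕ∞) (fun t : ℝ => ((t, (0 : ℝ × ℝ)) : ℝ × (ℝ × ℝ))) t :=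
      contDiffAt_id.prodMk contDiffAt_const
    exact contDiffAt_snd.comp t (h1.comp t h2)
  · have h3 := e.left_inv hyU.1
    rw [hecoe, hG] at h3
    simp only [hFy] at h3
    simp only [h3]
  · intro t ht
    obtain ⟨p, hp, hFp, hs⟩ := hsol t ht
    simp only [hs]; exact ⟨hp, hFp⟩
  · intro t ht p hp hFp
    have h3 := e.left_inv hp.1
    rw [hecoe, hG] at h3
    simp only [hFp] at h3
    simp only [h3]

end Continuation

/-- The reduced moment conditions as a function of `(t, (Re q, Im q))`. -/
def resid (α μ r x : ℝ) (y : ℝ × (ℝ × ℝ)) : ℝ × ℝ :=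
  ((2*π/α^2)*(4*y.2.1*y.1 + α*x - y.1) + I0fun α μ r y.2,
    N0fun α μ r y.2 - (4*π/α^2)*y.1*y.2.2^2)

section Residual

variable {α δ μ r x : ℝ}

lemma contDiffOn_resid (α μ r x : ℝ) :
    ContDiffOn ℝ (⊤ : ℕ∞) (resid α μ r x) {y | 0 < y.2.2} := by
  have h1 : ContDiffOn ℝ (⊤ : ℕ∞) (fun y : ℝ × (ℝ × ℝ) => I0fun α μ r y.2) {y | 0 < y.2.2} :=
    (contDiffOn_I0fun α μ r).comp contDiffOn_snd fun y hy => hy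
  have h2 : ContDiffOn ℝ (⊤ : ℕ∞) (fun y : ℝ × (ℝ × ℝ) => N0fun α μ r y.2) {y | 0 < y.2.2} :=
    (contDiffOn_N0fun α μ r).comp contDiffOn_snd fun y hy => hy
  unfold resid
  refine ContDiffOn.prodMk (ContDiffOn.add (ContDiff.contDiffOn ?_) h1)
    (h2.sub (ContDiff.contDiffOn ?_)) <;> fun_prop

lemma hasFDerivAt_resid_slice (t : ℝ) {p : ℝ × ℝ} (hp : 0 < p.2) :
    HasFDerivAt (fun p => resid α μ r x (t, p))
      (((I0a α μ r p + 8*π/α^2*t) • ContinuousLinearMap.fst ℝ ℝ ℝ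
          + (N0a α μ r p/p.2) • ContinuousLinearMap.snd ℝ ℝ ℝ).prod
        (N0a α μ r p • ContinuousLinearMap.fst ℝ ℝ ℝ
          + (-(p.2*(I0a α μ r p + 8*π/α^2*t))) • ContinuousLinearMap.snd ℝ ℝ ℝ)) p := by
  have e1 : HasFDerivAt (fun p : ℝ × ℝ => (2*π/α^2)*(4*p.1*t + α*x - t))
      ((8*π/α^2*t) • ContinuousLinearMap.fst ℝ ℝ ℝ) p := by
    refine HasFDerivAt.congr_fderiv (f := fun p : ℝ × ℝ => (2*π/α^2)*(4*p.1*t + α*x - t))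
      ((((((hasFDerivAt_fst (𝕜 := ℝ) (p := p)).const_mul 4).mul_const t).add_const (α*x)).sub_const
        t).const_mul (2*π/α^2)) ?_
    ext <;> simp
    ring
  have e2 : HasFDerivAt (fun p : ℝ × ℝ => (4*π/α^2)*t*p.2^2)
      ((8*π/α^2*t*p.2) • ContinuousLinearMap.snd ℝ ℝ ℝ) p := by
    refine HasFDerivAt.congr_fderiv (f := fun p : ℝ × ℝ => (4*π/α^2)*t*p.2^2)
      (((hasFDerivAt_snd (𝕜 := ℝ) (p := p)).pow 2).const_mul ((4*π/α^2)*t)) ?_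
    ext <;> simp
    ring
  unfold resid
  refine HasFDerivAt.congr_fderiv ((e1.add (hasFDerivAt_I0fun α μ r hp)).prodMk
    ((hasFDerivAt_N0fun α μ r hp).sub e2)) ?_
  ext <;> simp <;> ring

lemma fderiv_resid_injective (hα : 0 < α) (hr : 0 < r) {y : ℝ × (ℝ × ℝ)} (ht : 0 ≤ y.1)
    (hy : 0 < y.2.2) (w : ℝ × ℝ) (hw : fderiv ℝ (resid α μ r x) y (0, w) = 0) : w = 0 := by
  have hopen : IsOpen {y : ℝ × (ℝ × ℝ) | 0 < y.2.2} :=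
    isOpen_lt continuous_const (by fun_prop)
  have hd : HasFDerivAt (resid α μ r x) (fderiv ℝ (resid α μ r x) y) (y.1, y.2) :=
    (((contDiffOn_resid α μ r x).contDiffAt (hopen.mem_nhds hy)).differentiableAt
      (by simp)).hasFDerivAt
  have h1 := hd.comp y.2 (hasFDerivAt_prodMk_right (𝕜 := ℝ) y.1 y.2)
  have h2 := hasFDerivAt_resid_slice (α := α) (μ := μ) (r := r) (x := x) y.1 hy
  have h3 := congrArg (fun L => L w) (h1.unique h2)
  simp only [ContinuousLinearMap.comp_apply, ContinuousLinearMap.inr_apply, hw] at h3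
  have h4 := congrArg Prod.fst h3
  have h5 := congrArg Prod.snd h3
  simp at h4 h5
  have hg := gradient_pos (α := α) (μ := μ) hα hr hy
  have ha : 0 ≤ 8*π/α^2*y.1 := by positivity
  set A := I0a α μ r y.2 + 8*π/α^2*y.1 with hA
  set B := N0a α μ r y.2 with hB
  set b := y.2.2 with hb
  have hpos : 0 < b^2*A + (spt μ r - y.2.1)*B := by
    rw [hA]; nlinarith [mul_nonneg (sq_nonneg b) ha]
  have hAB : 0 < b^2*A^2 + B^2 := by
    rcases eq_or_ne A 0 with h | h
    · have : B ≠ 0 := by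
        rintro hB0
        rw [h, hB0] at hpos; simp at hpos
      positivity
    · have := pow_pos hy 2
      positivity
  have h4' : 0 = b*A*w.1 + B*w.2 := by
    have := congrArg (fun s => b*s) h4
    field_simp at this
    linarith
  have k1 : (b^2*A^2 + B^2)*w.1 = 0 := by linear_combination -b*A*h4' - B*h5
  have k2 : (b^2*A^2 + B^2)*w.2 = 0 := by linear_combination -B*h4' + b*A*h5
  exact Prod.ext ((mul_eq_zero.1 k1).resolve_left hAB.ne')
    ((mul_eq_zero.1 k2).resolve_left hAB.ne')

/-- The moment conditions are equivalent to the vanishing of `resid`. -/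
lemma moments_iff_resid (hα : 0 < α) (hr0 : 0 < r) (hrμ : r < μ)
    (hr : r^2 + 4*α*r = μ^2 - 4*(1 - α*δ)) {I0 I1 : ℂ → ℝ}
    (hfam : ∀ q : ℂ, 0 < q.im → q.re < zP α δ μ →
      ∃ S Splus : ℂ → ℂ, SSpec α δ μ q S Splus ∧
        I0 q = Ip α δ μ q Splus 0 ∧ I1 q = Ip α δ μ q Splus 1)
    {q : ℂ} (hq : 0 < q.im) (hqc : q.re < zP α δ μ) (t : ℝ) :
    (M0abs α I0 q x t = 0 ∧ M1abs α I1 q x t = 0) ↔ resid α μ r x (t, (q.re, q.im)) = 0 := by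
  obtain ⟨S, Sp, hS, h0, h1⟩ := hfam q hq hqc
  rw [Ip_zero_eq hα hr0 hrμ hr hS hq hqc] at h0
  rw [Ip_one_eq hα hr0 hrμ hr hS hq hqc] at h1
  have e0 : M0abs α I0 q x t = (resid α μ r x (t, (q.re, q.im))).1 := by
    unfold M0abs resid; rw [h0]; simp only; ring
  have e1 : M1abs α I1 q x t = q.re*(resid α μ r x (t, (q.re, q.im))).1
      + (resid α μ r x (t, (q.re, q.im))).2 := by
    unfold M1abs resid
    rw [h1, ← Complex.normSq_eq_norm_sq, Complex.normSq_apply, pow_two q, Complex.mul_re]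
    simp only; ring
  rw [e0, e1, Prod.ext_iff]
  simp only [Prod.fst_zero, Prod.snd_zero]
  constructor
  · rintro ⟨h, h'⟩
    refine ⟨h, ?_⟩
    rw [h] at h'; simpa using h'
  · rintro ⟨h, h'⟩
    rw [h, h']; simp

/-- Vanishing residual prevents the endpoint from reaching the vertical line through `z_P`. -/
lemma re_ne_of_resid (hα : 0 < α) (hr0 : 0 < r) (hr : r^2 + 4*α*r = μ^2 - 4*(1 - α*δ))
    {t : ℝ} (ht : 0 ≤ t) {p : ℝ × ℝ} (hp : 0 < p.2) (h : (resid α μ r x (t, p)).2 = 0) :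
    p.1 ≠ zP α δ μ := by
  intro hz
  rw [zP_eq_zpt hr] at hz
  have h1 := N0fun_neg_of_eq hα hr0 hp hz
  unfold resid at h
  simp only at h
  have : 0 ≤ (4*π/α^2)*t*p.2^2 := by positivity
  linarith

end Residual

section Initial

variable {α δ μ r x : ℝ}

lemma exists_parameter (hα : 0 < α) (hT1 : α * |μ| > |1 - α*δ|) (hT2 : μ^2 > 4*(1 - α*δ))
    (hT3 : 0 < μ) :
    ∃ r, 0 < r ∧ r < μ ∧ μ < r + 4*α ∧ r^2 + 4*α*r = μ^2 - 4*(1 - α*δ) := by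
  rw [abs_of_pos hT3] at hT1
  obtain ⟨h1, h2⟩ := abs_lt.1 hT1
  set m := μ^2 - 4*(1 - α*δ) with hm
  have hmpos : 0 < m := by linarith
  have hs := Real.sq_sqrt (show 0 ≤ 4*α^2 + m by positivity)
  have hlt : 2*α < √(4*α^2 + m) := Real.lt_sqrt_of_sq_lt (by linarith)
  set s := √(4*α^2 + m)
  have hr : (s - 2*α)^2 + 4*α*(s - 2*α) = m := by linear_combination hs
  have hr0 : 0 < s - 2*α := by linarith
  refine ⟨s - 2*α, hr0, ?_, ?_, hr⟩
  · by_contra! h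
    nlinarith
  · by_contra! h
    nlinarith

lemma rho0_eq (x : ℝ) : rho0 x = 1 - Real.tanh x^2 := by
  have h := (Real.cosh_pos x).ne'
  have h2 := Real.cosh_sq x
  rw [rho0, sech, Real.tanh_eq_sinh_div_cosh]
  field_simp
  linarith

lemma chiC_root_ofReal {zx : ℂ}
    (hroot : ∀ z : ℂ, chiC α δ μ x z = 16 * (z - zx) * (z - conj zx)) (z : ℝ) :
    (4*z - 1 + α*(δ + μ*Real.tanh x))^2 + 16*α^2*(1 - Real.tanh x^2)*z
      = 16*((z - zx.re)^2 + zx.im^2) := by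
  have h := congrArg Complex.re (hroot z)
  rw [chiC, rho0_eq, u0] at h
  have e1 : (4*(z:ℂ) - 1 + ((α * (δ + μ*Real.tanh x) : ℝ) : ℂ))^2
      + ((16*α^2*(1 - Real.tanh x^2) : ℝ) : ℂ) * z
      = (((4*z - 1 + α*(δ + μ*Real.tanh x))^2 + 16*α^2*(1 - Real.tanh x^2)*z : ℝ) : ℂ) := by
    push_cast; ring
  have e2 : 16*((z:ℂ) - zx)*((z:ℂ) - conj zx)
      = ((16*((z - zx.re)^2 + zx.im^2) : ℝ) : ℂ) := by
    have : zx = zx.re + zx.im*Complex.I := (Complex.re_add_im zx).symm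
    have h' : conj zx = zx.re - zx.im*Complex.I := by
      apply Complex.ext <;> simp
    rw [h']
    nth_rewrite 1 [this]
    push_cast
    linear_combination 16*(zx.im:ℂ)^2*(-Complex.I_sq)
  rw [e1, e2, Complex.ofReal_re, Complex.ofReal_re] at h
  exact h

lemma quart_eq_of_root (hr : r^2 + 4*α*r = μ^2 - 4*(1 - α*δ)) {zx : ℂ}
    (hroot : ∀ z : ℂ, chiC α δ μ x z = 16 * (z - zx) * (z - conj zx)) (k : ℝ) :
    quart α μ r (Real.tanh x) k = 16*sdist (spt μ k) (zx.re, zx.im)^2 := by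
  have h := chiC_root_ofReal hroot (spt μ k)
  rw [sdist_sq]
  simp only
  rw [← h, quart, spt, hr]
  ring

lemma re_lt_zP_of_root (hα : 0 < α) (hμ : 0 < μ) {zx : ℂ}
    (hroot : ∀ z : ℂ, chiC α δ μ x z = 16 * (z - zx) * (z - conj zx)) : zx.re < zP α δ μ := by
  have h1 := chiC_root_ofReal hroot 1
  have h2 := chiC_root_ofReal hroot (-1)
  have t1 := Real.neg_one_lt_tanh x
  have t2 := Real.tanh_lt_one x
  set T := Real.tanh x
  have p1 : 0 < α*μ*(1 + T) := by
    have : 0 < 1 + T := by linarith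
    positivity
  have p2 : 0 < α^2*((1 - T)*(1 + T)) := by
    have : 0 < 1 + T := by linarith
    have : 0 < 1 - T := by linarith
    positivity
  rw [zP]
  nlinarith

lemma resid_initial (hα : 0 < α) (hr0 : 0 < r) (hrμ : r < μ) (hμR : μ < r + 4*α)
    (hr : r^2 + 4*α*r = μ^2 - 4*(1 - α*δ)) {zx : ℂ} (him : 0 < zx.im)
    (hroot : ∀ z : ℂ, chiC α δ μ x z = 16 * (z - zx) * (z - conj zx)) :
    resid α μ r x (0, (zx.re, zx.im)) = 0 := by
  have hq := quart_eq_of_root hr hroot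
  have hp : 0 < ((zx.re, zx.im) : ℝ × ℝ).2 := him
  have H := pencilData_of_quart hα hr0 hrμ hμR (Real.neg_one_lt_tanh x) (Real.tanh_lt_one x) hp hq
  have h1 := N0fun_of_quart H hp hq
  have h2 := I0fun_of_quart H hp hq
  rw [resid]
  simp only
  rw [h1, h2]
  ext
  · simp only [Prod.fst_zero]
    field_simp
    ring
  · simp

end Initial

section Evolution

lemma eqOn_of_locally_unique {U : Set (ℝ × (ℝ × ℝ))} (hU : IsOpen U)
    {F : ℝ × (ℝ × ℝ) → ℝ × ℝ} {g p : ℝ → ℝ × ℝ} {J : Set ℝ} (hJ : IsPreconnected J)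
    (hg : ContinuousOn g J) (hgU : ∀ t ∈ J, (t, g t) ∈ U)
    (huniq : ∀ t ∈ J, ∀ q, (t, q) ∈ U → F (t, q) = 0 → q = g t)
    (hp : ContinuousOn p J) (hpF : ∀ t ∈ J, (t, p t) ∈ U → F (t, p t) = 0)
    {a : ℝ} (ha : a ∈ J) (hpa : p a = g a) : ∀ t ∈ J, p t = g t := by
  refine forall_mem_of_clopen hJ ?_ ?_ ha hpa
  · intro t ht h
    have hmem : (t, p t) ∈ U := h ▸ hgU t ht
    have hc : ContinuousWithinAt (fun s => (s, p s)) J t :=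
      continuousWithinAt_id.prodMk (hp t ht)
    filter_upwards [hc.eventually (hU.mem_nhds hmem), self_mem_nhdsWithin] with s hs hsJ
    exact huniq s hsJ _ hs (hpF s hsJ hs)
  · intro t ht h
    by_contra hne
    have hc : ContinuousWithinAt (fun s => p s - g s) J t := (hp t ht).sub (hg t ht)
    have := hc.eventually (isOpen_ne.mem_nhds (sub_ne_zero.2 hne))
    refine h (this.mono fun s hs => ?_)
    exact sub_ne_zero.1 hs

variable {α δ μ r x : ℝ}

lemma isOpen_region (z : ℝ) : IsOpen {y : ℝ × (ℝ × ℝ) | 0 < y.2.2 ∧ y.2.1 < z} :=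
  (isOpen_lt (f := fun _ => (0 : ℝ)) (g := fun y : ℝ × (ℝ × ℝ) => y.2.2) continuous_const
    (by fun_prop)).inter
    (isOpen_lt (f := fun y : ℝ × (ℝ × ℝ) => y.2.1) (g := fun _ => z) (by fun_prop)
      continuous_const)

/-- Along a curve of endpoints starting to the left of `z_P`, the endpoint stays there. -/
lemma re_lt_of_moments (hα : 0 < α) (hr0 : 0 < r) (hr : r^2 + 4*α*r = μ^2 - 4*(1 - α*δ))
    {T : ℝ} (hT : 0 < T) {p : ℝ → ℝ × ℝ} (hp : ContinuousOn p (Set.Ico 0 T))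
    (hpos : ∀ t ∈ Set.Ico 0 T, 0 < (p t).2)
    (hres : ∀ t ∈ Set.Ico 0 T, (p t).1 < zP α δ μ → resid α μ r x (t, p t) = 0)
    (h0 : (p 0).1 < zP α δ μ) : ∀ t ∈ Set.Ico 0 T, (p t).1 < zP α δ μ := by
  refine forall_mem_of_clopen isPreconnected_Ico ?_ ?_ (Set.left_mem_Ico.2 hT) h0
  · intro t ht h
    exact (hp t ht).fst.eventually (isOpen_Iio.mem_nhds h)
  · intro t ht h
    have hle : (p t).1 ≤ zP α δ μ := by
      by_contra! hlt
      refine h (((hp t ht).fst.eventually (isOpen_Ioi.mem_nhds hlt)).mono fun s hs => ?_)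
      exact not_lt.2 (le_of_lt hs)
    have hc : ContinuousWithinAt (fun s => resid α μ r x (s, p s)) (Set.Ico 0 T) t := by
      have hR : ContinuousAt (resid α μ r x) (t, p t) :=
        (contDiffOn_resid α μ r x).continuousOn.continuousAt
          ((isOpen_lt continuous_const (by fun_prop)).mem_nhds (hpos t ht))
      exact ContinuousAt.comp_continuousWithinAt (f := fun s => (s, p s)) hR
        (continuousWithinAt_id.prodMk (hp t ht))
    have hz : resid α μ r x (t, p t) = 0 := by
      by_contra hne
      refine h ?_
      filter_upwards [hc.eventually (isOpen_ne.mem_nhds hne), self_mem_nhdsWithin] with s hs hsI hlt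
      exact hs (hres s hsI hlt)
    exact lt_of_le_of_ne hle
      (re_ne_of_resid hα hr0 hr ht.1 (hpos t ht) (congrArg Prod.snd hz))

lemma exists_limit_point (hα : 0 < α) (hr0 : 0 < r) (hr : r^2 + 4*α*r = μ^2 - 4*(1 - α*δ))
    {T : ℝ} (hT : 0 < T) {p : ℝ → ℝ × ℝ}
    (hpos : ∀ t ∈ Set.Ico 0 T, 0 < (p t).2) (hlt : ∀ t ∈ Set.Ico 0 T, (p t).1 < zP α δ μ)
    (hres : ∀ t ∈ Set.Ico 0 T, resid α μ r x (t, p t) = 0)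
    (hnot : ¬ Tendsto (fun t => (p t).2) (𝓝[<] T) (𝓝 0)) :
    ∃ p' : ℝ × ℝ, 0 < p'.2 ∧ p'.1 < zP α δ μ ∧ resid α μ r x (T, p') = 0 ∧
      ∀ V ∈ 𝓝 ((T, p') : ℝ × (ℝ × ℝ)), ∃ᶠ t in 𝓝[<] T, (t, p t) ∈ V := by
  have hev : ∀ᶠ t in 𝓝[<] T, t ∈ Set.Ico 0 T := Ico_mem_nhdsLT hT
  have hε : ∃ ε > 0, ∃ᶠ t in 𝓝[<] T, ε ≤ (p t).2 := by
    by_contra! hcon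
    refine hnot (Metric.tendsto_nhds.2 fun ε hε => ?_)
    filter_upwards [hev, hcon ε hε] with t ht ht2
    rw [Real.dist_eq, sub_zero, abs_of_pos (hpos t ht)]
    exact ht2
  obtain ⟨ε, hε, hfreq⟩ := hε
  set 𝒰 : Ultrafilter ℝ := @Ultrafilter.of _ (𝓝[<] T ⊓ 𝓟 {t | ε ≤ (p t).2})
    (frequently_mem_iff_neBot.1 hfreq) with h𝒰
  have hle : (𝒰 : Filter ℝ) ≤ 𝓝[<] T ⊓ 𝓟 {t | ε ≤ (p t).2} :=
    @Ultrafilter.of_le _ _ (frequently_mem_iff_neBot.1 hfreq)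
  have hle1 : (𝒰 : Filter ℝ) ≤ 𝓝[<] T := hle.trans inf_le_left
  have hle2 : ∀ᶠ t in (𝒰 : Filter ℝ), ε ≤ (p t).2 :=
    le_principal_iff.1 (hle.trans inf_le_right)
  have hev' : ∀ᶠ t in (𝒰 : Filter ℝ), t ∈ Set.Ico 0 T := hle1 hev
  set C := 2*zpt α μ r - spt μ r - spt μ (r + 4*α) with hC
  have hbd : ∀ t ∈ Set.Ico 0 T, sdist (spt μ r) (p t) ≤ C := by
    intro t ht
    refine sdist_le_of_N0fun_nonneg hα hr0 (hpos t ht) ?_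
    have h := congrArg Prod.snd (hres t ht)
    simp only [resid, Prod.snd_zero] at h
    have : 0 ≤ (4*π/α^2)*t*(p t).2^2 := by have := ht.1; positivity
    linarith
  set K : Set (ℝ × ℝ) := Set.Icc (spt μ r - C, ε) (zP α δ μ, C) with hK
  have hmem : ∀ᶠ t in (𝒰 : Filter ℝ), p t ∈ K := by
    filter_upwards [hev', hle2] with t ht ht2
    have h1 := (abs_sub_le_sdist (spt μ r) (p t)).trans (hbd t ht)
    have h2 := (le_sdist (spt μ r) (p t)).trans (hbd t ht)
    have h3 := (abs_le.1 h1).2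
    exact ⟨⟨by simp only; linarith, ht2⟩, ⟨(hlt t ht).le, h2⟩⟩
  obtain ⟨p', hp'K, hp'⟩ := isCompact_Icc.ultrafilter_le_nhds (𝒰.map p)
    (le_principal_iff.2 hmem : _ ≤ 𝓟 K)
  have hp't : Tendsto p 𝒰 (𝓝 p') := hp'
  have hp'pos : 0 < p'.2 := hε.trans_le hp'K.1.2
  have hpair : Tendsto (fun t => (t, p t)) 𝒰 (𝓝 (T, p')) :=
    Tendsto.prodMk_nhds (hle1.trans nhdsWithin_le_nhds) hp't
  have hR : ContinuousAt (resid α μ r x) (T, p') :=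
    (contDiffOn_resid α μ r x).continuousOn.continuousAt
      ((isOpen_lt continuous_const (by fun_prop)).mem_nhds hp'pos)
  have hz : resid α μ r x (T, p') = 0 := by
    refine tendsto_nhds_unique (hR.tendsto.comp hpair) (tendsto_const_nhds.congr' ?_)
    filter_upwards [hev'] with t ht
    exact (hres t ht).symm
  refine ⟨p', hp'pos, lt_of_le_of_ne hp'K.2.1
    (re_ne_of_resid hα hr0 hr hT.le hp'pos (congrArg Prod.snd hz)), hz, fun V hV => ?_⟩
  exact (hpair.eventually hV).frequently.filter_mono hle1

end Evolution

section Conclusion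

variable {α δ μ r x : ℝ}

lemma exists_endpoint_curve (hα : 0 < α) (hr0 : 0 < r) {t : ℝ} (ht : 0 ≤ t) {p : ℝ × ℝ}
    (hp : 0 < p.2) (hpz : p.1 < zP α δ μ) (hres : resid α μ r x (t, p) = 0) :
    ∃ U : Set (ℝ × (ℝ × ℝ)), IsOpen U ∧ U ⊆ {y | 0 < y.2.2 ∧ y.2.1 < zP α δ μ} ∧ (t, p) ∈ U ∧
      ∃ ε : ℝ, 0 < ε ∧ ∃ g : ℝ → ℝ × ℝ,
      ContDiffOn ℝ (⊤ : ℕ∞) g (Set.Ioo (t - ε) (t + ε)) ∧ g t = p ∧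
      (∀ s ∈ Set.Ioo (t - ε) (t + ε), (s, g s) ∈ U ∧ resid α μ r x (s, g s) = 0) ∧
      ∀ s ∈ Set.Ioo (t - ε) (t + ε), ∀ p, (s, p) ∈ U → resid α μ r x (s, p) = 0 → p = g s :=
  exists_local_curve (y := (t, p)) (isOpen_region (zP α δ μ))
    ((contDiffOn_resid α μ r x).mono fun _ hy => hy.1) ⟨hp, hpz⟩ hres
    (fun w hw => fderiv_resid_injective hα hr0 ht hp w hw)

lemma exists_extension (hα : 0 < α) (hr0 : 0 < r) (hr : r^2 + 4*α*r = μ^2 - 4*(1 - α*δ))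
    {T : ℝ} (hT : 0 < T) {p : ℝ → ℝ × ℝ} (hp : ContDiffOn ℝ (⊤ : ℕ∞) p (Set.Ico 0 T))
    (hpos : ∀ t ∈ Set.Ico 0 T, 0 < (p t).2) (hlt : ∀ t ∈ Set.Ico 0 T, (p t).1 < zP α δ μ)
    (hres : ∀ t ∈ Set.Ico 0 T, resid α μ r x (t, p t) = 0)
    (hnot : ¬ Tendsto (fun t => (p t).2) (𝓝[<] T) (𝓝 0)) :
    ∃ T' : ℝ, ∃ pe : ℝ → ℝ × ℝ, T < T' ∧ ContDiffOn ℝ (⊤ : ℕ∞) pe (Set.Ico 0 T') ∧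
      (∀ t ∈ Set.Ico 0 T, pe t = p t) ∧
      ∀ t ∈ Set.Ico 0 T', 0 < (pe t).2 ∧ (pe t).1 < zP α δ μ ∧ resid α μ r x (t, pe t) = 0 := by
  obtain ⟨p', hp', hp'z, hz, hV⟩ := exists_limit_point hα hr0 hr hT hpos hlt hres hnot
  obtain ⟨U, hU, hUO, hmem, ε, hε, g, hg, -, hgU, huniq⟩ :=
    exists_endpoint_curve hα hr0 hT.le hp' hp'z hz
  have hev : ∀ᶠ t in 𝓝[<] T, t ∈ Set.Ico (max 0 (T - ε/2)) T :=
    Ico_mem_nhdsLT (max_lt hT (by linarith))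
  obtain ⟨t₁, h1U, ht1⟩ := ((hV U (hU.mem_nhds hmem)).and_eventually hev).exists
  have ht0 : 0 ≤ t₁ := (le_max_left _ _).trans ht1.1
  have htε : T - ε < t₁ := by have := (le_max_right _ _).trans ht1.1; linarith
  have hsub : Set.Ico t₁ T ⊆ Set.Ioo (T - ε) (T + ε) := fun t ht =>
    ⟨htε.trans_le ht.1, by linarith [ht.2]⟩
  have hsub0 : Set.Ico t₁ T ⊆ Set.Ico 0 T := Set.Ico_subset_Ico_left ht0
  have heq : ∀ t ∈ Set.Ico t₁ T, p t = g t :=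
    eqOn_of_locally_unique hU isPreconnected_Ico (hg.continuousOn.mono hsub)
      (fun t ht => (hgU t (hsub ht)).1) (fun t ht => huniq t (hsub ht))
      (hp.continuousOn.mono hsub0) (fun t ht _ => hres t (hsub0 ht))
      (Set.left_mem_Ico.2 ht1.2)
      (huniq t₁ (hsub (Set.left_mem_Ico.2 ht1.2)) _ h1U (hres t₁ ⟨ht0, ht1.2⟩))
  set pe : ℝ → ℝ × ℝ := fun t => if t < T then p t else g t with hpe
  have hpe1 : ∀ t, t < T → pe t = p t := fun t ht => if_pos ht
  have hpe2 : ∀ t, t₁ ≤ t → pe t = g t := by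
    intro t ht
    by_cases h : t < T
    · rw [hpe1 t h, heq t ⟨ht, h⟩]
    · exact if_neg h
  refine ⟨T + ε, pe, by linarith, ?_, fun t ht => hpe1 t ht.2, ?_⟩
  · intro t ht
    by_cases h : t < T
    · have h1 : ContDiffWithinAt ℝ (⊤ : ℕ∞) pe (Set.Ico 0 T) t :=
        (hp t ⟨ht.1, h⟩).congr (fun s hs => hpe1 s hs.2) (hpe1 t h)
      refine h1.mono_of_mem_nhdsWithin ?_
      filter_upwards [self_mem_nhdsWithin, mem_nhdsWithin_of_mem_nhds (isOpen_Iio.mem_nhds h)]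
        with s hs hs2 using ⟨hs.1, hs2⟩
    · have h' : t₁ < t := ht1.2.trans_le (not_lt.1 h)
      have h1 : ContDiffAt ℝ (⊤ : ℕ∞) g t :=
        hg.contDiffAt (isOpen_Ioo.mem_nhds ⟨htε.trans h', ht.2⟩)
      refine (h1.congr_of_eventuallyEq ?_).contDiffWithinAt
      filter_upwards [isOpen_Ioi.mem_nhds h'] with s hs
      exact hpe2 s (le_of_lt hs)
  · intro t ht
    by_cases h : t < T
    · rw [hpe1 t h]
      exact ⟨hpos t ⟨ht.1, h⟩, hlt t ⟨ht.1, h⟩, hres t ⟨ht.1, h⟩⟩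
    · have h' : t₁ < t := ht1.2.trans_le (not_lt.1 h)
      rw [hpe2 t h'.le]
      obtain ⟨h1, h2⟩ := hgU t ⟨htε.trans h', ht.2⟩
      exact ⟨(hUO h1).1, (hUO h1).2, h2⟩

end Conclusion

/-- for fixed `x < x_c`, the endpoint `q(x,t)` exists and is unique near
`t = 0` with `q(x,0) = 𝔷(x)`, and for `t > 0` it continues smoothly as long as
`Im q(x,t)` stays positive; at a finite maximal time `t*`, `Im q(x,t) → 0`. -/
theorem endpoint_continuation_in_time (α δ μ : ℝ) (hα : 0 < α)
    (hT1 : α * |μ| > |1 - α*δ|) (hT2 : μ^2 > 4*(1 - α*δ)) (hT3 : 0 < μ)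
    (I0 I1 : ℂ → ℝ)
    (hfam : ∀ q : ℂ, 0 < q.im → q.re < zP α δ μ →
      ∃ S Splus : ℂ → ℂ, SSpec α δ μ q S Splus ∧
        I0 q = Ip α δ μ q Splus 0 ∧ I1 q = Ip α δ μ q Splus 1)
    (x : ℝ) (hx : x < arctanh (Tcrit α δ μ))
    (zx : ℂ) (him : 0 < zx.im)
    (hroot : ∀ z : ℂ, chiC α δ μ x z = 16 * (z - zx) * (z - conj zx)) :
    (∃ t₀ : ℝ, 0 < t₀ ∧ ∃ qt : ℝ → ℂ,
      ContDiffOn ℝ (⊤ : ℕ∞) qt (Set.Ioo (-t₀) t₀) ∧ qt 0 = zx ∧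
      (∀ t ∈ Set.Ioo (-t₀) t₀, 0 < (qt t).im ∧
        M0abs α I0 (qt t) x t = 0 ∧ M1abs α I1 (qt t) x t = 0) ∧
      ∀ qs : ℝ → ℂ, ContDiffOn ℝ (⊤ : ℕ∞) qs (Set.Ioo (-t₀) t₀) → qs 0 = zx →
        (∀ t ∈ Set.Ioo (-t₀) t₀, 0 < (qs t).im ∧
          M0abs α I0 (qs t) x t = 0 ∧ M1abs α I1 (qs t) x t = 0) →
        ∀ t ∈ Set.Ioo (-t₀) t₀, qs t = qt t) ∧
    (∀ tstar : ℝ, 0 < tstar → ∀ qs : ℝ → ℂ,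
      ContDiffOn ℝ (⊤ : ℕ∞) qs (Set.Ico 0 tstar) → qs 0 = zx →
      (∀ t ∈ Set.Ico 0 tstar, 0 < (qs t).im ∧
        M0abs α I0 (qs t) x t = 0 ∧ M1abs α I1 (qs t) x t = 0) →
      (¬ ∃ t₂ : ℝ, ∃ qext : ℝ → ℂ, tstar < t₂ ∧
        ContDiffOn ℝ (⊤ : ℕ∞) qext (Set.Ico 0 t₂) ∧
        (∀ t ∈ Set.Ico 0 tstar, qext t = qs t) ∧
        (∀ t ∈ Set.Ico 0 t₂, 0 < (qext t).im ∧
          M0abs α I0 (qext t) x t = 0 ∧ M1abs α I1 (qext t) x t = 0)) →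
      Filter.Tendsto (fun t => (qs t).im) (𝓝[<] tstar) (𝓝 0)) := by
  obtain ⟨r, hr0, hrμ, hμR, hr⟩ := exists_parameter hα hT1 hT2 hT3
  have hz0 : zx.re < zP α δ μ := re_lt_zP_of_root hα hT3 hroot
  have hR0 := resid_initial hα hr0 hrμ hμR hr him hroot
  have hmom := fun (q : ℂ) (hq : 0 < q.im) (hqc : q.re < zP α δ μ) (t : ℝ) =>
    moments_iff_resid (x := x) hα hr0 hrμ hr hfam hq hqc t
  have hcoe : ∀ {q : ℝ → ℂ} {J : Set ℝ}, ContDiffOn ℝ (⊤ : ℕ∞) q J →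
      ContDiffOn ℝ (⊤ : ℕ∞) (fun t => ((q t).re, (q t).im)) J := fun h =>
    Complex.equivRealProdCLM.contDiff.comp_contDiffOn h
  have hlift : ∀ {g : ℝ → ℝ × ℝ} {J : Set ℝ}, ContDiffOn ℝ (⊤ : ℕ∞) g J →
      ContDiffOn ℝ (⊤ : ℕ∞) (fun t => (⟨(g t).1, (g t).2⟩ : ℂ)) J := fun h =>
    Complex.equivRealProdCLM.symm.contDiff.comp_contDiffOn h
  constructor
  · obtain ⟨U, hU, hUO, -, ε, hε, g, hg, hg0, hgU, huniq⟩ :=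
      exists_endpoint_curve hα hr0 le_rfl him hz0 hR0
    rw [zero_sub, zero_add] at hg hgU huniq
    refine ⟨ε, hε, fun t => ⟨(g t).1, (g t).2⟩, hlift hg, by simp only [hg0], fun t ht => ?_,
      fun qs hqs hqs0 hqsM => ?_⟩
    · obtain ⟨h1, h2⟩ := hgU t ht
      exact ⟨(hUO h1).1, (hmom ⟨(g t).1, (g t).2⟩ (hUO h1).1 (hUO h1).2 t).2 h2⟩
    · have key := eqOn_of_locally_unique (p := fun t => ((qs t).re, (qs t).im)) hU
        isPreconnected_Ioo hg.continuousOn (fun t ht => (hgU t ht).1) huniq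
        (hcoe hqs).continuousOn
        (fun t ht h => (hmom (qs t) (hUO h).1 (hUO h).2 t).1 (hqsM t ht).2)
        (a := 0) ⟨by linarith, hε⟩ (by simp only [hqs0, hg0])
      intro t ht
      simp only [← key t ht]
  · intro T hT qs hqs hqs0 hqsM hmax
    by_contra hnot
    have hpos : ∀ t ∈ Set.Ico 0 T, 0 < (qs t).im := fun t ht => (hqsM t ht).1
    have hlt : ∀ t ∈ Set.Ico 0 T, (qs t).re < zP α δ μ :=
      re_lt_of_moments (x := x) (p := fun t => ((qs t).re, (qs t).im)) hα hr0 hr hT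
        (hcoe hqs).continuousOn hpos
        (fun t ht h => (hmom (qs t) (hpos t ht) h t).1 (hqsM t ht).2) (by simpa only [hqs0])
    obtain ⟨T', pe, hTT', hpe, hagree, hsol⟩ :=
      exists_extension (x := x) (p := fun t => ((qs t).re, (qs t).im)) hα hr0 hr hT (hcoe hqs)
        hpos hlt (fun t ht => (hmom (qs t) (hpos t ht) (hlt t ht) t).1 (hqsM t ht).2) hnot
    refine hmax ⟨T', fun t => ⟨(pe t).1, (pe t).2⟩, hTT', hlift hpe, fun t ht => ?_,
      fun t ht => ?_⟩
    · simp only [hagree t ht]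
    · obtain ⟨h1, h2, h3⟩ := hsol t ht
      exact ⟨h1, (hmom ⟨(pe t).1, (pe t).2⟩ h1 h2 t).2 h3⟩
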